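/- Let T = (G, S, L) be a canvas such that S is an induced path of length two. If no chord of the boundary of the outer face of G exists, then there exists at most one proper L-coloring of S that does not extend to an L-coloring of G. -/

import Mathlib

/-!
Common definitions: plane graphs (given by a concrete embedding in the plane),
outer face, canvases, list colorings, governments, harmonicas and coloring
harmonicas, following Postle–Thomas,
"Five-list-coloring graphs on surfaces III".
-/

open Set

universe u

/-- A finite simple graph together with an embedding in the plane:
each vertex gets a point, each edge a simple arc joining its endpoints;
arcs avoid other vertices, and two distinct edges meet only in common
endpoints. -/
structure PlaneGraph (V : Type u) where
  verts : Set V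
  Adj : V → V → Prop
  finite_verts : verts.Finite
  adj_symm : ∀ u v, Adj u v → Adj v u
  adj_irrefl : ∀ v, ¬Adj v v
  adj_mem : ∀ u v, Adj u v → u ∈ verts
  pos : V → ℝ × ℝ
  arc : Sym2 V → Set (ℝ × ℝ)
  pos_injOn : Set.InjOn pos verts
  arc_arc : ∀ u v, Adj u v → ∃ f : ℝ → ℝ × ℝ,
    ContinuousOn f (Set.Icc 0 1) ∧ Set.InjOn f (Set.Icc 0 1) ∧
    f '' Set.Icc 0 1 = arc s(u, v) ∧ f 0 = pos u ∧ f 1 = pos v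
  arc_avoid : ∀ u v, Adj u v → ∀ w ∈ verts, pos w ∈ arc s(u, v) → w = u ∨ w = v
  arc_meet : ∀ u v x y, Adj u v → Adj x y → s(u, v) ≠ s(x, y) →
    arc s(u, v) ∩ arc s(x, y) ⊆ pos '' (({u, v} : Set V) ∩ ({x, y} : Set V))

namespace PlaneGraph

variable {V : Type u}

/-- The point set of the drawing of the plane graph. -/
def image (G : PlaneGraph V) : Set (ℝ × ℝ) :=
  G.pos '' G.verts ∪ ⋃ (u : V) (v : V) (_ : G.Adj u v), G.arc s(u, v)

/-- The outer (unbounded) face of the drawing. -/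
def outerFace (G : PlaneGraph V) : Set (ℝ × ℝ) :=
  {p | p ∉ G.image ∧ ¬Bornology.IsBounded (connectedComponentIn G.imageᶜ p)}

/-- A vertex incident with (i.e. on the boundary of) the outer face. -/
def OnOuter (G : PlaneGraph V) (v : V) : Prop := G.pos v ∈ frontier G.outerFace

/-- An edge incident with (i.e. on the boundary of) the outer face. -/
def EdgeOnOuter (G : PlaneGraph V) (u v : V) : Prop :=
  G.arc s(u, v) ⊆ frontier G.outerFace

/-- The vertices of the boundary of the outer face. -/
def boundaryVerts (G : PlaneGraph V) : Set V := {v | v ∈ G.verts ∧ G.OnOuter v}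

/-- Connectivity of a plane graph. -/
def Connected (G : PlaneGraph V) : Prop :=
  G.verts.Nonempty ∧ ∀ u ∈ G.verts, ∀ v ∈ G.verts, Relation.ReflTransGen G.Adj u v

/-- `H` is a (plane) subgraph of `G`, drawn the same way. -/
def IsSubgraph (H G : PlaneGraph V) : Prop :=
  H.verts ⊆ G.verts ∧ (∀ u v, H.Adj u v → G.Adj u v) ∧
  (∀ v ∈ H.verts, H.pos v = G.pos v) ∧
  (∀ u v, H.Adj u v → H.arc s(u, v) = G.arc s(u, v))

/-- Delete a set of vertices (and all incident edges) from a plane graph. -/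
def deleteVerts (G : PlaneGraph V) (s : Set V) : PlaneGraph V where
  verts := G.verts \ s
  Adj u v := G.Adj u v ∧ u ∉ s ∧ v ∉ s
  finite_verts := G.finite_verts.subset Set.diff_subset
  adj_symm := fun u v h => ⟨G.adj_symm u v h.1, h.2.2, h.2.1⟩
  adj_irrefl := fun v h => G.adj_irrefl v h.1
  adj_mem := fun u v h => ⟨G.adj_mem u v h.1, h.2.1⟩
  pos := G.pos
  arc := G.arc
  pos_injOn := G.pos_injOn.mono Set.diff_subset
  arc_arc := fun u v h => G.arc_arc u v h.1
  arc_avoid := fun u v h w hw hm => G.arc_avoid u v h.1 w hw.1 hm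
  arc_meet := fun u v x y h h' hne => G.arc_meet u v x y h.1 h'.1 hne

/-- `G` has a proper coloring from the lists `L`. -/
def HasLColoring (G : PlaneGraph V) (L : V → Finset ℕ) : Prop :=
  ∃ φ : V → ℕ, (∀ v ∈ G.verts, φ v ∈ L v) ∧ ∀ u v, G.Adj u v → φ u ≠ φ v

/-- A vertex of degree exactly one. -/
def DegreeOne (G : PlaneGraph V) (x : V) : Prop :=
  (∃ a, G.Adj x a) ∧ ∀ a b, G.Adj x a → G.Adj x b → a = b

end PlaneGraph

/-- The cyclic successor of an index in a list. -/
def cycNext {V : Type u} (C : List V) (i : Fin C.length) : Fin C.length :=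
  ⟨((i : ℕ) + 1) % C.length, Nat.mod_lt _ (lt_of_le_of_lt (Nat.zero_le _) i.isLt)⟩

/-- The list `C` is a cycle of `G` whose image is exactly the boundary of the
outer face of `G`; i.e. `G` is a plane graph with outer cycle `C`. -/
def PlaneGraph.IsOuterCycle {V : Type u} (G : PlaneGraph V) (C : List V) : Prop :=
  C.Nodup ∧ 3 ≤ C.length ∧ (∀ v ∈ C, v ∈ G.verts) ∧
  (∀ i : Fin C.length, G.Adj (C.get i) (C.get (cycNext C i))) ∧
  frontier G.outerFace =
    G.pos '' {v | v ∈ C} ∪ ⋃ i : Fin C.length, G.arc s(C.get i, C.get (cycNext C i))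

/-- `pq` is an edge of the cycle (given as a list) `C`. -/
def IsCycleEdge {V : Type u} (C : List V) (p q : V) : Prop :=
  ∃ i : Fin C.length, s(p, q) = s(C.get i, C.get (cycNext C i))

/-- `(G, S, L)` is a canvas, where the subgraph `S` of the boundary of the
outer face of `G` is given by its vertex set `Sverts` and adjacency `SAdj`. -/
structure IsCanvas {V : Type u} (G : PlaneGraph V) (Sverts : Set V) (SAdj : V → V → Prop)
    (L : V → Finset ℕ) : Prop where
  sadj_symm : ∀ u v, SAdj u v → SAdj v u
  sadj_sub : ∀ u v, SAdj u v → G.Adj u v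
  sadj_mem : ∀ u v, SAdj u v → u ∈ Sverts
  sverts_sub : Sverts ⊆ G.verts
  sverts_outer : ∀ v ∈ Sverts, G.OnOuter v
  sedges_outer : ∀ u v, SAdj u v → G.EdgeOnOuter u v
  lists_nonempty : ∀ v ∈ G.verts, (L v).Nonempty
  card_inner : ∀ v ∈ G.verts, ¬G.OnOuter v → 5 ≤ (L v).card
  card_outside_S : ∀ v ∈ G.verts, v ∉ Sverts → 3 ≤ (L v).card
  scolorable : ∃ φ : V → ℕ, (∀ v ∈ Sverts, φ v ∈ L v) ∧ ∀ u v, SAdj u v → φ u ≠ φ v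

/-- The adjacency relation of the single-edge path `p₁p₂`. -/
def pathAdj {V : Type u} (p1 p2 : V) : V → V → Prop :=
  fun u v => (u = p1 ∧ v = p2) ∨ (u = p2 ∧ v = p1)

/-- `(G, P, L)` is a canvas whose precolored subgraph is a path `P = p₁p₂` of
length one (in the boundary of the outer face of `G`). -/
def IsPathCanvas {V : Type u} (G : PlaneGraph V) (p1 p2 : V) (L : V → Finset ℕ) : Prop :=
  p1 ≠ p2 ∧ IsCanvas G {p1, p2} (pathAdj p1 p2) L

/-- `c = (c₁, c₂)` is a proper `L`-coloring of the edge `p₁p₂`. -/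
def ProperEdgeColoring {V : Type u} (L : V → Finset ℕ) (p1 p2 : V) (c : ℕ × ℕ) : Prop :=
  c.1 ∈ L p1 ∧ c.2 ∈ L p2 ∧ c.1 ≠ c.2

/-- `Φ_T(P', 𝒞)`: the colorings of the edge `q₁q₂` extendable to an `L`-coloring
of `G` whose restriction to `p₁p₂` lies in `C`. -/
def Phi {V : Type u} (G : PlaneGraph V) (L : V → Finset ℕ) (p1 p2 q1 q2 : V)
    (C : Set (ℕ × ℕ)) : Set (ℕ × ℕ) :=
  {c | ∃ φ : V → ℕ, (∀ v ∈ G.verts, φ v ∈ L v) ∧ (∀ u v, G.Adj u v → φ u ≠ φ v) ∧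
    (φ p1, φ p2) ∈ C ∧ φ q1 = c.1 ∧ φ q2 = c.2}

/-- The set of colors used on the first vertex of the path. -/
def fstColors (C : Set (ℕ × ℕ)) : Set ℕ := Prod.fst '' C

/-- The set of colors used on the second vertex of the path. -/
def sndColors (C : Set (ℕ × ℕ)) : Set ℕ := Prod.snd '' C

/-- A dictatorship: at least two (distinct) colorings, all agreeing on one of
the two vertices (the dictator). -/
def IsDictatorship (C : Set (ℕ × ℕ)) : Prop :=
  (∃ c ∈ C, ∃ d ∈ C, c ≠ d) ∧
  ((∃ a, ∀ c ∈ C, c.1 = a) ∨ (∃ a, ∀ c ∈ C, c.2 = a))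

/-- A democracy: exactly the two colorings `(x, y)` and `(y, x)`. -/
def IsDemocracy (C : Set (ℕ × ℕ)) : Prop :=
  ∃ x y : ℕ, x ≠ y ∧ C = {(x, y), (y, x)}

/-- A government is a dictatorship or a democracy. -/
def IsGovernment (C : Set (ℕ × ℕ)) : Prop := IsDictatorship C ∨ IsDemocracy C

/-- A confederacy: not a government, but the union of two governments. -/
def IsConfederacy (C : Set (ℕ × ℕ)) : Prop :=
  ¬IsGovernment C ∧ ∃ C1 C2 : Set (ℕ × ℕ), IsGovernment C1 ∧ IsGovernment C2 ∧ C = C1 ∪ C2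

/-- The canvas `(G, p₁p₂, L)` is a harmonica from the path `p₁p₂` to the path
`q₁q₂` with government `C`. -/
inductive IsHarmonica {V : Type u} (L : V → Finset ℕ) :
    PlaneGraph V → V → V → V → V → Set (ℕ × ℕ) → Prop where
  /-- Rule (i): `G = P = P'`. -/
  | same (G : PlaneGraph V) (p1 p2 q1 q2 : V) (C : Set (ℕ × ℕ))
      (hcanvas : IsPathCanvas G p1 p2 L)
      (hproper : ∀ c ∈ C, ProperEdgeColoring L p1 p2 c)
      (hgov : IsGovernment C)
      (hq : (q1 = p1 ∧ q2 = p2) ∨ (q1 = p2 ∧ q2 = p1))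
      (hverts : G.verts = {p1, p2})
      (hedges : ∀ u v, G.Adj u v → pathAdj p1 p2 u v) :
      IsHarmonica L G p1 p2 q1 q2 C
  /-- Rule (ii): `C` is a dictatorship, `G = P ∪ P'`, `V(P) ∩ V(P') = {z}`
  where `z` is the dictator. -/
  | cherry (G : PlaneGraph V) (p1 p2 q1 q2 z : V) (C : Set (ℕ × ℕ))
      (hcanvas : IsPathCanvas G p1 p2 L)
      (hproper : ∀ c ∈ C, ProperEdgeColoring L p1 p2 c)
      (hdict : IsDictatorship C)
      (hq : q1 ≠ q2) (hqadj : G.Adj q1 q2) (hqout : G.EdgeOnOuter q1 q2)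
      (hverts : G.verts = {p1, p2, q1, q2})
      (hedges : ∀ u v, G.Adj u v → pathAdj p1 p2 u v ∨ pathAdj q1 q2 u v)
      (hz : (({p1, p2} : Set V) ∩ ({q1, q2} : Set V)) = {z})
      (hzdict : (z = p1 ∧ ∃ a, ∀ c ∈ C, c.1 = a) ∨ (z = p2 ∧ ∃ a, ∀ c ∈ C, c.2 = a)) :
      IsHarmonica L G p1 p2 q1 q2 C
  /-- Rule (iii): `C` is a dictatorship with dictator `z ∈ V(P)` in color `c`,
  sitting on a triangle `z u₁ u₂`. -/
  | dict (G : PlaneGraph V) (p1 p2 q1 q2 z w u1 u2 : V) (c : ℕ) (L0 : Finset ℕ)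
      (C C' : Set (ℕ × ℕ))
      (hcanvas : IsPathCanvas G p1 p2 L)
      (hproper : ∀ d ∈ C, ProperEdgeColoring L p1 p2 d)
      (hdict : IsDictatorship C)
      (hq : q1 ≠ q2) (hqadj : G.Adj q1 q2) (hqout : G.EdgeOnOuter q1 q2)
      (hz : (z = p1 ∧ w = p2 ∧ (∀ d ∈ C, d.1 = c) ∧
              (u1 = w → sndColors C = (L0 : Set ℕ)) ∧
              (u2 = w → sndColors C = (L0 : Set ℕ))) ∨
            (z = p2 ∧ w = p1 ∧ (∀ d ∈ C, d.2 = c) ∧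
              (u1 = w → fstColors C = (L0 : Set ℕ)) ∧
              (u2 = w → fstColors C = (L0 : Set ℕ))))
      (hzu1 : G.Adj z u1) (hzu2 : G.Adj z u2) (hu12 : G.Adj u1 u2)
      (hL0 : L0.card = 2)
      (hLu1 : u1 ∉ ({p1, p2} : Set V) → L u1 = L0 ∪ {c})
      (hLu2 : u2 ∉ ({p1, p2} : Set V) → L u2 = L0 ∪ {c})
      (hu1P : u1 ∈ ({p1, p2} : Set V) → u1 = w)
      (hu2P : u2 ∈ ({p1, p2} : Set V) → u2 = w)
      (hdem : IsDemocracy C')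
      (hC'1 : fstColors C' = (L0 : Set ℕ)) (hC'2 : sndColors C' = (L0 : Set ℕ))
      (hrec : IsHarmonica L (G.deleteVerts (({p1, p2} : Set V) \ {u1, u2})) u1 u2 q1 q2 C') :
      IsHarmonica L G p1 p2 q1 q2 C
  /-- Rule (iv), with `i = 1`: `C` is a democracy, `z` is a common neighbor of
  `p₁, p₂`, and `p₁` is deleted. -/
  | demo1 (G : PlaneGraph V) (p1 p2 q1 q2 z : V) (a b c : ℕ) (L0 : Finset ℕ)
      (C C' : Set (ℕ × ℕ))
      (hcanvas : IsPathCanvas G p1 p2 L)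
      (hproper : ∀ d ∈ C, ProperEdgeColoring L p1 p2 d)
      (hdemC : IsDemocracy C)
      (hq : q1 ≠ q2) (hqadj : G.Adj q1 q2) (hqout : G.EdgeOnOuter q1 q2)
      (hz1 : G.Adj z p1) (hz2 : G.Adj z p2)
      (hLz : L z = L0 ∪ {c})
      (hC1 : fstColors C = (L0 : Set ℕ)) (hC2 : sndColors C = (L0 : Set ℕ))
      (hab : a ≠ b) (hL0ab : (L0 : Set ℕ) = {a, b})
      (hC' : C' = {(c, a), (c, b)})
      (hrec : IsHarmonica L (G.deleteVerts {p1}) z p2 q1 q2 C') :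
      IsHarmonica L G p1 p2 q1 q2 C
  /-- Rule (iv), with `i = 2`: `C` is a democracy, `z` is a common neighbor of
  `p₁, p₂`, and `p₂` is deleted. -/
  | demo2 (G : PlaneGraph V) (p1 p2 q1 q2 z : V) (a b c : ℕ) (L0 : Finset ℕ)
      (C C' : Set (ℕ × ℕ))
      (hcanvas : IsPathCanvas G p1 p2 L)
      (hproper : ∀ d ∈ C, ProperEdgeColoring L p1 p2 d)
      (hdemC : IsDemocracy C)
      (hq : q1 ≠ q2) (hqadj : G.Adj q1 q2) (hqout : G.EdgeOnOuter q1 q2)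
      (hz1 : G.Adj z p1) (hz2 : G.Adj z p2)
      (hLz : L z = L0 ∪ {c})
      (hC1 : fstColors C = (L0 : Set ℕ)) (hC2 : sndColors C = (L0 : Set ℕ))
      (hab : a ≠ b) (hL0ab : (L0 : Set ℕ) = {a, b})
      (hC' : C' = {(c, a), (c, b)})
      (hrec : IsHarmonica L (G.deleteVerts {p2}) z p1 q1 q2 C') :
      IsHarmonica L G p1 p2 q1 q2 C

/-- `(G, L)` is a coloring harmonica from `uv` to `w` (source `Sum.inr (u, v)`)
or from `u` to `w` (source `Sum.inl u`). -/
inductive IsColoringHarmonica {V : Type u} [DecidableEq V] :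
    PlaneGraph V → (V → Finset ℕ) → V ⊕ V × V → V → Prop where
  /-- `G` is a triangle with vertex set `{u, v, w}`, `L(u) = L(v) = L(w)` and
  `|L(u)| = 2`. -/
  | tri (G : PlaneGraph V) (L : V → Finset ℕ) (u v w : V)
      (hconn : G.Connected) (huv : u ≠ v) (huw : u ≠ w) (hvw : v ≠ w)
      (hu : G.OnOuter u) (hv : G.OnOuter v) (hw : G.OnOuter w)
      (huvout : G.EdgeOnOuter u v)
      (hverts : G.verts = {u, v, w})
      (hadjuv : G.Adj u v) (hadjvw : G.Adj v w) (hadjuw : G.Adj u w)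
      (hLuv : L u = L v) (hLvw : L v = L w) (hcard : (L u).card = 2) :
      IsColoringHarmonica G L (Sum.inr (u, v)) w
  /-- There is a triangle `uvz` on the outer face; delete one or both of
  `u, v` and recurse from `z`. -/
  | step (G : PlaneGraph V) (L : V → Finset ℕ) (u v w z : V) (s : Set V)
      (hconn : G.Connected) (huv : u ≠ v) (huw : u ≠ w) (hvw : v ≠ w)
      (hu : G.OnOuter u) (hv : G.OnOuter v) (hw : G.OnOuter w)
      (huvout : G.EdgeOnOuter u v)
      (hadjuv : G.Adj u v) (hadjuz : G.Adj u z) (hadjvz : G.Adj v z)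
      (hz : G.OnOuter z)
      (hLuv : L u = L v) (hsub : L u ⊆ L z)
      (hcardu : (L u).card = 2) (hcardz : (L z).card = 3)
      (hs : s = {u} ∨ s = {v} ∨ s = ({u, v} : Set V))
      (hrec : IsColoringHarmonica (G.deleteVerts s)
        (Function.update L z (L z \ L u)) (Sum.inl z) w) :
      IsColoringHarmonica G L (Sum.inr (u, v)) w
  /-- `|L(u)| = 1`, `u` sits on a triangle `uxy`; delete `u` and recurse
  from `xy`. -/
  | vert (G : PlaneGraph V) (L : V → Finset ℕ) (u w x y : V)
      (hconn : G.Connected) (huw : u ≠ w)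
      (hu : G.OnOuter u) (hw : G.OnOuter w)
      (hx : G.OnOuter x) (hy : G.OnOuter y)
      (hadjux : G.Adj u x) (hadjuy : G.Adj u y) (hadjxy : G.Adj x y)
      (hcardu : (L u).card = 1)
      (hLxy : L x \ L u = L y \ L u) (hcardx : (L x \ L u).card = 2)
      (hrec : IsColoringHarmonica (G.deleteVerts {u})
        (Function.update (Function.update L x (L x \ L u)) y (L y \ L u))
        (Sum.inr (x, y)) w) :
      IsColoringHarmonica G L (Sum.inl u) w

/-- `(G, L)` contains a coloring harmonica `(H, L')` with the given source and
target: `H` is a subgraph of `G` and `L'` agrees with `L` on `V(H)`. -/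
def ContainsColoringHarmonica {V : Type u} [DecidableEq V] (G : PlaneGraph V)
    (L : V → Finset ℕ) (st : V ⊕ V × V) (w : V) : Prop :=
  ∃ (H : PlaneGraph V) (L' : V → Finset ℕ), H.IsSubgraph G ∧
    (∀ x ∈ H.verts, L' x = L x) ∧ IsColoringHarmonica H L' st w

/-- `v` is a cutvertex of the boundary of the outer face of `G`. -/
def BoundaryCutvertex {V : Type u} (G : PlaneGraph V) (v : V) : Prop :=
  ∃ a b : V, a ∈ G.boundaryVerts ∧ b ∈ G.boundaryVerts ∧ a ≠ v ∧ b ≠ v ∧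
    Relation.ReflTransGen (fun x y => G.Adj x y ∧ G.EdgeOnOuter x y) a b ∧
    ¬Relation.ReflTransGen
      (fun x y => G.Adj x y ∧ G.EdgeOnOuter x y ∧ x ≠ v ∧ y ≠ v) a b

open Classical in
/-- The list assignment of the democratic reduction `T(P, L0, x)`:
remove the colors of `L0` from the list of `x` and from the lists of all
neighbors of `P` other than `y`. -/
noncomputable def reducedL {V : Type u} (G : PlaneGraph V) (L : V → Finset ℕ)
    (L0 : Finset ℕ) (Q : List V) (x y : V) : V → Finset ℕ := fun w =>
  if w = x ∨ (w ≠ y ∧ ∃ p ∈ Q, G.Adj w p) then L w \ L0 else L w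

/-- The vertex set of the precolored subgraph of the democratic reduction:
`S ∖ V(P)`, together with `x` as an isolated vertex if its new list is
smaller than 3. -/
def reducedSverts {V : Type u} (Sverts : Set V) (Q : List V) (x : V)
    (L' : V → Finset ℕ) : Set V :=
  {v | (v ∈ Sverts ∧ v ∉ Q) ∨ (v = x ∧ (L' x).card < 3)}

/-- The adjacency of the precolored subgraph of the democratic reduction:
`S ∖ V(P)`. -/
def reducedSAdj {V : Type u} (SAdj : V → V → Prop) (Q : List V) : V → V → Prop :=
  fun u v => SAdj u v ∧ u ∉ Q ∧ v ∉ Q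



namespace BadCol

theorem exists_lift {A : Type*} [TopologicalSpace A] [SimplyConnectedSpace A]
    [LocallyPathConnectedSpace A] (f : A → ℂ) (hf : Continuous f)
    (h0 : ∀ a, f a ≠ 0) : ∃ θ : A → ℂ, Continuous θ ∧ ∀ a, Complex.exp (θ a) = f a := by
  obtain ⟨a₀⟩ : Nonempty A := inferInstance
  rcases Complex.isCoveringMapOn_exp.existsUnique_continuousMap_lifts
    ⟨f, hf⟩ (a₀ := a₀) (Complex.exp_log (h0 a₀)) (fun x ↦ h0 x) with ⟨F, ⟨-, hF⟩, -⟩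
  exact ⟨F, F.continuous, fun a => congrFun hF a⟩

theorem lift_unique (θ θ' : ℝ → ℂ) (h : Continuous θ) (h' : Continuous θ') (κ : ℂ) (hκ : κ ≠ 0)
    (he : ∀ t, Complex.exp (θ t) = κ * Complex.exp (θ' t)) :
    θ 1 - θ 0 = θ' 1 - θ' 0 := by
  let F : C(ℝ, ℂ) := ⟨θ, h⟩
  let F' : C(ℝ, ℂ) := ⟨fun t => θ' t + (θ 0 - θ' 0), by fun_prop⟩
  let E : C(ℝ, ℂ) := ⟨fun t => Complex.exp (θ t), by fun_prop⟩
  obtain ⟨G, -, hG⟩ := Complex.isCoveringMapOn_exp.existsUnique_continuousMap_lifts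
    E (a₀ := (0:ℝ)) (e₀ := θ 0) rfl (fun x ↦ Complex.exp_ne_zero _)
  have h1 := hG F ⟨rfl, rfl⟩
  have hk : Complex.exp (θ 0 - θ' 0) = κ := by
    rw [Complex.exp_sub, he 0]; field_simp [Complex.exp_ne_zero]
  have h2 := hG F' ⟨by simp [F'], by
    funext t
    simp only [Function.comp_apply, F', E, ContinuousMap.coe_mk]
    rw [Complex.exp_add, hk, he t, mul_comm]⟩
  have : F 1 = F' 1 := by rw [h1, h2]
  simp only [F, F', ContinuousMap.coe_mk] at this
  rw [this]; ring

open Classical in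
/-- total change of logarithm of `f t - P`, minus the difference of principal logs, over `2πi`. -/
noncomputable def nn (P : ℂ) (f : ℝ → ℂ) : ℤ :=
  if h : ∃ n : ℤ, ∃ θ : ℝ → ℂ, Continuous θ ∧ (∀ t, Complex.exp (θ t) = f t - P) ∧
      θ 1 - θ 0 = Complex.log (f 1 - P) - Complex.log (f 0 - P) + 2 * Real.pi * Complex.I * n
  then h.choose else 0

theorem nn_spec (P : ℂ) (f : ℝ → ℂ) (hP : ∀ t, f t ≠ P) (θ : ℝ → ℂ)
    (hθ : Continuous θ) (κ : ℂ) (hκ : κ ≠ 0) (he : ∀ t, Complex.exp (θ t) = κ * (f t - P)) :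
    θ 1 - θ 0 = Complex.log (f 1 - P) - Complex.log (f 0 - P) + 2 * Real.pi * Complex.I * nn P f := by
  have h : ∃ n : ℤ, ∃ θ : ℝ → ℂ, Continuous θ ∧ (∀ t, Complex.exp (θ t) = f t - P) ∧
      θ 1 - θ 0 = Complex.log (f 1 - P) - Complex.log (f 0 - P) + 2 * Real.pi * Complex.I * n := by
    have hk := Complex.exp_log hκ
    have e1 : ∀ t, Complex.exp (θ t - Complex.log κ) = f t - P := by
      intro t; rw [Complex.exp_sub, hk, he]; field_simp
    have n0 : ∀ t, f t - P ≠ 0 := fun t => sub_ne_zero.2 (hP t)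
    have : Complex.exp (θ 1 - θ 0) = Complex.exp (Complex.log (f 1 - P) - Complex.log (f 0 - P)) := by
      rw [Complex.exp_sub, Complex.exp_sub, he, he, Complex.exp_log (n0 _), Complex.exp_log (n0 _)]
      have := n0 0
      field_simp
    obtain ⟨n, hn⟩ := Complex.exp_eq_exp_iff_exists_int.1 this
    refine ⟨n, fun t => θ t - Complex.log κ, by fun_prop, e1, ?_⟩
    simp only
    linear_combination hn
  obtain ⟨θ', c', e', d'⟩ := h.choose_spec
  have : θ 1 - θ 0 = θ' 1 - θ' 0 :=
    lift_unique θ θ' hθ c' κ hκ (fun t => by rw [he, e'])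
  rw [this, d', nn, dif_pos h]

open Classical in
noncomputable def sg (P Q : ℂ) : ℤ :=
  if h : ∃ n : ℤ, Complex.log (Q - P) - Complex.log (P - Q) = Real.pi * Complex.I * (2 * n + 1)
  then 2 * h.choose + 1 else 0

theorem sg_spec (P Q : ℂ) (h : P ≠ Q) :
    Complex.log (Q - P) - Complex.log (P - Q) = Real.pi * Complex.I * sg P Q ∧
    ∃ n, sg P Q = 2 * n + 1 := by
  have h : ∃ n : ℤ, Complex.log (Q - P) - Complex.log (P - Q)
      = Real.pi * Complex.I * (2 * n + 1) := by
    have h1 : Q - P ≠ 0 := sub_ne_zero.2 h.symm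
    have h2 : P - Q ≠ 0 := sub_ne_zero.2 h
    have : Complex.exp (Complex.log (Q - P) - Complex.log (P - Q)) =
        Complex.exp (Real.pi * Complex.I) := by
      rw [Complex.exp_sub, Complex.exp_log h1, Complex.exp_log h2, Complex.exp_pi_mul_I]
      field_simp; ring
    obtain ⟨n, hn⟩ := Complex.exp_eq_exp_iff_exists_int.1 this
    exact ⟨n, by rw [hn]; ring⟩
  rw [sg, dif_pos h]
  refine ⟨?_, _, rfl⟩
  have := h.choose_spec
  push_cast; exact this

theorem pii : (Real.pi : ℂ) * Complex.I ≠ 0 := by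
  simp [Real.pi_ne_zero]

theorem sg_symm (P Q : ℂ) (h : P ≠ Q) : sg Q P = - sg P Q := by
  have h1 := (sg_spec P Q h).1
  have h2 := (sg_spec Q P h.symm).1
  have : (Real.pi : ℂ) * Complex.I * ((sg Q P : ℂ) + sg P Q) = 0 := by
    linear_combination -h1 - h2
  rcases mul_eq_zero.1 this with h | h
  · exact absurd h pii
  · have : ((sg Q P + sg P Q : ℤ) : ℂ) = 0 := by push_cast; exact h
    have := Int.cast_eq_zero.1 this
    omega

theorem key (e f : ℝ → ℂ) (he : Continuous e) (hf : Continuous f) (hd : ∀ s t, e s ≠ f t)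
    (A B C D : ℂ) (hA : e 0 = A) (hB : e 1 = B) (hC : f 0 = C) (hD : f 1 = D) :
    sg A D - sg A C - sg B D + sg B C + 2 * (nn A f + nn D e - nn B f - nn C e) = 0 := by
  subst hA hB hC hD
  obtain ⟨θ, hθ, hx⟩ := exists_lift (fun z : ℝ × ℝ => e z.1 - f z.2) (by fun_prop)
    (fun z => sub_ne_zero.2 (hd _ _))
  have r1 := nn_spec (e 0) f (fun t => (hd _ _).symm) (fun t => θ (0, t)) (by fun_prop) (-1)
    (by norm_num) (fun t => by rw [hx]; ring)
  have r2 := nn_spec (e 1) f (fun t => (hd _ _).symm) (fun t => θ (1, t)) (by fun_prop) (-1)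
    (by norm_num) (fun t => by rw [hx]; ring)
  have r3 := nn_spec (f 0) e (fun t => (hd _ _)) (fun t => θ (t, 0)) (by fun_prop) 1
    (by norm_num) (fun t => by rw [hx]; ring)
  have r4 := nn_spec (f 1) e (fun t => (hd _ _)) (fun t => θ (t, 1)) (by fun_prop) 1
    (by norm_num) (fun t => by rw [hx]; ring)
  have s1 := (sg_spec (e 0) (f 0) (hd _ _)).1
  have s2 := (sg_spec (e 0) (f 1) (hd _ _)).1
  have s3 := (sg_spec (e 1) (f 0) (hd _ _)).1
  have s4 := (sg_spec (e 1) (f 1) (hd _ _)).1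
  have : (Real.pi : ℂ) * Complex.I * ((sg (e 0) (f 1) : ℂ) - sg (e 0) (f 0) - sg (e 1) (f 1)
      + sg (e 1) (f 0) + 2 * (nn (e 0) f + nn (f 1) e - nn (e 1) f - nn (f 0) e)) = 0 := by
    linear_combination -r1 + r2 + r3 - r4 + s1 - s2 - s3 + s4
  have := (mul_eq_zero.1 this).resolve_left pii
  exact_mod_cast this

theorem addz {x y : ℤ} (hx : x = 0) (hy : y = 0) : x + y = 0 := by omega

theorem no_K33 (p q : Fin 3 → ℂ) (g : Fin 3 → Fin 3 → ℝ → ℂ) (hg : ∀ i j, Continuous (g i j))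
    (h0 : ∀ i j, g i j 0 = p i) (h1 : ∀ i j, g i j 1 = q j)
    (hd : ∀ i j k l, i ≠ k → j ≠ l → ∀ s t, g i j s ≠ g k l t) : False := by
  have hpp : ∀ i k, i ≠ k → p i ≠ p k := by
    intro i k hik h
    rw [← h0 i 0, ← h0 k 1] at h
    exact hd _ _ _ _ hik (by decide) _ _ h
  have hqq : ∀ i k, i ≠ k → q i ≠ q k := by
    intro i k hik h
    rw [← h1 0 i, ← h1 1 k] at h
    exact hd _ _ _ _ (by decide) hik _ _ h
  have hpq : ∀ i j, p i ≠ q j := by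
    intro i j h
    obtain ⟨k, hk⟩ := exists_ne i
    obtain ⟨l, hl⟩ := exists_ne j
    rw [← h0 i l, ← h1 k j] at h
    exact hd _ _ _ _ hk.symm hl _ _ h
  have K : ∀ i j k l, i ≠ k → j ≠ l → _ := fun i j k l hik hjl =>
    key (g i j) (g k l) (hg _ _) (hg _ _) (hd _ _ _ _ hik hjl) (p i) (q j) (p k) (q l)
      (h0 _ _) (h1 _ _) (h0 _ _) (h1 _ _)
  have S : ∀ i j, ∃ n, sg (p i) (q j) = 2 * n + 1 := fun i j => (sg_spec _ _ (hpq i j)).2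
  have S' : ∀ i j, sg (q j) (p i) = - sg (p i) (q j) := fun i j => sg_symm _ _ (hpq i j)
  have Q' : ∀ i j, i ≠ j → sg (q j) (q i) = - sg (q i) (q j) :=
    fun i j h => sg_symm _ _ (hqq i j h)
  have P1 : ∀ i j, i ≠ j → ∃ n, sg (p i) (p j) = 2 * n + 1 :=
    fun i j h => (sg_spec _ _ (hpp i j h)).2
  obtain ⟨n01, e01⟩ := P1 0 1 (by decide)
  obtain ⟨n02, e02⟩ := P1 0 2 (by decide)
  obtain ⟨n12, e12⟩ := P1 1 2 (by decide)
  obtain ⟨m00, f00⟩ := S 0 0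
  obtain ⟨m01, f01⟩ := S 0 1
  obtain ⟨m02, f02⟩ := S 0 2
  obtain ⟨m20, f20⟩ := S 2 0
  obtain ⟨m21, f21⟩ := S 2 1
  obtain ⟨m22, f22⟩ := S 2 2
  have q01 := Q' 0 1 (by decide)
  have q02 := Q' 0 2 (by decide)
  have q12 := Q' 1 2 (by decide)
  have a1 := K 0 0 1 1 (by decide) (by decide)
  have a2 := K 0 0 1 2 (by decide) (by decide)
  have a3 := K 0 1 1 0 (by decide) (by decide)
  have a4 := K 0 1 1 2 (by decide) (by decide)
  have a5 := K 0 2 1 0 (by decide) (by decide)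
  have a6 := K 0 2 1 1 (by decide) (by decide)
  have b1 := K 0 0 2 1 (by decide) (by decide)
  have b2 := K 0 0 2 2 (by decide) (by decide)
  have b3 := K 0 1 2 0 (by decide) (by decide)
  have b4 := K 0 1 2 2 (by decide) (by decide)
  have b5 := K 0 2 2 0 (by decide) (by decide)
  have b6 := K 0 2 2 1 (by decide) (by decide)
  have c1 := K 1 0 2 1 (by decide) (by decide)
  have c2 := K 1 0 2 2 (by decide) (by decide)
  have c3 := K 1 1 2 0 (by decide) (by decide)
  have c4 := K 1 1 2 2 (by decide) (by decide)
  have c5 := K 1 2 2 0 (by decide) (by decide)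
  have c6 := K 1 2 2 1 (by decide) (by decide)
  simp only [S'] at a1 a2 a3 a4 a5 a6 b1 b2 b3 b4 b5 b6 c1 c2 c3 c4 c5 c6
  have t := (addz a1 (addz a2 (addz a3 (addz a4 (addz a5 (addz a6 (addz b1 (addz b2 (addz b3 (addz b4 (addz b5 (addz b6 (addz c1 (addz c2 (addz c3 (addz c4 (addz c5 c6)))))))))))))))))
  clear K S S' Q' P1 a1 a2 a3 a4 a5 a6 b1 b2 b3 b4 b5 b6 c1 c2 c3 c4 c5 c6
  omega

theorem no_K5 (p : Fin 5 → ℂ) (g : Fin 5 → Fin 5 → ℝ → ℂ) (hg : ∀ i j, i < j → Continuous (g i j))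
    (h0 : ∀ i j, i < j → g i j 0 = p i) (h1 : ∀ i j, i < j → g i j 1 = p j)
    (hd : ∀ i j k l, i < j → k < l → i ≠ k → i ≠ l → j ≠ k → j ≠ l → ∀ s t, g i j s ≠ g k l t) :
    False := by
  have hp : ∀ i k : Fin 5, i < k → p i ≠ p k := by
    intro i k hik h
    have : ∃ j l : Fin 5, i ≠ j ∧ i ≠ l ∧ k ≠ j ∧ k ≠ l ∧ j < l := by
      clear h; revert i k; decide
    obtain ⟨j, l, a1, a2, a3, a4, a5⟩ := this
    have hi : ∃ s, (if i < j then g i j else g j i) s = p i := by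
      split_ifs with h
      · exact ⟨0, h0 _ _ h⟩
      · exact ⟨1, h1 _ _ (lt_of_le_of_ne (not_lt.1 h) a1.symm)⟩
    have hk : ∃ s, (if k < l then g k l else g l k) s = p k := by
      split_ifs with h
      · exact ⟨0, h0 _ _ h⟩
      · exact ⟨1, h1 _ _ (lt_of_le_of_ne (not_lt.1 h) a4.symm)⟩
    obtain ⟨s, hs⟩ := hi
    obtain ⟨t, ht⟩ := hk
    rw [← hs, ← ht] at h
    have n1 := hik.ne
    have n2 := a5.ne
    split_ifs at h with b1 b2 b2
    · exact hd _ _ _ _ b1 b2 n1 a2 a3.symm n2 _ _ h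
    · exact hd _ _ _ _ b1 (lt_of_le_of_ne (not_lt.1 b2) a4.symm) a2 n1 n2 a3.symm  _ _ h
    · exact hd _ _ _ _ (lt_of_le_of_ne (not_lt.1 b1) a1.symm) b2 a3.symm n2 n1 a2  _ _ h
    · exact hd _ _ _ _ (lt_of_le_of_ne (not_lt.1 b1) a1.symm)
        (lt_of_le_of_ne (not_lt.1 b2) a4.symm) n2 a3.symm a2 n1   _ _ h
  have K : ∀ i j k l, (i < j ∧ k < l ∧ i ≠ k ∧ i ≠ l ∧ j ≠ k ∧ j ≠ l) → _ :=
    fun i j k l ⟨a1, a2, a3, a4, a5, a6⟩ =>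
    key (g i j) (g k l) (hg _ _ a1) (hg _ _ a2) (hd _ _ _ _ a1 a2 a3 a4 a5 a6) (p i) (p j) (p k) (p l)
      (h0 _ _ a1) (h1 _ _ a1) (h0 _ _ a2) (h1 _ _ a2)
  have S : ∀ i j, i < j → ∃ n, sg (p i) (p j) = 2 * n + 1 := fun i j h => (sg_spec _ _ (hp i j h)).2
  have S' : ∀ i j, i < j → sg (p j) (p i) = - sg (p i) (p j) := fun i j h => sg_symm _ _ (hp i j h)
  obtain ⟨m01, f01⟩ := S 0 1 (by decide)
  obtain ⟨m02, f02⟩ := S 0 2 (by decide)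
  obtain ⟨m03, f03⟩ := S 0 3 (by decide)
  obtain ⟨m04, f04⟩ := S 0 4 (by decide)
  obtain ⟨m12, f12⟩ := S 1 2 (by decide)
  obtain ⟨m13, f13⟩ := S 1 3 (by decide)
  obtain ⟨m14, f14⟩ := S 1 4 (by decide)
  obtain ⟨m23, f23⟩ := S 2 3 (by decide)
  obtain ⟨m24, f24⟩ := S 2 4 (by decide)
  obtain ⟨m34, f34⟩ := S 3 4 (by decide)
  have s01 := S' 0 1 (by decide)
  have s02 := S' 0 2 (by decide)
  have s03 := S' 0 3 (by decide)
  have s04 := S' 0 4 (by decide)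
  have s12 := S' 1 2 (by decide)
  have s13 := S' 1 3 (by decide)
  have s14 := S' 1 4 (by decide)
  have s23 := S' 2 3 (by decide)
  have s24 := S' 2 4 (by decide)
  have s34 := S' 3 4 (by decide)
  have a1 := K 0 1 2 3 (by decide)
  have a2 := K 0 2 1 3 (by decide)
  have a3 := K 0 3 1 2 (by decide)
  have b1 := K 0 1 2 4 (by decide)
  have b2 := K 0 2 1 4 (by decide)
  have b3 := K 0 4 1 2 (by decide)
  have c1 := K 0 1 3 4 (by decide)
  have c2 := K 0 3 1 4 (by decide)
  have c3 := K 0 4 1 3 (by decide)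
  have d1 := K 0 2 3 4 (by decide)
  have d2 := K 0 3 2 4 (by decide)
  have d3 := K 0 4 2 3 (by decide)
  have e1 := K 1 2 3 4 (by decide)
  have e2 := K 1 3 2 4 (by decide)
  have e3 := K 1 4 2 3 (by decide)
  have t := (addz a1 (addz a2 (addz a3 (addz b1 (addz b2 (addz b3 (addz c1 (addz c2 (addz c3 (addz d1 (addz d2 (addz d3 (addz e1 (addz e2 e3))))))))))))))
  clear K S S' a1 a2 a3 b1 b2 b3 c1 c2 c3 d1 d2 d3 e1 e2 e3
  omega

end BadCol

namespace BadCol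

/-- reachability inside a vertex set -/
def Rch {U : Type u} (H : SimpleGraph U) (S : Set U) : U → U → Prop :=
  Relation.ReflTransGen (fun x y => H.Adj x y ∧ x ∈ S ∧ y ∈ S)

/-- nonempty and connected vertex set -/
def Conn {U : Type u} (H : SimpleGraph U) (S : Set U) : Prop :=
  S.Nonempty ∧ ∀ u ∈ S, ∀ v ∈ S, Rch H S u v

/-- some edge between the two sets -/
def Touch {U : Type u} (H : SimpleGraph U) (A B : Set U) : Prop :=
  ∃ a ∈ A, ∃ b ∈ B, H.Adj a b

def NoK33 {U : Type u} (H : SimpleGraph U) : Prop :=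
  ∀ P Q : Fin 3 → Set U, (∀ i, Conn H (P i)) → (∀ j, Conn H (Q j)) →
    (∀ i j, i ≠ j → Disjoint (P i) (P j)) → (∀ i j, i ≠ j → Disjoint (Q i) (Q j)) →
    (∀ i j, Disjoint (P i) (Q j)) → (∀ i j, Touch H (P i) (Q j)) → False

def NoK5 {U : Type u} (H : SimpleGraph U) : Prop :=
  ∀ P : Fin 5 → Set U, (∀ i, Conn H (P i)) →
    (∀ i j, i < j → Disjoint (P i) (P j)) → (∀ i j, i < j → Touch H (P i) (P j)) → False

section basic
variable {U : Type u} {H : SimpleGraph U}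

theorem Rch.mono {S T : Set U} (h : S ⊆ T) {u v : U} (hr : Rch H S u v) : Rch H T u v := by
  induction hr with
  | refl => exact .refl
  | tail _ e ih => exact ih.tail ⟨e.1, h e.2.1, h e.2.2⟩

theorem Rch.symm {S : Set U} {u v : U} (hr : Rch H S u v) : Rch H S v u := by
  induction hr with
  | refl => exact .refl
  | tail _ h ih => exact Relation.ReflTransGen.head ⟨h.1.symm, h.2.2, h.2.1⟩ ih

theorem Rch.trans {S : Set U} {u v w : U} (hr : Rch H S u v) (h' : Rch H S v w) : Rch H S u w :=
  Relation.ReflTransGen.trans hr h'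

theorem Touch.symm {A B : Set U} (h : Touch H A B) : Touch H B A := by
  obtain ⟨a, ha, b, hb, h⟩ := h
  exact ⟨b, hb, a, ha, h.symm⟩

theorem Touch.mono {A B A' B' : Set U} (h : Touch H A B) (hA : A ⊆ A') (hB : B ⊆ B') :
    Touch H A' B' := by
  obtain ⟨a, ha, b, hb, h⟩ := h
  exact ⟨a, hA ha, b, hB hb, h⟩

theorem Conn.singleton (v : U) : Conn H {v} :=
  ⟨⟨v, rfl⟩, by rintro u rfl w rfl; exact .refl⟩

theorem Conn.union {A B : Set U} (hA : Conn H A) (hB : Conn H B) (h : Touch H A B) :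
    Conn H (A ∪ B) := by
  obtain ⟨a, ha, b, hb, hab⟩ := h
  have hab' : Rch H (A ∪ B) a b := .single ⟨hab, .inl ha, .inr hb⟩
  have key : ∀ u ∈ A ∪ B, Rch H (A ∪ B) u a := by
    rintro u (hu | hu)
    · exact (hA.2 u hu a ha).mono subset_union_left
    · exact ((hB.2 u hu b hb).mono subset_union_right).trans hab'.symm
  exact ⟨⟨a, .inl ha⟩, fun u hu v hv => (key u hu).trans (key v hv).symm⟩

theorem Conn.union_inter {A B : Set U} (hA : Conn H A) (hB : Conn H B) (h : (A ∩ B).Nonempty) :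
    Conn H (A ∪ B) := by
  obtain ⟨a, ha, hb⟩ := h
  have key : ∀ u ∈ A ∪ B, Rch H (A ∪ B) u a := by
    rintro u (hu | hu)
    · exact (hA.2 u hu a ha).mono subset_union_left
    · exact (hB.2 u hu a hb).mono subset_union_right
  exact ⟨⟨a, .inl ha⟩, fun u hu v hv => (key u hu).trans (key v hv).symm⟩

theorem Conn.insert {A : Set U} (hA : Conn H A) {v : U} (h : ∃ a ∈ A, H.Adj v a) :
    Conn H (insert v A) := by
  rw [Set.insert_eq]
  obtain ⟨a, ha, h⟩ := h
  exact (Conn.singleton v).union hA ⟨v, rfl, a, ha, h⟩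

end basic

/-- A drawing of a graph, with weak requirements. -/
structure Drawing {U : Type u} (H : SimpleGraph U) where
  pos : U → ℝ × ℝ
  tr : U → U → Set (ℝ × ℝ)
  joined : ∀ u v, H.Adj u v → JoinedIn (tr u v) (pos u) (pos v)
  disj : ∀ u v x y, H.Adj u v → H.Adj x y → u ≠ x → u ≠ y → v ≠ x → v ≠ y →
    Disjoint (tr u v) (tr x y)

namespace Drawing
variable {U : Type u} {H : SimpleGraph U}

def T (D : Drawing H) (S : Set U) : Set (ℝ × ℝ) :=
  {z | ∃ x ∈ S, ∃ y ∈ S, H.Adj x y ∧ z ∈ D.tr x y}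

theorem T_disj (D : Drawing H) {S S' : Set U} (h : Disjoint S S') : Disjoint (D.T S) (D.T S') := by
  rw [Set.disjoint_left]
  rintro z ⟨x, hx, y, hy, hxy, hz⟩ ⟨x', hx', y', hy', hxy', hz'⟩
  have key : ∀ a ∈ S, ∀ b ∈ S', a ≠ b := fun a ha b hb e =>
    Set.disjoint_left.1 h ha (e ▸ hb)
  exact Set.disjoint_left.1 (D.disj x y x' y' hxy hxy' (key _ hx _ hx') (key _ hx _ hy')
    (key _ hy _ hx') (key _ hy _ hy')) hz hz'

theorem rch_joined (D : Drawing H) {S : Set U} {u v : U} (h : Rch H S u v) :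
    u = v ∨ JoinedIn (D.T S) (D.pos u) (D.pos v) := by
  induction h with
  | refl => exact .inl rfl
  | @tail b c _ h ih =>
    right
    have : JoinedIn (D.T S) (D.pos b) (D.pos c) :=
      (D.joined b c h.1).mono (fun z hz => ⟨b, h.2.1, c, h.2.2, h.1, hz⟩)
    rcases ih with rfl | ih
    · exact this
    · exact ih.trans this

theorem exists_path (D : Drawing H) {A B : Set U} (hA : Conn H A) (hB : Conn H B)
    (hd : Disjoint A B) (h : Touch H A B) {a b : U} (ha : a ∈ A) (hb : b ∈ B) :
    ∃ g : ℝ → ℂ, Continuous g ∧ g 0 = Complex.equivRealProdCLM.symm (D.pos a) ∧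
      g 1 = Complex.equivRealProdCLM.symm (D.pos b) ∧
      ∀ t, Complex.equivRealProdCLM (g t) ∈ D.T (A ∪ B) := by
  rcases D.rch_joined ((hA.union hB h).2 a (.inl ha) b (.inr hb)) with rfl | ⟨γ, hγ⟩
  · exact absurd hb (Set.disjoint_left.1 hd ha)
  · refine ⟨fun t => Complex.equivRealProdCLM.symm (γ.extend t), ?_, ?_, ?_, ?_⟩
    · exact Complex.equivRealProdCLM.symm.continuous.comp γ.continuous_extend
    · simp
    · simp
    · intro t
      rw [ContinuousLinearEquiv.apply_symm_apply]
      have : γ.extend t ∈ Set.range γ := by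
        rw [← Path.extend_range]; exact ⟨t, rfl⟩
      obtain ⟨s, hs⟩ := this
      rw [← hs]; exact hγ s

theorem noK33 (D : Drawing H) : NoK33 H := by
  intro P Q hP hQ hPP hQQ hPQ hT
  choose p hp using fun i => (hP i).1
  choose q hq using fun i => (hQ i).1
  choose g h1 h2 h3 h4 using fun i j => D.exists_path (hP i) (hQ j) (hPQ i j) (hT i j) (hp i) (hq j)
  refine no_K33 _ _ g h1 h2 h3 ?_
  intro i j k l hik hjl s t h
  have hd : Disjoint (P i ∪ Q j) (P k ∪ Q l) := by
    simp only [Set.disjoint_union_left, Set.disjoint_union_right]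
    exact ⟨⟨hPP _ _ hik, (hPQ _ _).symm⟩, ⟨hPQ _ _, hQQ _ _ hjl⟩⟩
  refine Set.disjoint_left.1 (D.T_disj hd) (h4 i j s) ?_
  rw [h]; exact h4 k l t

theorem noK5 (D : Drawing H) : NoK5 H := by
  intro P hP hPP hT
  choose p hp using fun i => (hP i).1
  choose! g h1 h2 h3 h4 using fun i j => fun hij : i < j =>
    D.exists_path (hP i) (hP j) (hPP i j hij) (hT i j hij) (hp i) (hp j)
  have hPP' : ∀ i j, i ≠ j → Disjoint (P i) (P j) := by
    intro i j hij
    rcases lt_or_gt_of_ne hij with h | h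
    · exact hPP _ _ h
    · exact (hPP _ _ h).symm
  refine no_K5 _ g h1 h2 h3 ?_
  intro i j k l hij hkl a1 a2 a3 a4 s t h
  have hd : Disjoint (P i ∪ P j) (P k ∪ P l) := by
    simp only [Set.disjoint_union_left, Set.disjoint_union_right]
    exact ⟨⟨hPP' _ _ a1, hPP' _ _ a3⟩, ⟨hPP' _ _ a2, hPP' _ _ a4⟩⟩
  refine Set.disjoint_left.1 (D.T_disj hd) (h4 i j hij s) ?_
  rw [h]; exact h4 k l hkl t

end Drawing
end BadCol

namespace BadCol

/-- Add an apex vertex adjacent to all vertices in `B`. -/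
def apex {U : Type u} (H : SimpleGraph U) (B : Set U) : SimpleGraph (Option U) where
  Adj x y := match x, y with
    | some x, some y => H.Adj x y
    | some x, none => x ∈ B
    | none, some y => y ∈ B
    | none, none => False
  symm := ⟨by
    rintro (_ | x) (_ | y) h
    · exact h
    · exact h
    · exact h
    · exact H.adj_symm h⟩
  loopless := ⟨by
    rintro (_ | x) h
    · exact h
    · exact H.loopless.irrefl _ h⟩

theorem apex_drawing {U : Type u} {H : SimpleGraph U} (D : Drawing H) (B : Set U)
    (hfin : {e : U × U | H.Adj e.1 e.2}.Finite)
    (hcl : ∀ x y, H.Adj x y → IsClosed (D.tr x y))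
    (hav : ∀ v ∈ B, ∀ x y, H.Adj x y → x ≠ v → y ≠ v → D.pos v ∉ D.tr x y)
    (O : Set (ℝ × ℝ)) (hO : IsPathConnected O)
    (hOd : ∀ x y, H.Adj x y → Disjoint O (D.tr x y))
    (hB : ∀ v ∈ B, D.pos v ∈ closure O) : Nonempty (Drawing (apex H B)) := by
  have hball : ∀ v ∈ B, ∃ ε > 0, ∀ x y, H.Adj x y → x ≠ v → y ≠ v →
      Disjoint (Metric.ball (D.pos v) ε) (D.tr x y) := by
    intro v hv
    have hc : IsClosed (⋃ e ∈ {e : U × U | H.Adj e.1 e.2 ∧ e.1 ≠ v ∧ e.2 ≠ v}, D.tr e.1 e.2) := by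
      apply Set.Finite.isClosed_biUnion
      · exact hfin.subset (fun e he => he.1)
      · exact fun e he => hcl _ _ he.1
    have hn : D.pos v ∉ (⋃ e ∈ {e : U × U | H.Adj e.1 e.2 ∧ e.1 ≠ v ∧ e.2 ≠ v}, D.tr e.1 e.2) := by
      simp only [Set.mem_iUnion, not_exists]
      intro e he
      exact hav v hv _ _ he.1 he.2.1 he.2.2
    obtain ⟨ε, hε, hs⟩ := Metric.isOpen_iff.1 hc.isOpen_compl _ hn
    refine ⟨ε, hε, fun x y hxy hx hy => ?_⟩
    rw [Set.disjoint_left]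
    intro z hz hz'
    apply hs hz
    simp only [Set.mem_iUnion]
    exact ⟨(x, y), ⟨hxy, hx, hy⟩, hz'⟩
  choose! ε hε hb using hball
  obtain ⟨p, hp, hpO⟩ := hO
  have hj : ∀ v ∈ B, JoinedIn (Metric.ball (D.pos v) (ε v) ∪ O) (D.pos v) p := by
    intro v hv
    obtain ⟨q, hq, hd⟩ := Metric.mem_closure_iff.1 (hB v hv) (ε v) (hε v hv)
    have h1 : JoinedIn (Metric.ball (D.pos v) (ε v)) (D.pos v) q := by
      apply ((convex_ball (D.pos v) (ε v)).isPathConnected ⟨_, Metric.mem_ball_self (hε v hv)⟩).joinedIn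
      · exact Metric.mem_ball_self (hε v hv)
      · rw [Metric.mem_ball, dist_comm]; exact hd
    exact (h1.mono subset_union_left).trans ((hpO hq).symm.mono subset_union_right)
  have hdis : ∀ v ∈ B, ∀ x y, H.Adj x y → x ≠ v → y ≠ v →
      Disjoint (Metric.ball (D.pos v) (ε v) ∪ O) (D.tr x y) := by
    intro v hv x y hxy hx hy
    rw [Set.disjoint_union_left]
    exact ⟨hb v hv x y hxy hx hy, hOd x y hxy⟩
  refine ⟨{
    pos := fun x => match x with
      | some x => D.pos x
      | none => p
    tr := fun x y => match x, y with
      | some x, some y => D.tr x y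
      | some x, none => Metric.ball (D.pos x) (ε x) ∪ O
      | none, some x => Metric.ball (D.pos x) (ε x) ∪ O
      | none, none => ∅
    joined := ?_
    disj := ?_ }⟩
  · rintro (_ | x) (_ | y) h
    · exact h.elim
    · exact (hj y h).symm
    · exact hj x h
    · exact D.joined x y h
  · rintro (_ | u) (_ | v) (_ | x) (_ | y) h h' h1 h2 h3 h4 <;>
      simp only [ne_eq, not_true_eq_false, Option.some.injEq] at h1 h2 h3 h4
    · exact h.elim
    · exact hdis _ h _ _ h' (Ne.symm h3) (Ne.symm h4)
    · exact hdis _ h _ _ h' (Ne.symm h1) (Ne.symm h2)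
    · exact h'.elim
    · exact (hdis _ h' _ _ h h2 h4).symm
    · exact (hdis _ h' _ _ h h1 h3).symm
    · exact D.disj _ _ _ _ h h' h1 h2 h3 h4

theorem preconn_big (R : ℝ) (hR : 0 ≤ R) :
    IsPreconnected (Metric.closedBall (0 : ℝ × ℝ) R)ᶜ := by
  have e : (Metric.closedBall (0 : ℝ × ℝ) R)ᶜ =
      ((({z : ℝ × ℝ | R < z.1} ∪ {z : ℝ × ℝ | R < z.2}) ∪ {z : ℝ × ℝ | z.1 < -R}) ∪
        {z : ℝ × ℝ | z.2 < -R}) := by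
    ext ⟨x, y⟩
    simp only [mem_compl_iff, Metric.mem_closedBall, dist_zero_right, Prod.norm_def, sup_le_iff,
      Real.norm_eq_abs, abs_le, mem_union, mem_setOf_eq]
    constructor
    · intro h
      by_contra hc
      push Not at hc
      exact h ⟨⟨by linarith, by linarith⟩, ⟨by linarith, by linarith⟩⟩
    · rintro (((h | h) | h) | h) ⟨⟨h1, h2⟩, h3, h4⟩ <;> linarith
  rw [e]
  have c1 : IsPreconnected {z : ℝ × ℝ | R < z.1} :=
    ((convex_Ioi R).is_linear_preimage (f := fun z : ℝ × ℝ => z.1) (by exact ⟨fun _ _ => rfl, fun _ _ => rfl⟩)).isPreconnected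
  have c2 : IsPreconnected {z : ℝ × ℝ | R < z.2} :=
    ((convex_Ioi R).is_linear_preimage (f := fun z : ℝ × ℝ => z.2) (by exact ⟨fun _ _ => rfl, fun _ _ => rfl⟩)).isPreconnected
  have c3 : IsPreconnected {z : ℝ × ℝ | z.1 < -R} :=
    ((convex_Iio (-R)).is_linear_preimage (f := fun z : ℝ × ℝ => z.1) (by exact ⟨fun _ _ => rfl, fun _ _ => rfl⟩)).isPreconnected
  have c4 : IsPreconnected {z : ℝ × ℝ | z.2 < -R} :=
    ((convex_Iio (-R)).is_linear_preimage (f := fun z : ℝ × ℝ => z.2) (by exact ⟨fun _ _ => rfl, fun _ _ => rfl⟩)).isPreconnected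
  refine IsPreconnected.union (-R-1, -R-1) ?_ ?_ (IsPreconnected.union (-R-1, R+1) ?_ ?_ (IsPreconnected.union (R+1, R+1) ?_ ?_ c1 c2) c3) c4
  all_goals simp <;> linarith

theorem exists_not_mem_closedBall (R : ℝ) : ∃ p : ℝ × ℝ, p ∉ Metric.closedBall (0 : ℝ × ℝ) R := by
  refine ⟨(|R| + 1, 0), ?_⟩
  simp only [Metric.mem_closedBall, dist_zero_right, Prod.norm_def, not_le, lt_sup_iff]
  left
  rw [Real.norm_eq_abs, abs_of_nonneg (by positivity)]
  have := le_abs_self R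
  linarith

section
variable {V : Type u} (G : PlaneGraph V)

theorem adj_finite : {e : V × V | G.Adj e.1 e.2}.Finite :=
  (G.finite_verts.prod G.finite_verts).subset
    (fun e he => ⟨G.adj_mem _ _ he, G.adj_mem _ _ (G.adj_symm _ _ he)⟩)

theorem arc_compact {u v : V} (h : G.Adj u v) : IsCompact (G.arc s(u, v)) := by
  obtain ⟨f, hf, -, he, -, -⟩ := G.arc_arc u v h
  rw [← he]; exact isCompact_Icc.image_of_continuousOn hf

theorem image_compact : IsCompact G.image := by
  unfold PlaneGraph.image
  have : (⋃ (u : V) (v : V) (_ : G.Adj u v), G.arc s(u, v)) =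
      ⋃ e ∈ {e : V × V | G.Adj e.1 e.2}, G.arc s(e.1, e.2) := by
    ext z; simp
  rw [this]
  exact (G.finite_verts.image _).isCompact.union
    ((adj_finite G).isCompact_biUnion (fun e he => arc_compact G he))

theorem outer_pathConn : IsPathConnected G.outerFace := by
  obtain ⟨R, hR⟩ := (image_compact G).isBounded.subset_closedBall (0 : ℝ × ℝ)
  set R' := max R 0
  have hR' : G.image ⊆ Metric.closedBall 0 R' :=
    hR.trans (Metric.closedBall_subset_closedBall (le_max_left _ _))
  obtain ⟨p, hp⟩ := exists_not_mem_closedBall R'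
  have hopen : IsOpen G.imageᶜ := (image_compact G).isClosed.isOpen_compl
  have hsub : (Metric.closedBall (0 : ℝ × ℝ) R')ᶜ ⊆ connectedComponentIn G.imageᶜ p :=
    (preconn_big R' (le_max_right _ _)).subset_connectedComponentIn hp
      (compl_subset_compl.2 hR')
  have hpi : p ∈ G.imageᶜ := fun h => hp (hR' h)
  have e : G.outerFace = connectedComponentIn G.imageᶜ p := by
    ext z
    constructor
    · rintro ⟨h1, h2⟩
      by_contra hz
      apply h2
      apply (Metric.isBounded_closedBall (x := (0 : ℝ × ℝ)) (r := R')).subset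
      intro w hw
      by_contra hwb
      have hw' := hsub hwb
      have e1 := connectedComponentIn_eq hw
      have e2 := connectedComponentIn_eq hw'
      apply hz
      rw [e2, ← e1]
      exact mem_connectedComponentIn h1
    · intro hz
      refine ⟨connectedComponentIn_subset _ _ hz, ?_⟩
      rw [← connectedComponentIn_eq hz]
      intro hb
      have := (hb.subset hsub)
      obtain ⟨r, hr⟩ := ((Metric.isBounded_closedBall (x := (0 : ℝ × ℝ)) (r := R')).union this).subset_closedBall (0 : ℝ × ℝ)
      rw [union_compl_self] at hr
      obtain ⟨q, hq⟩ := exists_not_mem_closedBall r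
      exact hq (hr trivial)
  rw [e]
  exact (hopen.connectedComponentIn).isConnected_iff_isPathConnected.1
    (isConnected_connectedComponentIn_iff.2 hpi)

theorem outer_disj {u v : V} (h : G.Adj u v) : Disjoint G.outerFace (G.arc s(u, v)) := by
  rw [Set.disjoint_left]
  intro z hz hz'
  apply hz.1
  right
  simp only [mem_iUnion]
  exact ⟨u, v, h, hz'⟩

def toGraph : SimpleGraph V where
  Adj := G.Adj
  symm := ⟨G.adj_symm⟩
  loopless := ⟨G.adj_irrefl⟩

def toDrawing : Drawing (toGraph G) where
  pos := G.pos
  tr u v := G.arc s(u, v)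
  joined := by
    intro u v h
    obtain ⟨f, hf, -, he, h0, h1⟩ := G.arc_arc u v h
    exact JoinedIn.ofLine hf h0 h1 he.le
  disj := by
    intro u v x y h h' h1 h2 h3 h4
    rw [Set.disjoint_iff]
    intro z hz
    obtain ⟨w, ⟨hw, hw'⟩, -⟩ := G.arc_meet u v x y h h' (by
      intro e; rw [Sym2.eq_iff] at e; tauto) hz
    simp only [mem_insert_iff, mem_singleton_iff] at hw hw'
    rcases hw with rfl | rfl <;> rcases hw' with rfl | rfl <;> contradiction

theorem apex_G_drawing : Nonempty (Drawing (apex (toGraph G) G.boundaryVerts)) := by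
  refine apex_drawing (toDrawing G) _ (adj_finite G) (fun x y h => (arc_compact G h).isClosed) ?_
    G.outerFace (outer_pathConn G) (fun x y h => outer_disj G h)
    (fun v hv => frontier_subset_closure hv.2)
  intro v hv x y h hx hy hm
  rcases G.arc_avoid x y h v hv.1 hm with h | h
  · exact hx h.symm
  · exact hy h.symm

/-- Subdivide the edge `bn`; the new vertex is `none`. -/
def subdiv (b n : V) : SimpleGraph (Option V) where
  Adj x y := match x, y with
    | some x, some y => G.Adj x y ∧ s(x, y) ≠ s(b, n)
    | some x, none => x = b ∨ x = n
    | none, some y => y = b ∨ y = n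
    | none, none => False
  symm := ⟨by
    rintro (_ | x) (_ | y) h
    · exact h
    · exact h
    · exact h
    · exact ⟨G.adj_symm _ _ h.1, by rw [Sym2.eq_swap]; exact h.2⟩⟩
  loopless := ⟨by
    rintro (_ | x) h
    · exact h
    · exact G.adj_irrefl _ h.1⟩

theorem subdiv_drawing {b n : V} (hbn : G.Adj b n) (hb : G.OnOuter b) (hn : G.OnOuter n)
    (hE : G.EdgeOnOuter b n) :
    Nonempty (Drawing (apex (subdiv G b n) (insert none (some '' G.boundaryVerts)))) := by
  obtain ⟨f, hf, hinj, he, h0, h1⟩ := G.arc_arc b n hbn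
  have hne : b ≠ n := fun e => G.adj_irrefl b (by rw [← e] at hbn; exact hbn)
  have hbv : b ∈ G.verts := G.adj_mem _ _ hbn
  have hnv : n ∈ G.verts := G.adj_mem _ _ (G.adj_symm _ _ hbn)
  classical
  -- the two halves
  let I1 : Set ℝ := Icc 0 (1/2)
  let I2 : Set ℝ := Icc (1/2) 1
  have hI1 : I1 ⊆ Icc 0 1 := Icc_subset_Icc le_rfl (by norm_num)
  have hI2 : I2 ⊆ Icc 0 1 := Icc_subset_Icc (by norm_num) le_rfl
  let half : V → Set (ℝ × ℝ) := fun v => if v = b then f '' I1 else f '' I2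
  have half_sub : ∀ v, half v ⊆ G.arc s(b, n) := by
    intro v; rw [← he]; simp only [half]; split_ifs
    · exact image_mono hI1
    · exact image_mono hI2
  have half_closed : ∀ v, IsClosed (half v) := by
    intro v; simp only [half]; split_ifs
    · exact (isCompact_Icc.image_of_continuousOn (hf.mono hI1)).isClosed
    · exact (isCompact_Icc.image_of_continuousOn (hf.mono hI2)).isClosed
  have nb : G.pos n ∉ half b := by
    simp only [half, if_true]
    rintro ⟨t, ht, e⟩
    rw [← h1] at e
    have := hinj (hI1 ht) (by simp) e
    rw [this] at ht
    have := ht.2; norm_num at this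
  have bn : G.pos b ∉ half n := by
    simp only [half, if_neg hne.symm]
    rintro ⟨t, ht, e⟩
    rw [← h0] at e
    have := hinj (hI2 ht) (by simp) e
    rw [this] at ht
    have := ht.1; norm_num at this
  have mid_arc : f (1/2) ∈ G.arc s(b, n) := by
    rw [← he]; exact ⟨1/2, by norm_num, rfl⟩
  have mid_b : f (1/2) ≠ G.pos b := by
    rw [← h0]; intro e
    have := hinj (by norm_num) (by norm_num) e
    norm_num at this
  have mid_n : f (1/2) ≠ G.pos n := by
    rw [← h1]; intro e
    have := hinj (by norm_num) (by norm_num) e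
    norm_num at this
  have joined_half : ∀ v, v = b ∨ v = n → JoinedIn (half v) (f (1/2)) (G.pos v) := by
    rintro v (rfl | rfl)
    · simp only [half, if_true]
      have hm : ∀ t ∈ Icc (0:ℝ) 1, (1/2) * (1 - t) ∈ I1 := by
        rintro t ⟨ht, ht'⟩; constructor <;> linarith
      refine JoinedIn.ofLine (f := fun t => f ((1/2) * (1 - t))) ?_ (by simp) (by simp [h0]) ?_
      · exact hf.comp (by fun_prop) (fun t ht => hI1 (hm t ht))
      · rintro _ ⟨t, ht, rfl⟩
        exact ⟨_, hm t ht, rfl⟩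
    · simp only [half, if_neg hne.symm]
      have hm : ∀ t ∈ Icc (0:ℝ) 1, (1/2) * (1 + t) ∈ I2 := by
        rintro t ⟨ht, ht'⟩; constructor <;> linarith
      refine JoinedIn.ofLine (f := fun t => f ((1/2) * (1 + t))) ?_ (by simp) (by norm_num [h1]) ?_
      · exact hf.comp (by fun_prop) (fun t ht => hI2 (hm t ht))
      · rintro _ ⟨t, ht, rfl⟩
        exact ⟨_, hm t ht, rfl⟩
  -- edges other than bn avoid halves when vertex disjoint
  have half_disj : ∀ v x y, v = b ∨ v = n → G.Adj x y → s(x, y) ≠ s(b, n) → v ≠ x → v ≠ y →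
      Disjoint (half v) (G.arc s(x, y)) := by
    intro v x y hv hxy hs hvx hvy
    rw [Set.disjoint_left]
    intro z hz hz'
    obtain ⟨w, ⟨hw, hw'⟩, rfl⟩ := G.arc_meet b n x y hbn hxy hs.symm ⟨half_sub v hz, hz'⟩
    simp only [mem_insert_iff, mem_singleton_iff] at hw hw'
    have hwv : w ≠ v := by rintro rfl; rcases hw' with h | h <;> contradiction
    rcases hv with rfl | rfl <;> rcases hw with rfl | rfl
    · exact hwv rfl
    · exact nb hz
    · exact bn hz
    · exact hwv rfl
  let D : Drawing (subdiv G b n) :=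
    { pos := fun x => match x with
        | some x => G.pos x
        | none => f (1/2)
      tr := fun x y => match x, y with
        | some x, some y => G.arc s(x, y)
        | some x, none => half x
        | none, some x => half x
        | none, none => ∅
      joined := by
        rintro (_ | x) (_ | y) h
        · exact h.elim
        · exact joined_half y h
        · exact (joined_half x h).symm
        · exact (toDrawing G).joined x y h.1
      disj := by
        rintro (_ | u) (_ | v) (_ | x) (_ | y) h h' h1 h2 h3 h4 <;>
          simp only [ne_eq, not_true_eq_false, Option.some.injEq] at h1 h2 h3 h4
        · exact h.elim
        · exact half_disj _ _ _ h h'.1 h'.2 h3 h4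
        · exact half_disj _ _ _ h h'.1 h'.2 h1 h2
        · exact h'.elim
        · exact (half_disj _ _ _ h' h.1 h.2 (Ne.symm h2) (Ne.symm h4)).symm
        · exact (half_disj _ _ _ h' h.1 h.2 (Ne.symm h1) (Ne.symm h3)).symm
        · exact (toDrawing G).disj _ _ _ _ h.1 h'.1 h1 h2 h3 h4 }
  have hverts : ∀ v, v = b ∨ v = n → v ∈ G.verts := by rintro v (rfl | rfl) <;> assumption
  refine apex_drawing D _ ?_ ?_ ?_ G.outerFace (outer_pathConn G) ?_ ?_
  · have hf1 : (insert none (some '' G.verts)).Finite := (G.finite_verts.image some).insert none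
    refine (hf1.prod hf1).subset ?_
    rintro ⟨_ | x, _ | y⟩ h
    · exact h.elim
    · exact ⟨.inl rfl, .inr ⟨y, hverts y h, rfl⟩⟩
    · exact ⟨.inr ⟨x, hverts x h, rfl⟩, .inl rfl⟩
    · exact ⟨.inr ⟨x, G.adj_mem _ _ h.1, rfl⟩, .inr ⟨y, G.adj_mem _ _ (G.adj_symm _ _ h.1), rfl⟩⟩
  · rintro (_ | x) (_ | y) h
    · exact h.elim
    · exact half_closed y
    · exact half_closed x
    · exact (arc_compact G h.1).isClosed
  · have key : ∀ v ∈ G.boundaryVerts, ∀ x, x = b ∨ x = n → v ≠ x → G.pos v ∉ half x := by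
      intro v hv x hx hvx hm
      rcases G.arc_avoid b n hbn v hv.1 (half_sub x hm) with rfl | rfl <;> rcases hx with rfl | rfl
      · exact hvx rfl
      · exact bn hm
      · exact nb hm
      · exact hvx rfl
    rintro v hv (_ | x) (_ | y) h hx hy
    · exact h.elim
    · rcases hv with rfl | ⟨v, hv, rfl⟩
      · exact absurd rfl hx
      · exact key v hv y h (fun e => hy (by rw [e]))
    · rcases hv with rfl | ⟨v, hv, rfl⟩
      · exact absurd rfl hy
      · exact key v hv x h (fun e => hx (by rw [e]))
    · rcases hv with rfl | ⟨v, hv, rfl⟩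
      · intro hm
        obtain ⟨w, ⟨hw, -⟩, e⟩ := G.arc_meet b n x y hbn h.1 h.2.symm ⟨mid_arc, hm⟩
        rcases hw with rfl | rfl
        · exact mid_b e.symm
        · exact mid_n e.symm
      · intro hm
        rcases G.arc_avoid x y h.1 v hv.1 hm with rfl | rfl
        · exact hx rfl
        · exact hy rfl
  · rintro (_ | x) (_ | y) h
    · exact h.elim
    · exact (outer_disj G hbn).mono_right (half_sub y)
    · exact (outer_disj G hbn).mono_right (half_sub x)
    · exact outer_disj G h.1
  · rintro v (rfl | ⟨v, hv, rfl⟩)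
    · exact frontier_subset_closure (hE mid_arc)
    · exact frontier_subset_closure hv.2

end
end BadCol

namespace BadCol
section
variable {U : Type u} {H : SimpleGraph U}

/-- the component of `z` in `S` -/
def comp (H : SimpleGraph U) (S : Set U) (z : U) : Set U := {y | y ∈ S ∧ Rch H S z y}

/-- `w` has a neighbour in `X` -/
def N (H : SimpleGraph U) (X : Set U) (w : U) : Prop := ∃ x ∈ X, H.Adj w x

theorem comp_sub {S : Set U} {z : U} : comp H S z ⊆ S := fun _ h => h.1

theorem mem_comp_self {S : Set U} {z : U} (h : z ∈ S) : z ∈ comp H S z := ⟨h, .refl⟩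

theorem comp_closed {S : Set U} {z y w : U} (hy : y ∈ comp H S z) (hw : w ∈ S)
    (h : H.Adj y w) : w ∈ comp H S z := ⟨hw, hy.2.tail ⟨h, hy.1, hw⟩⟩

theorem rch_comp {S : Set U} {z y : U} (hz : z ∈ S) (h : Rch H S z y) : Rch H (comp H S z) z y := by
  induction h with
  | refl => exact .refl
  | @tail b c h1 h2 ih =>
    exact ih.tail ⟨h2.1, ⟨h2.2.1, h1⟩, ⟨h2.2.2, h1.tail h2⟩⟩

theorem comp_conn {S : Set U} {z : U} (hz : z ∈ S) : Conn H (comp H S z) := by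
  refine ⟨⟨z, mem_comp_self hz⟩, fun u hu v hv => ?_⟩
  exact (rch_comp hz hu.2).symm.trans (rch_comp hz hv.2)

theorem comp_eq {S : Set U} {z y : U} (h : y ∈ comp H S z) : comp H S y = comp H S z := by
  ext w
  exact ⟨fun hw => ⟨hw.1, h.2.trans hw.2⟩, fun hw => ⟨hw.1, h.2.symm.trans hw.2⟩⟩

theorem conn_sub_comp {S K : Set U} {z : U} (hK : Conn H K) (hs : K ⊆ S) (hz : z ∈ K) :
    K ⊆ comp H S z := fun _ hy => ⟨hs hy, (hK.2 z hz _ hy).mono hs⟩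

theorem rch_exit {S K : Set U} {u v : U} (h : Rch H S u v) (hu : u ∈ K) (hv : v ∉ K) :
    ∃ x ∈ K, ∃ y ∈ S, y ∉ K ∧ x ∈ S ∧ H.Adj x y := by
  induction h with
  | refl => exact absurd hu hv
  | @tail b c h1 h2 ih =>
    by_cases hb : b ∈ K
    · exact ⟨b, hb, c, h2.2.2, hv, h2.2.1, h2.1⟩
    · exact ih hb

theorem Conn.exit {S K : Set U} {u v : U} (h : Conn H S) (huS : u ∈ S) (hvS : v ∈ S)
    (hu : u ∈ K) (hv : v ∉ K) : ∃ x ∈ K, ∃ y ∈ S, y ∉ K ∧ x ∈ S ∧ H.Adj x y :=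
  rch_exit (h.2 u huS v hvS) hu hv

theorem not_conn {S : Set U} (hn : S.Nonempty) (h : ¬ Conn H S) :
    ∃ p ∈ S, ∃ q ∈ S, q ∉ comp H S p := by
  by_contra hc
  push Not at hc
  exact h ⟨hn, fun u hu v hv => (hc u hu v hv).2⟩

theorem mk_K33 (hk : NoK33 H) (A1 A2 A3 B1 B2 B3 : Set U)
    (c1 : Conn H A1) (c2 : Conn H A2) (c3 : Conn H A3)
    (d1 : Conn H B1) (d2 : Conn H B2) (d3 : Conn H B3)
    (hd : ∀ z, (z ∈ A1 → z ∉ A2 ∧ z ∉ A3 ∧ z ∉ B1 ∧ z ∉ B2 ∧ z ∉ B3) ∧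
      (z ∈ A2 → z ∉ A3 ∧ z ∉ B1 ∧ z ∉ B2 ∧ z ∉ B3) ∧
      (z ∈ A3 → z ∉ B1 ∧ z ∉ B2 ∧ z ∉ B3) ∧
      (z ∈ B1 → z ∉ B2 ∧ z ∉ B3) ∧ (z ∈ B2 → z ∉ B3))
    (t11 : Touch H A1 B1) (t12 : Touch H A1 B2) (t13 : Touch H A1 B3)
    (t21 : Touch H A2 B1) (t22 : Touch H A2 B2) (t23 : Touch H A2 B3)
    (t31 : Touch H A3 B1) (t32 : Touch H A3 B2) (t33 : Touch H A3 B3) : False := by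
  refine hk ![A1, A2, A3] ![B1, B2, B3] ?_ ?_ ?_ ?_ ?_ ?_
  · intro i; fin_cases i <;> assumption
  · intro i; fin_cases i <;> assumption
  · intro i j hij
    rw [Set.disjoint_left]
    intro z
    obtain ⟨g1, g2, g3, g4, g5⟩ := hd z
    fin_cases i <;> fin_cases j <;> first
      | exact absurd rfl hij
      | exact fun h => (g1 h).1
      | exact fun h => (g1 h).2.1
      | exact fun h => (g2 h).1
      | exact fun h h' => (g1 h').1 h
      | exact fun h h' => (g1 h').2.1 h
      | exact fun h h' => (g2 h').1 h
  · intro i j hij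
    rw [Set.disjoint_left]
    intro z
    obtain ⟨g1, g2, g3, g4, g5⟩ := hd z
    fin_cases i <;> fin_cases j <;> first
      | exact absurd rfl hij
      | exact fun h => (g4 h).1
      | exact fun h => (g4 h).2
      | exact fun h => g5 h
      | exact fun h h' => (g4 h').1 h
      | exact fun h h' => (g4 h').2 h
      | exact fun h h' => g5 h' h
  · intro i j
    rw [Set.disjoint_left]
    intro z
    obtain ⟨g1, g2, g3, g4, g5⟩ := hd z
    fin_cases i <;> fin_cases j <;> first
      | exact fun h => (g1 h).2.2.1
      | exact fun h => (g1 h).2.2.2.1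
      | exact fun h => (g1 h).2.2.2.2
      | exact fun h => (g2 h).2.1
      | exact fun h => (g2 h).2.2.1
      | exact fun h => (g2 h).2.2.2
      | exact fun h => (g3 h).1
      | exact fun h => (g3 h).2.1
      | exact fun h => (g3 h).2.2
  · intro i j; fin_cases i <;> fin_cases j <;> assumption

theorem mk_K5 (hk : NoK5 H) (A1 A2 A3 A4 A5 : Set U)
    (c1 : Conn H A1) (c2 : Conn H A2) (c3 : Conn H A3)
    (c4 : Conn H A4) (c5 : Conn H A5)
    (hd : ∀ z, (z ∈ A1 → z ∉ A2 ∧ z ∉ A3 ∧ z ∉ A4 ∧ z ∉ A5) ∧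
      (z ∈ A2 → z ∉ A3 ∧ z ∉ A4 ∧ z ∉ A5) ∧
      (z ∈ A3 → z ∉ A4 ∧ z ∉ A5) ∧
      (z ∈ A4 → z ∉ A5))
    (t12 : Touch H A1 A2) (t13 : Touch H A1 A3) (t14 : Touch H A1 A4)
    (t15 : Touch H A1 A5) (t23 : Touch H A2 A3) (t24 : Touch H A2 A4)
    (t25 : Touch H A2 A5) (t34 : Touch H A3 A4) (t35 : Touch H A3 A5) (t45 : Touch H A4 A5) :
    False := by
  refine hk ![A1, A2, A3, A4, A5] ?_ ?_ ?_
  · intro i; fin_cases i <;> assumption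
  · intro i j hij
    rw [Set.disjoint_left]
    intro z
    obtain ⟨h1, h2, h3, h4⟩ := hd z
    fin_cases i <;> fin_cases j <;> first
      | (exfalso; revert hij; decide)
      | exact fun h => (h1 h).1
      | exact fun h => (h1 h).2.1
      | exact fun h => (h1 h).2.2.1
      | exact fun h => (h1 h).2.2.2
      | exact fun h => (h2 h).1
      | exact fun h => (h2 h).2.1
      | exact fun h => (h2 h).2.2
      | exact fun h => (h3 h).1
      | exact fun h => (h3 h).2
      | exact fun h => h4 h
  · intro i j hij; fin_cases i <;> fin_cases j <;> first | assumption | (exfalso; revert hij; decide)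

theorem Touch.sl {a : U} {B : Set U} (h : N H B a) : Touch H {a} B := by
  obtain ⟨b, hb, h⟩ := h
  exact ⟨a, rfl, b, hb, h⟩

theorem Touch.sr {a : U} {B : Set U} (h : N H B a) : Touch H B {a} := (Touch.sl h).symm

theorem Touch.ss {a b : U} (h : H.Adj a b) : Touch H {a} {b} := ⟨a, rfl, b, rfl, h⟩

theorem touch_sl {a : U} {B : Set U} : Touch H {a} B ↔ N H B a := by
  constructor
  · rintro ⟨_, rfl, b, hb, h⟩; exact ⟨b, hb, h⟩
  · exact Touch.sl

theorem N_single {a b : U} : N H {b} a ↔ H.Adj a b := by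
  constructor
  · rintro ⟨_, rfl, h⟩; exact h
  · intro h; exact ⟨b, rfl, h⟩

theorem N_insert {X : Set U} {a v : U} : N H (insert v X) a ↔ H.Adj a v ∨ N H X a := by
  simp [N]

theorem N.mono {X Y : Set U} {a : U} (h : N H X a) (hs : X ⊆ Y) : N H Y a := by
  obtain ⟨x, hx, h⟩ := h
  exact ⟨x, hs hx, h⟩

/-- two vertices of a connected set are adjacent or linked through a component of the rest -/
theorem link {T : Set U} (hT : Conn H T) {p q : U} (hp : p ∈ T) (hq : q ∈ T) (hne : p ≠ q) :
    H.Adj p q ∨ ∃ z ∈ T \ {p, q}, N H (comp H (T \ {p, q}) z) p ∧ N H (comp H (T \ {p, q}) z) q := by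
  have hpq : p ∈ T \ {q} := ⟨hp, hne⟩
  obtain ⟨r, hr, y, hy, hyK, hrT, hry⟩ := hT.exit (K := comp H (T \ {q}) p) hp hq
    (mem_comp_self hpq) (fun h => h.1.2 rfl)
  have hyq : y = q := by
    by_contra hc
    exact hyK (comp_closed hr ⟨hy, hc⟩ hry)
  subst hyq
  by_cases hrp : r = p
  · subst hrp; exact .inl hry
  right
  have hrS : r ∈ T \ {p, y} := ⟨hrT, by rintro (h | h); exact hrp h; exact hr.1.2 h⟩
  refine ⟨r, hrS, ?_, ⟨r, mem_comp_self hrS, hry.symm⟩⟩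
  obtain ⟨x, hx, w, hw, hwK, -, hxw⟩ := rch_exit (K := comp H (T \ {p, y}) r) hr.2.symm
    (mem_comp_self hrS) (fun h => h.1.2 (.inl rfl))
  have hwp : w = p := by
    by_contra hc
    exact hwK (comp_closed hx ⟨hw.1, by rintro (h | h); exact hc h; exact hw.2 h⟩ hxw)
  subst hwp
  exact ⟨x, hx, hxw.symm⟩

theorem diff_pair_comm (W : Set U) (p q : U) : W \ {p, q} = W \ {q, p} := by
  rw [Set.pair_comm]

/-- Degree lemma. -/
theorem degLemma (hk33 : NoK33 H) (hk5 : NoK5 H) {W X : Set U} (hX : Conn H X)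
    (hWX : ∀ z ∈ W, z ∉ X) {v p1 p2 p3 : U} (hv : v ∈ W) (h1 : p1 ∈ W) (h2 : p2 ∈ W) (h3 : p3 ∈ W)
    (nv : N H X v) (n1 : N H X p1) (n2 : N H X p2) (n3 : N H X p3)
    (a1 : H.Adj v p1) (a2 : H.Adj v p2) (a3 : H.Adj v p3)
    (d12 : p1 ≠ p2) (d13 : p1 ≠ p3) (d23 : p2 ≠ p3)
    (c1 : Conn H (W \ {v, p1})) (c2 : Conn H (W \ {v, p2})) (c3 : Conn H (W \ {v, p3})) :
    False := by
  have v1 := a1.ne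
  have v2 := a2.ne
  have v3 := a3.ne
  have vX := hWX v hv
  have X1 := hWX _ h1
  have X2 := hWX _ h2
  have X3 := hWX _ h3
  set R : Set U := W \ {v, p1, p2, p3} with hR
  have R3 : (W \ {v, p3}) \ {p1, p2} = R := by ext; simp [hR]; tauto
  have R2 : (W \ {v, p2}) \ {p1, p3} = R := by ext; simp [hR]; tauto
  have R1 : (W \ {v, p1}) \ {p2, p3} = R := by ext; simp [hR]; tauto
  have l3 := link c3 (p := p1) (q := p2) (by simp [*, Ne.symm v1]) (by simp [*, Ne.symm v2]) d12
  have l2 := link c2 (p := p1) (q := p3) (by simp [*, Ne.symm v1]) (by simp [*, Ne.symm v3, d23.symm]) d13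
  have l1 := link c1 (p := p2) (q := p3) (by simp [*, Ne.symm v2, d12.symm]) (by simp [*, Ne.symm v3, d13.symm]) d23
  rw [R3] at l3
  rw [R2] at l2
  rw [R1] at l1
  -- no component touches all three
  have no3 : ∀ z ∈ R, ¬ (N H (comp H R z) p1 ∧ N H (comp H R z) p2 ∧ N H (comp H R z) p3) := by
    rintro z hz ⟨m1, m2, m3⟩
    have hs : ∀ y ∈ comp H R z, y ∈ W ∧ y ≠ v ∧ y ≠ p1 ∧ y ≠ p2 ∧ y ≠ p3 := by
      intro y hy
      have := comp_sub hy
      simp only [hR, mem_sdiff, mem_insert_iff, mem_singleton_iff, not_or] at this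
      exact this
    refine mk_K33 hk33 {v} X (comp H R z) {p1} {p2} {p3} (.singleton _) hX (comp_conn hz)
      (.singleton _) (.singleton _) (.singleton _) ?_ (.ss a1) (.ss a2) (.ss a3)
      (.sr n1) (.sr n2) (.sr n3) (.sr m1) (.sr m2) (.sr m3)
    intro y
    have q1 := hs y
    have q2 := hWX y
    generalize comp H R z = K at q1
    clear hs m1 m2 m3 l1 l2 l3 R1 R2 R3 c1 c2 c3 hk33 hk5 hX a1 a2 a3 hWX nv n1 n2 n3 hz hR
    clear_value R
    simp only [mem_singleton_iff]
    refine ⟨?_, ?_, ?_, ?_, ?_⟩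
    · rintro rfl; refine ⟨vX, fun h => (q1 h).2.1 rfl, v1, v2, v3⟩
    · intro hy
      refine ⟨fun h => q2 (q1 h).1 hy, ?_, ?_, ?_⟩ <;> rintro rfl <;> contradiction
    · intro hy
      exact (q1 hy).2.2
    · rintro rfl; exact ⟨d12, d13⟩
    · rintro rfl; exact d23
  -- linking sets
  have mk : ∀ p q r : U, (H.Adj p q ∨ ∃ z ∈ R, N H (comp H R z) p ∧ N H (comp H R z) q) →
      ∃ K : Set U, K ⊆ R ∧ Conn H (insert p K) ∧ N H (insert p K) q ∧
        (K.Nonempty → ∃ z ∈ R, K = comp H R z ∧ N H K p ∧ N H K q) := by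
    rintro p q r (h | ⟨z, hz, hp, hq⟩)
    · refine ⟨∅, by simp, by simpa using Conn.singleton p, ?_, by simp⟩
      rw [N_insert]; exact .inl h.symm
    · refine ⟨comp H R z, comp_sub, (comp_conn hz).insert hp, ?_, fun _ => ⟨z, hz, rfl, hp, hq⟩⟩
      rw [N_insert]; exact .inr hq
  obtain ⟨K1, s1, k1, t1, e1⟩ := mk p1 p2 p3 l3
  obtain ⟨K2, s2, k2, t2, e2⟩ := mk p2 p3 p1 l1
  obtain ⟨K3, s3, k3, t3, e3⟩ := mk p3 p1 p2 (by rcases l2 with h | ⟨z, hz, h, h'⟩; exacts [.inl h.symm, .inr ⟨z, hz, h', h⟩])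
  have dj : ∀ K K' : Set U, (∀ z ∈ R, ¬(K = comp H R z ∧ K' = comp H R z)) →
      (K.Nonempty → ∃ z ∈ R, K = comp H R z) → (K'.Nonempty → ∃ z ∈ R, K' = comp H R z) →
      ∀ y, y ∈ K → y ∉ K' := by
    intro K K' h hK hK' y hy hy'
    obtain ⟨z, hz, rfl⟩ := hK ⟨y, hy⟩
    obtain ⟨z', hz', rfl⟩ := hK' ⟨y, hy'⟩
    exact h z hz ⟨rfl, by rw [← comp_eq hy, ← comp_eq hy']⟩
  have e1' : K1.Nonempty → ∃ z ∈ R, K1 = comp H R z := fun h => by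
    obtain ⟨z, hz, h, -⟩ := e1 h; exact ⟨z, hz, h⟩
  have e2' : K2.Nonempty → ∃ z ∈ R, K2 = comp H R z := fun h => by
    obtain ⟨z, hz, h, -⟩ := e2 h; exact ⟨z, hz, h⟩
  have e3' : K3.Nonempty → ∃ z ∈ R, K3 = comp H R z := fun h => by
    obtain ⟨z, hz, h, -⟩ := e3 h; exact ⟨z, hz, h⟩
  have D12 := dj K1 K2 (by
    rintro z hz ⟨h, h'⟩
    have ne1 : K1.Nonempty := by rw [h]; exact ⟨z, mem_comp_self hz⟩
    have ne2 : K2.Nonempty := by rw [h']; exact ⟨z, mem_comp_self hz⟩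
    obtain ⟨z1, hz1, -, x1, x2⟩ := e1 ne1
    obtain ⟨z2, hz2, -, y1, y2⟩ := e2 ne2
    exact no3 z hz ⟨h ▸ x1, h ▸ x2, h' ▸ y2⟩) e1' e2'
  have D13 := dj K1 K3 (by
    rintro z hz ⟨h, h'⟩
    have ne1 : K1.Nonempty := by rw [h]; exact ⟨z, mem_comp_self hz⟩
    have ne2 : K3.Nonempty := by rw [h']; exact ⟨z, mem_comp_self hz⟩
    obtain ⟨z1, hz1, -, x1, x2⟩ := e1 ne1
    obtain ⟨z2, hz2, -, y1, y2⟩ := e3 ne2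
    exact no3 z hz ⟨h ▸ x1, h ▸ x2, h' ▸ y1⟩) e1' e3'
  have D23 := dj K2 K3 (by
    rintro z hz ⟨h, h'⟩
    have ne1 : K2.Nonempty := by rw [h]; exact ⟨z, mem_comp_self hz⟩
    have ne2 : K3.Nonempty := by rw [h']; exact ⟨z, mem_comp_self hz⟩
    obtain ⟨z1, hz1, -, x1, x2⟩ := e2 ne1
    obtain ⟨z2, hz2, -, y1, y2⟩ := e3 ne2
    exact no3 z hz ⟨h' ▸ y2, h ▸ x1, h ▸ x2⟩) e2' e3'
  have hRs : ∀ y ∈ R, y ∈ W ∧ y ≠ v ∧ y ≠ p1 ∧ y ≠ p2 ∧ y ≠ p3 := by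
    intro y hy
    simp only [hR, mem_sdiff, mem_insert_iff, mem_singleton_iff, not_or] at hy
    exact hy
  refine mk_K5 hk5 {v} X (insert p1 K1) (insert p2 K2) (insert p3 K3) (.singleton _) hX k1 k2 k3 ?_
    (.sl nv) (.sl (N_insert.2 (.inl a1))) (.sl (N_insert.2 (.inl a2))) (.sl (N_insert.2 (.inl a3)))
    ((Touch.sr n1).mono le_rfl (by simp)) ((Touch.sr n2).mono le_rfl (by simp))
    ((Touch.sr n3).mono le_rfl (by simp)) ((Touch.sr t1).mono le_rfl (by simp))
    ((Touch.sl t3).mono (by simp) le_rfl) ((Touch.sr t2).mono le_rfl (by simp))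
  intro y
  have q1 := hRs y
  have q2 := hWX y
  have q3 := D12 y
  have q4 := D13 y
  have q5 := D23 y
  have q6 := @s1 y
  have q7 := @s2 y
  have q8 := @s3 y
  simp only [mem_singleton_iff, mem_insert_iff]
  clear hRs hWX D12 D13 D23 s1 s2 s3 e1 e2 e3 e1' e2' e3' dj k1 k2 k3 t1 t2 t3 mk no3 l1 l2 l3 R1 R2 R3 c1 c2 c3 hk33 hk5 hX a1 a2 a3 nv n1 n2 n3 hR
  clear_value R
  refine ⟨?_, ?_, ?_, ?_⟩ <;> grind (splits := 30)

end
end BadCol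

namespace BadCol
section
variable {U : Type u} {H : SimpleGraph U}

/-- `φ` is proper on `W` -/
def Pr (H : SimpleGraph U) (W : Set U) (φ : U → ℕ) : Prop :=
  ∀ u ∈ W, ∀ v ∈ W, H.Adj u v → φ u ≠ φ v

/-- lists of size at least three, five in the interior, away from `P` -/
def Good (H : SimpleGraph U) (W X : Set U) (L : U → Finset ℕ) (P : Set U) : Prop :=
  ∀ z ∈ W, z ∉ P → 3 ≤ (L z).card ∧ (¬ N H X z → 5 ≤ (L z).card)

/-- standing assumptions -/
structure St (H : SimpleGraph U) (W X : Set U) : Prop where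
  fin : W.Finite
  conn : Conn H X
  dj : ∀ z ∈ W, z ∉ X

theorem St.sub {W W' X : Set U} (h : St H W X) (hs : W' ⊆ W) : St H W' X :=
  ⟨h.fin.subset hs, h.conn, fun z hz => h.dj z (hs hz)⟩

theorem St.del {W X : Set U} (h : St H W X) {v : U} (hN : N H X v) : St H (W \ {v}) (insert v X) :=
  ⟨h.fin.subset sdiff_subset, h.conn.insert hN, by
    rintro z ⟨hz, hzv⟩ (hz' | hz')
    · exact hzv hz'
    · exact h.dj z hz hz'⟩

open Classical in
/-- remove colours `F` from the lists of the vertices satisfying `Q` -/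
noncomputable def rm (L : U → Finset ℕ) (Q : U → Prop) (F : Finset ℕ) : U → Finset ℕ :=
  fun z => if Q z then L z \ F else L z

theorem mem_rm {L : U → Finset ℕ} {Q : U → Prop} {F : Finset ℕ} {z : U} {c : ℕ} :
    c ∈ rm L Q F z ↔ c ∈ L z ∧ (Q z → c ∉ F) := by
  unfold rm
  split_ifs with h <;> simp [h]

theorem rm_not {L : U → Finset ℕ} {Q : U → Prop} {F : Finset ℕ} {z : U} (h : ¬ Q z) :
    rm L Q F z = L z := by simp [rm, h]

theorem rm_of {L : U → Finset ℕ} {Q : U → Prop} {F : Finset ℕ} {z : U} (h : Q z) :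
    rm L Q F z = L z \ F := by simp [rm, h]

theorem card_rm {L : U → Finset ℕ} {Q : U → Prop} {F : Finset ℕ} {z : U} :
    (L z).card ≤ (rm L Q F z).card + F.card := by
  unfold rm
  split_ifs with h
  · have := Finset.le_card_sdiff F (L z); omega
  · omega

theorem Pr.sub {W W' : Set U} {φ : U → ℕ} (h : Pr H W φ) (hs : W' ⊆ W) : Pr H W' φ :=
  fun u hu v hv => h u (hs hu) v (hs hv)

open Classical in
theorem Pr.add {W : Set U} {φ : U → ℕ} {v : U} {c : ℕ} (h : Pr H (W \ {v}) φ)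
    (hc : ∀ w ∈ W, H.Adj w v → φ w ≠ c) : Pr H W (Function.update φ v c) := by
  intro x hx y hy hxy
  by_cases h1 : x = v
  · subst h1
    have : y ≠ x := hxy.ne'
    simp only [Function.update_self, Function.update_of_ne this]
    exact (hc y hy hxy.symm).symm
  · by_cases h2 : y = v
    · subst h2
      simp only [Function.update_self, Function.update_of_ne h1]
      exact hc x hx hxy
    · simp only [Function.update_of_ne h1, Function.update_of_ne h2]
      exact h x ⟨hx, h1⟩ y ⟨hy, h2⟩ hxy

/-- gluing -/
theorem glue {W1 W2 W : Set U} {φ1 φ2 : U → ℕ} (hW : ∀ z ∈ W, z ∈ W1 ∨ z ∈ W2)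
    (h1 : Pr H W1 φ1) (h2 : Pr H W2 φ2)
    (hag : ∀ z ∈ W1, z ∈ W2 → φ1 z = φ2 z)
    (hcr : ∀ x ∈ W1, ∀ y ∈ W2, H.Adj x y → x ∈ W2 ∨ y ∈ W1) :
    ∃ φ, Pr H W φ ∧ (∀ z ∈ W1, φ z = φ1 z) ∧ ∀ z ∈ W2, φ z = φ2 z := by
  classical
  have e1 : ∀ z ∈ W1, (if z ∈ W1 then φ1 z else φ2 z) = φ1 z := fun z hz => by simp [hz]
  have e2 : ∀ z ∈ W2, (if z ∈ W1 then φ1 z else φ2 z) = φ2 z := fun z hz => by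
    split_ifs with h
    · exact hag z h hz
    · rfl
  refine ⟨fun z => if z ∈ W1 then φ1 z else φ2 z, ?_, e1, e2⟩
  intro x hx y hy hxy
  have key : ∀ x ∈ W1, ∀ y ∈ W2, H.Adj x y →
      (if x ∈ W1 then φ1 x else φ2 x) ≠ (if y ∈ W1 then φ1 y else φ2 y) := by
    intro x hx y hy hxy
    rcases hcr x hx y hy hxy with h | h
    · rw [e2 x h, e2 y hy]; exact h2 x h y hy hxy
    · rw [e1 x hx, e1 y h]; exact h1 x hx y h hxy
  rcases hW x hx with hx1 | hx2
  · rcases hW y hy with hy1 | hy2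
    · show (if x ∈ W1 then φ1 x else φ2 x) ≠ (if y ∈ W1 then φ1 y else φ2 y)
      rw [e1 x hx1, e1 y hy1]; exact h1 x hx1 y hy1 hxy
    · exact key x hx1 y hy2 hxy
  · rcases hW y hy with hy1 | hy2
    · exact (key y hy1 x hx2 hxy.symm).symm
    · show (if x ∈ W1 then φ1 x else φ2 x) ≠ (if y ∈ W1 then φ1 y else φ2 y)
      rw [e2 x hx2, e2 y hy2]; exact h2 x hx2 y hy2 hxy

theorem set_ind {P : Set U → Prop} (h : ∀ W, W.Finite → (∀ W', W' ⊂ W → P W') → P W) :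
    ∀ W : Set U, W.Finite → P W := by
  have : ∀ n, ∀ W : Set U, W.Finite → W.ncard ≤ n → P W := by
    intro n
    induction n with
    | zero =>
      intro W hW hn
      refine h W hW fun W' hW' => ?_
      have := Set.ncard_lt_ncard hW' hW
      omega
    | succ n ih =>
      intro W hW hn
      refine h W hW fun W' hW' => ih W' (hW.subset hW'.subset) ?_
      have := Set.ncard_lt_ncard hW' hW
      omega
  exact fun W hW => this _ W hW le_rfl

theorem exists_ne1 {S : Finset ℕ} (h : 2 ≤ S.card) (a : ℕ) : ∃ c ∈ S, c ≠ a := by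
  obtain ⟨c, hc, h⟩ := Finset.exists_mem_ne (by omega : 1 < S.card) a
  exact ⟨c, hc, h⟩

theorem exists_nin {S F : Finset ℕ} (h : F.card < S.card) : ∃ c ∈ S, c ∉ F :=
  Finset.exists_mem_notMem_of_card_lt_card h

theorem exists_ne2 {S : Finset ℕ} (h : 3 ≤ S.card) (a b : ℕ) : ∃ c ∈ S, c ≠ a ∧ c ≠ b := by
  obtain ⟨c, hc, h⟩ := exists_nin (S := S) (F := {a, b})
    (lt_of_le_of_lt Finset.card_le_two (by omega))
  simp only [Finset.mem_insert, Finset.mem_singleton, not_or] at h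
  exact ⟨c, hc, h⟩

theorem exists_ne3 {S : Finset ℕ} (h : 4 ≤ S.card) (a b d : ℕ) :
    ∃ c ∈ S, c ≠ a ∧ c ≠ b ∧ c ≠ d := by
  obtain ⟨c, hc, h⟩ := exists_nin (S := S) (F := {a, b, d})
    (lt_of_le_of_lt Finset.card_le_three (by omega))
  simp only [Finset.mem_insert, Finset.mem_singleton, not_or] at h
  exact ⟨c, hc, h⟩

theorem exists_two {S : Finset ℕ} (h : 3 ≤ S.card) (a : ℕ) :
    ∃ s ∈ S, ∃ t ∈ S, s ≠ t ∧ s ≠ a ∧ t ≠ a := by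
  obtain ⟨s, hs, hsa⟩ := exists_ne1 (S := S) (by omega) a
  obtain ⟨t, ht, h1, h2⟩ := exists_ne2 h s a
  exact ⟨s, hs, t, ht, h1.symm, hsa, h2⟩

theorem pick {s t : ℕ} (h : s ≠ t) (c : ℕ) : ∃ y, (y = s ∨ y = t) ∧ y ≠ c := by
  by_cases hs : s = c
  · exact ⟨t, .inr rfl, fun h' => h (hs.trans h'.symm)⟩
  · exact ⟨s, .inl rfl, hs⟩

/-- statement of Thomassen's theorem for the vertex set `W` -/
def ThAt (H : SimpleGraph U) (W : Set U) : Prop :=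
  ∀ (X : Set U) (L : U → Finset ℕ) (x y : U) (α β : ℕ), St H W X → x ∈ W → y ∈ W →
    N H X x → N H X y → (x = y ∧ α = β ∨ H.Adj x y ∧ α ≠ β) → Good H W X L {x, y} →
    ∃ φ, Pr H W φ ∧ φ x = α ∧ φ y = β ∧ ∀ z ∈ W, z ≠ x → z ≠ y → φ z ∈ L z

def Th0At (H : SimpleGraph U) (W : Set U) : Prop :=
  ∀ (X : Set U) (L : U → Finset ℕ), St H W X → Good H W X L ∅ →
    ∃ φ, Pr H W φ ∧ ∀ z ∈ W, φ z ∈ L z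


theorem th0_of (W : Set U) (hW : W.Finite) : (∀ W' ⊆ W, ThAt H W') → Th0At H W := by
  classical
  refine set_ind (P := fun W => (∀ W' ⊆ W, ThAt H W') → Th0At H W) ?_ W hW
  intro W hWf ih hTh X L hst hg
  rcases W.eq_empty_or_nonempty with rfl | ⟨v, hv⟩
  · exact ⟨fun _ => 0, by simp [Pr], by simp⟩
  by_cases hB : ∃ x ∈ W, N H X x
  · obtain ⟨x, hx, hN⟩ := hB
    have hc := (hg x hx (by simp)).1
    obtain ⟨α, hα⟩ := Finset.card_pos.1 (by omega : 0 < (L x).card)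
    obtain ⟨φ, h1, h2, -, h3⟩ := hTh W le_rfl X L x x α α hst hx hx hN hN (.inl ⟨rfl, rfl⟩)
      (fun z hz _ => hg z hz (by simp))
    refine ⟨φ, h1, fun z hz => ?_⟩
    by_cases hzx : z = x
    · subst hzx; rw [h2]; exact hα
    · exact h3 z hz hzx hzx
  push Not at hB
  have hc := (hg v hv (by simp)).1
  obtain ⟨α, hα⟩ := Finset.card_pos.1 (by omega : 0 < (L v).card)
  have hss : W \ {v} ⊂ W := ⟨sdiff_subset, fun h => (h hv).2 rfl⟩
  obtain ⟨φ, h1, h2⟩ := ih (W \ {v}) hss (fun W' h => hTh W' (h.trans sdiff_subset)) {v}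
    (rm L (fun z => H.Adj z v) {α})
    ⟨hWf.subset sdiff_subset, .singleton v, fun z hz => hz.2⟩ (by
      intro z hz _
      have h5 := (hg z hz.1 (by simp)).2 (hB z hz.1)
      have := card_rm (L := L) (Q := fun z => H.Adj z v) (F := {α}) (z := z)
      simp only [Finset.card_singleton] at this
      refine ⟨by omega, fun h => ?_⟩
      rw [rm_not (by exact fun h' => h (N_single.2 h'))]
      exact h5)
  refine ⟨Function.update φ v α, h1.add ?_, ?_⟩
  · intro w hw hwv
    have := (mem_rm.1 (h2 w ⟨hw, hwv.ne⟩)).2 hwv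
    simpa using this
  · intro z hz
    by_cases hzv : z = v
    · subst hzv; simpa using hα
    · rw [Function.update_of_ne hzv]
      exact (mem_rm.1 (h2 z ⟨hz, hzv⟩)).1

/-- extend a colouring over a piece attached at an edge (or vertex) of the boundary -/
theorem extD {W X D : Set U} {L : U → Finset ℕ} {u v : U} {φ : U → ℕ}
    (hTh : ThAt H (D ∪ {u, v})) (hst : St H W X) (hD : D ⊆ W) (hu : u ∈ W) (hv : v ∈ W)
    (huD : u ∉ D) (hvD : v ∉ D) (hNu : N H X u) (hNv : N H X v) (huv : u = v ∨ H.Adj u v)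
    (hcl : ∀ d ∈ D, ∀ w ∈ W, H.Adj d w → w ∈ D ∨ w = u ∨ w = v)
    (hg : Good H D X L ∅) (hφ : Pr H (W \ D) φ) :
    ∃ ψ, Pr H W ψ ∧ (∀ z ∈ W \ D, ψ z = φ z) ∧ ∀ z ∈ D, ψ z ∈ L z := by
  have hsub : D ∪ {u, v} ⊆ W := by
    rintro z (hz | hz | hz)
    · exact hD hz
    · exact hz ▸ hu
    · exact hz ▸ hv
  obtain ⟨φ2, p1, p2, p3, p4⟩ := hTh X L u v (φ u) (φ v) (hst.sub hsub) (by simp) (by simp) hNu hNv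
    (by
      rcases huv with h | h
      · exact .inl ⟨h, by rw [h]⟩
      · exact .inr ⟨h, hφ u ⟨hu, huD⟩ v ⟨hv, hvD⟩ h⟩)
    (by
      intro z hz hz'
      exact hg z (hz.resolve_right hz') (by simp))
  obtain ⟨ψ, q1, q2, q3⟩ := glue (W := W) (W1 := W \ D) (W2 := D ∪ {u, v})
    (fun z hz => by by_cases h : z ∈ D <;> simp [h, hz]) hφ p1
    (by
      rintro z hz (h | h | h)
      · exact absurd h hz.2
      · rw [h, p2]
      · rw [h, p3])
    (by
      rintro x hx y hy hxy
      by_cases hyD : y ∈ D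
      · rcases hcl y hyD x hx.1 hxy.symm with h | h | h
        · exact absurd h hx.2
        · left; right; left; exact h
        · left; right; right; exact h
      · right; exact ⟨hsub hy, hyD⟩)
  refine ⟨ψ, q1, q2, fun z hz => ?_⟩
  rw [q3 z (.inl hz)]
  exact p4 z (.inl hz) (fun h => huD (h ▸ hz)) (fun h => hvD (h ▸ hz))

theorem comp_cl {W : Set U} {u v p : U} : ∀ d ∈ comp H (W \ {u, v}) p, ∀ w ∈ W, H.Adj d w →
    w ∈ comp H (W \ {u, v}) p ∨ w = u ∨ w = v := by
  intro d hd w hw h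
  by_cases h' : w ∈ ({u, v} : Set U)
  · exact .inr h'
  · exact .inl (comp_closed hd ⟨hw, h'⟩ h)

theorem ssub_of {W W' : Set U} (h : W' ⊆ W) {z : U} (hz : z ∈ W) (hz' : z ∉ W') : W' ⊂ W :=
  ⟨h, fun h' => hz' (h' hz)⟩

theorem thAt (hk33 : NoK33 H) (hk5 : NoK5 H) (W : Set U) (hW : W.Finite) : ThAt H W := by
  classical
  refine set_ind (P := fun W => ThAt H W) ?_ W hW
  clear hW W
  intro W hW ih X L x y α β hst hx hy hNx hNy hxy hg
  by_contra hno
  -- connectivity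
  have noD : ∀ u v : U, u ∈ W → v ∈ W → N H X u → N H X v → (u = v ∨ H.Adj u v) →
      ∀ p ∈ W \ {u, v}, ∀ q ∈ W \ {u, v}, q ∉ comp H (W \ {u, v}) p →
      x ∉ comp H (W \ {u, v}) p → y ∉ comp H (W \ {u, v}) p → False := by
    intro u v hu hv hNu hNv huv p hp q hq hqp hxD hyD
    set D := comp H (W \ {u, v}) p with hDdef
    have hDs : D ⊆ W := comp_sub.trans sdiff_subset
    have huD : u ∉ D := fun h => (comp_sub h).2 (by simp)
    have hvD : v ∉ D := fun h => (comp_sub h).2 (by simp)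
    obtain ⟨φ, f1, f2, f3, f4⟩ := ih (W \ D) (ssub_of sdiff_subset hp.1 (fun h => h.2 (mem_comp_self hp)))
      X L x y α β (hst.sub sdiff_subset) ⟨hx, hxD⟩ ⟨hy, hyD⟩ hNx hNy hxy
      (fun z hz hz' => hg z hz.1 hz')
    obtain ⟨ψ, g1, g2, g3⟩ := extD (L := L) (ih (D ∪ {u, v}) (ssub_of (union_subset hDs (by
      rintro z (h | h)
      · exact h ▸ hu
      · exact h ▸ hv)) hq.1 (by rintro (h | h); exacts [hqp h, hq.2 h]))) hst hDs hu hv huD hvD hNu hNv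
        huv comp_cl (fun z hz _ => hg z (hDs hz) (by
          rintro (h | h)
          · exact hxD (h ▸ hz)
          · exact hyD (h ▸ hz))) f1
    refine hno ⟨ψ, g1, by rw [g2 x ⟨hx, hxD⟩, f2], by rw [g2 y ⟨hy, hyD⟩, f3], fun z hz h1 h2 => ?_⟩
    by_cases hzD : z ∈ D
    · exact g3 z hzD
    · rw [g2 z ⟨hz, hzD⟩]; exact f4 z ⟨hz, hzD⟩ h1 h2
  have con : ∀ u v : U, u ∈ W → v ∈ W → N H X u → N H X v → (u = v ∨ H.Adj u v) →
      (W \ {u, v}).Nonempty → Conn H (W \ {u, v}) := by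
    intro u v hu hv hNu hNv huv hne
    by_contra hc
    obtain ⟨p, hp, q, hq, hqp⟩ := not_conn hne hc
    by_cases hpx : x ∉ comp H (W \ {u, v}) p ∧ y ∉ comp H (W \ {u, v}) p
    · exact noD u v hu hv hNu hNv huv p hp q hq hqp hpx.1 hpx.2
    have hpq : ∀ z, z ∈ comp H (W \ {u, v}) p → z ∉ comp H (W \ {u, v}) q := by
      intro z h1 h2
      rw [← comp_eq h1, comp_eq h2] at hqp
      exact hqp (mem_comp_self hq)
    refine noD u v hu hv hNu hNv huv q hq p hp (hpq p (mem_comp_self hp)) ?_ ?_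
    · intro h
      have h1 : x ∉ comp H (W \ {u, v}) p := fun h' => hpq x h' h
      have h2 : y ∈ comp H (W \ {u, v}) p := by tauto
      rcases hxy with ⟨e, -⟩ | ⟨e, -⟩
      · exact h1 (e ▸ h2)
      · exact h1 (comp_closed h2 (comp_sub h) e.symm)
    · intro h
      have h1 : y ∉ comp H (W \ {u, v}) p := fun h' => hpq y h' h
      have h2 : x ∈ comp H (W \ {u, v}) p := by tauto
      rcases hxy with ⟨e, -⟩ | ⟨e, -⟩
      · exact h1 (e ▸ h2)
      · exact h1 (comp_closed h2 (comp_sub h) e)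
  have deg : ∀ v p1 p2 p3 : U, v ∈ W → p1 ∈ W → p2 ∈ W → p3 ∈ W → N H X v → N H X p1 → N H X p2 →
      N H X p3 → H.Adj v p1 → H.Adj v p2 → H.Adj v p3 → p1 ≠ p2 → p1 ≠ p3 → p2 ≠ p3 → False := by
    intro v p1 p2 p3 hv h1 h2 h3 nv n1 n2 n3 a1 a2 a3 d12 d13 d23
    refine degLemma hk33 hk5 hst.conn hst.dj hv h1 h2 h3 nv n1 n2 n3 a1 a2 a3 d12 d13 d23
      (con v p1 hv h1 nv n1 (.inr a1) ⟨p2, h2, ?_⟩) (con v p2 hv h2 nv n2 (.inr a2) ⟨p1, h1, ?_⟩)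
      (con v p3 hv h3 nv n3 (.inr a3) ⟨p1, h1, ?_⟩)
    · rintro (h | h); exacts [a2.ne h.symm, d12 h.symm]
    · rintro (h | h); exacts [a1.ne h.symm, d12 h]
    · rintro (h | h); exacts [a1.ne h.symm, d13 h]
  -- a boundary neighbour
  have caseA : ∀ (x y : U) (α β : ℕ), x ∈ W → y ∈ W → N H X x → N H X y →
      (x = y ∧ α = β ∨ H.Adj x y ∧ α ≠ β) → Good H W X L {x, y} →
      (¬ ∃ φ, Pr H W φ ∧ φ x = α ∧ φ y = β ∧ ∀ z ∈ W, z ≠ x → z ≠ y → φ z ∈ L z) →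
      ∀ v ∈ W, N H X v → v ≠ x → v ≠ y → H.Adj v x → False := by
    intro x y α β hx hy hNx hNy hxy hg hno v hv hNv hvx hvy hadj
    have hcv := (hg v hv (by simp [hvx, hvy])).1
    have hss : W \ {v} ⊂ W := ssub_of sdiff_subset hv (fun h => h.2 rfl)
    by_cases hA : ∀ w ∈ W, N H X w → H.Adj v w → w = x ∨ w = y
    · obtain ⟨c, hc, hcα, hcβ⟩ := exists_ne2 hcv α β
      obtain ⟨φ, f1, f2, f3, f4⟩ := ih (W \ {v}) hss (insert v X) (rm L (fun z => H.Adj z v) {c})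
        x y α β (hst.del hNv) ⟨hx, hvx.symm⟩ ⟨hy, hvy.symm⟩ (hNx.mono (subset_insert _ _))
        (hNy.mono (subset_insert _ _)) hxy (by
          intro z hz hz'
          obtain ⟨g1, g2⟩ := hg z hz.1 hz'
          have := card_rm (L := L) (Q := fun z => H.Adj z v) (F := {c}) (z := z)
          simp only [Finset.card_singleton] at this
          by_cases hNz : N H X z
          · have hnz : ¬ H.Adj z v := fun h => hz' (hA z hz.1 hNz h.symm)
            rw [rm_not (by exact hnz)]
            exact ⟨g1, fun h => absurd (hNz.mono (subset_insert _ _)) h⟩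
          · have := g2 hNz
            refine ⟨by omega, fun h => ?_⟩
            rw [N_insert] at h
            rw [rm_not (by tauto)]
            exact this)
      refine hno ⟨Function.update φ v c, f1.add ?_, ?_, ?_, ?_⟩
      · intro w hw hwv
        by_cases h1 : w = x
        · subst h1; rw [f2]; exact hcα.symm
        by_cases h2 : w = y
        · subst h2; rw [f3]; exact hcβ.symm
        have := (mem_rm.1 (f4 w ⟨hw, hwv.ne⟩ h1 h2)).2 hwv
        simpa using this
      · rw [Function.update_of_ne hvx.symm, f2]
      · rw [Function.update_of_ne hvy.symm, f3]
      · intro z hz h1 h2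
        by_cases hzv : z = v
        · subst hzv; simpa using hc
        · rw [Function.update_of_ne hzv]
          exact (mem_rm.1 (f4 z ⟨hz, hzv⟩ h1 h2)).1
    · push Not at hA
      obtain ⟨u, hu, hNu, hvu, hux, huy⟩ := hA
      have hB : ∀ w ∈ W, N H X w → H.Adj v w → w = x ∨ w = u := by
        intro w hw hNw hvw
        by_contra hc
        push Not at hc
        exact deg v x u w hv hx hu hw hNv hNx hNu hNw hadj hvu hvw hux.symm hc.1.symm hc.2.symm
      obtain ⟨s, hs, t, ht, hst', hsα, htα⟩ := exists_two hcv α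
      obtain ⟨φ, f1, f2, f3, f4⟩ := ih (W \ {v}) hss (insert v X)
        (rm L (fun z => H.Adj z v ∧ ¬ N H X z) {s, t})
        x y α β (hst.del hNv) ⟨hx, hvx.symm⟩ ⟨hy, hvy.symm⟩ (hNx.mono (subset_insert _ _))
        (hNy.mono (subset_insert _ _)) hxy (by
          intro z hz hz'
          obtain ⟨g1, g2⟩ := hg z hz.1 hz'
          have := card_rm (L := L) (Q := fun z => H.Adj z v ∧ ¬ N H X z) (F := {s, t}) (z := z)
          have h2 : ({s, t} : Finset ℕ).card ≤ 2 := Finset.card_le_two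
          by_cases hNz : N H X z
          · rw [rm_not (by tauto)]
            exact ⟨g1, fun h => absurd (hNz.mono (subset_insert _ _)) h⟩
          · have := g2 hNz
            refine ⟨by omega, fun h => ?_⟩
            rw [N_insert] at h
            rw [rm_not (by tauto)]
            exact this)
      obtain ⟨c, hc, hcu⟩ := pick hst' (φ u)
      refine hno ⟨Function.update φ v c, f1.add ?_, ?_, ?_, ?_⟩
      · intro w hw hwv
        by_cases h1 : N H X w
        · rcases hB w hw h1 hwv.symm with rfl | rfl
          · rw [f2]; rcases hc with rfl | rfl
            · exact hsα.symm
            · exact htα.symm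
          · exact hcu.symm
        · have := (mem_rm.1 (f4 w ⟨hw, hwv.ne⟩ (fun h => h1 (h ▸ hNx)) (fun h => h1 (h ▸ hNy)))).2 ⟨hwv, h1⟩
          rintro rfl
          apply this
          simpa using hc
      · rw [Function.update_of_ne hvx.symm, f2]
      · rw [Function.update_of_ne hvy.symm, f3]
      · intro z hz h1 h2
        by_cases hzv : z = v
        · subst hzv; rw [Function.update_self]; rcases hc with rfl | rfl <;> assumption
        · rw [Function.update_of_ne hzv]
          exact (mem_rm.1 (f4 z ⟨hz, hzv⟩ h1 h2)).1
  have nA1 := caseA x y α β hx hy hNx hNy hxy hg hno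
  have nA2 := caseA y x β α hy hx hNy hNx (by
    rcases hxy with ⟨h1, h2⟩ | ⟨h1, h2⟩
    · exact .inl ⟨h1.symm, h2.symm⟩
    · exact .inr ⟨h1.symm, h2.symm⟩) (by rw [Set.pair_comm]; exact hg) (by
      rintro ⟨φ, f1, f2, f3, f4⟩
      exact hno ⟨φ, f1, f3, f2, fun z hz h1 h2 => f4 z hz h2 h1⟩)
  have hfin : (W \ {x, y}).Finite := hW.subset sdiff_subset
  have hXc : Conn H (insert x (insert y X)) :=
    (hst.conn.insert hNy).insert (hNx.mono (subset_insert _ _))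
  obtain ⟨φ, f1, f2⟩ := th0_of (W \ {x, y}) hfin (fun W' hW' => ih W' (ssub_of (hW'.trans sdiff_subset) hx
      (fun h => (hW' h).2 (by simp)))) (insert x (insert y X))
      (rm (rm L (fun z => H.Adj z x) {α}) (fun z => H.Adj z y) {β})
      ⟨hfin, hXc, by
        rintro z ⟨hz, hz'⟩ (h | h | h)
        · exact hz' (.inl h)
        · exact hz' (.inr h)
        · exact hst.dj z hz h⟩ (by
      intro z hz _
      obtain ⟨g1, g2⟩ := hg z hz.1 hz.2
      have hz1 : z ≠ x := fun h => hz.2 (.inl h)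
      have hz2 : z ≠ y := fun h => hz.2 (.inr h)
      have k1 := card_rm (L := L) (Q := fun z => H.Adj z x) (F := {α}) (z := z)
      have k2 := card_rm (L := rm L (fun z => H.Adj z x) {α}) (Q := fun z => H.Adj z y) (F := {β}) (z := z)
      simp only [Finset.card_singleton] at k1 k2
      by_cases hNz : N H X z
      · have e1 : ¬ H.Adj z x := fun h => nA1 z hz.1 hNz hz1 hz2 h
        have e2 : ¬ H.Adj z y := fun h => nA2 z hz.1 hNz hz2 hz1 h
        rw [rm_not (by exact e2), rm_not (by exact e1)]
        exact ⟨g1, fun h => absurd (hNz.mono ((subset_insert _ _).trans (subset_insert _ _))) h⟩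
      · have := g2 hNz
        refine ⟨by omega, fun h => ?_⟩
        rw [N_insert, N_insert] at h
        rw [rm_not (by tauto), rm_not (by tauto)]
        exact this)
  have e1 : ∀ z ∈ W \ {x, y}, φ z ∈ L z ∧ (H.Adj z x → φ z ≠ α) ∧ (H.Adj z y → φ z ≠ β) := by
    intro z hz
    obtain ⟨h1, h2⟩ := mem_rm.1 (f2 z hz)
    obtain ⟨h3, h4⟩ := mem_rm.1 h1
    simp only [Finset.mem_singleton] at h2 h4
    exact ⟨h3, h4, h2⟩
  have p1 : Pr H (W \ {x}) (Function.update φ y β) := by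
    refine Pr.add (f1.sub ?_) ?_
    · rintro z ⟨⟨hz, h1⟩, h2⟩
      exact ⟨hz, by rintro (h | h); exacts [h1 h, h2 h]⟩
    · intro w hw hwy
      exact (e1 w ⟨hw.1, by rintro (h | h); exacts [hw.2 h, hwy.ne h]⟩).2.2 hwy
  refine hno ⟨Function.update (Function.update φ y β) x α, p1.add ?_, by simp, ?_, ?_⟩
  · intro w hw hwx
    by_cases h : w = y
    · subst h
      rw [Function.update_self]
      rcases hxy with ⟨h1, h2⟩ | ⟨h1, h2⟩
      · exact absurd h1.symm hwx.ne
      · exact h2.symm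
    · rw [Function.update_of_ne h]
      exact (e1 w ⟨hw, by rintro (h' | h'); exacts [hwx.ne h', h h']⟩).2.1 hwx
  · rcases hxy with ⟨h1, h2⟩ | ⟨h1, h2⟩
    · subst h1; simpa using h2
    · rw [Function.update_of_ne h1.ne', Function.update_self]
  · intro z hz h1 h2
    rw [Function.update_of_ne h1, Function.update_of_ne h2]
    exact (e1 z ⟨hz, by rintro (h | h); exacts [h1 h, h2 h]⟩).1

end
end BadCol

namespace BadCol
section
variable {U : Type u} {H : SimpleGraph U}

/-- a path `a b c` of boundary vertices -/
structure Pth (H : SimpleGraph U) (W X : Set U) (a b c : U) : Prop where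
  aW : a ∈ W
  bW : b ∈ W
  cW : c ∈ W
  aN : N H X a
  bN : N H X b
  cN : N H X c
  ab : H.Adj a b
  bc : H.Adj b c
  ac : a ≠ c

theorem Pth.symm {W X : Set U} {a b c : U} (h : Pth H W X a b c) : Pth H W X c b a :=
  ⟨h.cW, h.bW, h.aW, h.cN, h.bN, h.aN, h.bc.symm, h.ab.symm, h.ac.symm⟩

theorem Pth.sub {W W' X : Set U} {a b c : U} (h : Pth H W X a b c) (ha : a ∈ W') (hb : b ∈ W')
    (hc : c ∈ W') : Pth H W' X a b c :=
  ⟨ha, hb, hc, h.aN, h.bN, h.cN, h.ab, h.bc, h.ac⟩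

/-- the colours `α β γ` of `a b c` extend to `W` -/
def Ext3 (H : SimpleGraph U) (W : Set U) (L : U → Finset ℕ) (a b c : U) (α β γ : ℕ) : Prop :=
  ∃ φ, Pr H W φ ∧ φ a = α ∧ φ b = β ∧ φ c = γ ∧ ∀ z ∈ W, z ≠ a → z ≠ b → z ≠ c → φ z ∈ L z

theorem Ext3.symm {W : Set U} {L : U → Finset ℕ} {a b c : U} {α β γ : ℕ}
    (h : Ext3 H W L a b c α β γ) : Ext3 H W L c b a γ β α := by
  obtain ⟨φ, h1, h2, h3, h4, h5⟩ := h
  exact ⟨φ, h1, h4, h3, h2, fun z hz a1 a2 a3 => h5 z hz a3 a2 a1⟩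

theorem Good.sub {W W' X : Set U} {L : U → Finset ℕ} {P P' : Set U} (h : Good H W X L P)
    (hs : W' ⊆ W) (hP : ∀ z ∈ W', z ∈ P → z ∈ P') : Good H W' X L P' :=
  fun z hz hz' => h z (hs hz) (fun h' => hz' (hP z hz h'))


theorem lemF (hk33 : NoK33 H) (hk5 : NoK5 H) {W X : Set U} {L : U → Finset ℕ} {a b c : U}
    {α β γ1 γ2 : ℕ} (hst : St H W X) (hp : Pth H W X a b c) (hg : Good H W X L {a, b, c})
    (hαβ : α ≠ β) (h1 : γ1 ≠ β) (h2 : γ2 ≠ β) (h12 : γ1 ≠ γ2) :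
    Ext3 H W L a b c α β γ1 ∨ Ext3 H W L a b c α β γ2 := by
  classical
  obtain ⟨φ, f1, f2, f3, f4⟩ := thAt hk33 hk5 W hst.fin X
    (Function.update L c {β, γ1, γ2}) a b α β hst hp.aW hp.bW hp.aN hp.bN (.inr ⟨hp.ab, hαβ⟩) (by
      intro z hz hz'
      by_cases hzc : z = c
      · subst hzc
        rw [Function.update_self, Finset.card_eq_three.2 ⟨β, γ1, γ2, h1.symm, h2.symm, h12, rfl⟩]
        exact ⟨le_rfl, fun h => absurd hp.cN h⟩
      · rw [Function.update_of_ne hzc]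
        refine hg z hz ?_
        rintro (h | h | h)
        · exact hz' (.inl h)
        · exact hz' (.inr h)
        · exact hzc h)
  have hc := f4 c hp.cW hp.ac.symm hp.bc.ne'
  rw [Function.update_self] at hc
  have hcb := f1 c hp.cW b hp.bW hp.bc.symm
  rw [f3] at hcb
  have hr : ∀ z ∈ W, z ≠ a → z ≠ b → z ≠ c → φ z ∈ L z := by
    intro z hz a1 a2 a3
    have := f4 z hz a1 a2
    rwa [Function.update_of_ne a3] at this
  simp only [Finset.mem_insert, Finset.mem_singleton] at hc
  rcases hc with h | h | h
  · exact absurd h hcb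
  · exact .inl ⟨φ, f1, f2, f3, h, hr⟩
  · exact .inr ⟨φ, f1, f2, f3, h, hr⟩

/-- `n` is a boundary neighbour of `b` separating `a` from `c` -/
def NCn (H : SimpleGraph U) (W X : Set U) (a b c n : U) : Prop :=
  n ∈ W ∧ N H X n ∧ n ≠ a ∧ n ≠ c ∧ H.Adj n b ∧ ∃ A C : Set U, Conn H A ∧ Conn H C ∧ a ∈ A ∧ c ∈ C ∧
    A ⊆ W \ {b, n} ∧ C ⊆ W \ {b, n} ∧ (∀ z ∈ A, z ∉ C) ∧ N H A n ∧ N H C n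

theorem NCn.symm {W X : Set U} {a b c n : U} (h : NCn H W X a b c n) : NCn H W X c b a n := by
  obtain ⟨h1, h2, h3, h4, h5, A, C, p1, p2, p3, p4, p5, p6, p7, p8, p9⟩ := h
  exact ⟨h1, h2, h4, h3, h5, C, A, p2, p1, p4, p3, p6, p5, fun z hz hz' => p7 z hz' hz, p9, p8⟩

theorem NCn.mono {W W' X : Set U} {a b c n : U} (h : NCn H W' X a b c n) (hs : W' ⊆ W) :
    NCn H W X a b c n := by
  obtain ⟨h1, h2, h3, h4, h5, A, C, p1, p2, p3, p4, p5, p6, p7, p8, p9⟩ := h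
  exact ⟨hs h1, h2, h3, h4, h5, A, C, p1, p2, p3, p4, p5.trans (sdiff_subset_sdiff_left hs),
    p6.trans (sdiff_subset_sdiff_left hs), p7, p8, p9⟩

theorem lemSep (hk5 : NoK5 H) {W X : Set U} {a b c n : U} (hst : St H W X)
    (hp : Pth H W X a b c) (h : NCn H W X a b c n) : c ∉ comp H (W \ {b, n}) a := by
  obtain ⟨hn, hNn, hna, hnc, hnb, A, C, p1, p2, p3, p4, p5, p6, p7, p8, p9⟩ := h
  intro hc
  set R := W \ {b, n} with hR
  have hA : A ⊆ comp H (R \ C) a := conn_sub_comp p1 (fun z hz => ⟨p5 hz, p7 z hz⟩) p3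
  have hA's : comp H (R \ C) a ⊆ R \ C := comp_sub
  have hA'c : Conn H (comp H (R \ C) a) := comp_conn ⟨p5 p3, p7 a p3⟩
  obtain ⟨x, hx, y, hy, hyA, hxR, hxy⟩ := rch_exit (K := comp H (R \ C) a) hc.2 (hA p3)
    (fun h => (hA's h).2 p4)
  have hyC : y ∈ C := by
    by_contra hyC
    exact hyA (comp_closed hx ⟨hy, hyC⟩ hxy)
  generalize comp H (R \ C) a = A' at *
  have hRs : ∀ z ∈ R, z ∈ W ∧ z ≠ b ∧ z ≠ n := by
    intro z hz
    exact ⟨hz.1, fun h => hz.2 (.inl h), fun h => hz.2 (.inr h)⟩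
  refine mk_K5 hk5 A' C {b} {n} X hA'c p2 (.singleton _) (.singleton _) hst.conn ?_
    ⟨x, hx, y, hyC, hxy⟩ ⟨a, hA p3, b, rfl, hp.ab⟩ (.sr (p8.mono hA))
    ((Touch.sl hp.aN).mono (by simpa using hA p3) le_rfl) ⟨c, p4, b, rfl, hp.bc.symm⟩ (.sr p9)
    ((Touch.sl hp.cN).mono (by simpa using p4) le_rfl) (.ss hnb.symm) (.sl hp.bN) (.sl hNn)
  intro z
  simp only [mem_singleton_iff]
  refine ⟨fun hz => ?_, fun hz => ?_, ?_, ?_⟩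
  · obtain ⟨h1, h2⟩ := hA's hz
    obtain ⟨h3, h4, h5⟩ := hRs z h1
    exact ⟨h2, h4, h5, hst.dj z h3⟩
  · obtain ⟨h3, h4, h5⟩ := hRs z (p6 hz)
    exact ⟨h4, h5, hst.dj z h3⟩
  · rintro rfl; exact ⟨hnb.ne', hst.dj _ hp.bW⟩
  · rintro rfl; exact hst.dj _ hn

/-- a bad colouring of the path `a b c` -/
structure Bad (H : SimpleGraph U) (W X : Set U) (L : U → Finset ℕ) (a b c : U) (α β γ : ℕ) : Prop where
  st : St H W X
  p : Pth H W X a b c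
  nac : ¬ H.Adj a c
  g : Good H W X L {a, b, c}
  ab : α ≠ β
  bc : β ≠ γ
  bad : ¬ Ext3 H W L a b c α β γ

theorem Bad.symm {W X : Set U} {L : U → Finset ℕ} {a b c : U} {α β γ : ℕ}
    (h : Bad H W X L a b c α β γ) : Bad H W X L c b a γ β α :=
  ⟨h.st, h.p.symm, fun h' => h.nac h'.symm, h.g.sub le_rfl (by
    intro z _ hz; simp only [mem_insert_iff, mem_singleton_iff] at hz ⊢; tauto), h.bc.symm, h.ab.symm,
    fun h' => h.bad h'.symm⟩

theorem three_aux {S : Finset ℕ} (hS : 3 ≤ S.card) {β : ℕ} {EA EC : ℕ → Prop}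
    (hA : ∀ o o', o ≠ β → o' ≠ β → o ≠ o' → EA o ∨ EA o')
    (hC : ∀ o o', o ≠ β → o' ≠ β → o ≠ o' → EC o ∨ EC o')
    (hG : ∀ o ∈ S, o ≠ β → EA o → EC o → False) :
    ∃ o1 o2, o1 ≠ β ∧ o2 ≠ β ∧ o1 ≠ o2 ∧ S = {β, o1, o2} ∧ ¬ EA o1 ∧ ¬ EC o2 := by
  obtain ⟨x, hx, y, hy, hxy, hxb, hyb⟩ := exists_two hS β
  have main : ∀ x ∈ S, ∀ y ∈ S, x ≠ y → x ≠ β → y ≠ β → ¬ EA x →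
      ∃ o1 o2, o1 ≠ β ∧ o2 ≠ β ∧ o1 ≠ o2 ∧ S = {β, o1, o2} ∧ ¬ EA o1 ∧ ¬ EC o2 := by
    intro x hx y hy hxy hxb hyb hEx
    have h1 : EA y := (hA x y hxb hyb hxy).resolve_left hEx
    have h2 : ¬ EC y := fun h => hG y hy hyb h1 h
    refine ⟨x, y, hxb, hyb, hxy, ?_, hEx, h2⟩
    apply Finset.eq_of_subset_of_card_le
    · intro z hz
      simp only [Finset.mem_insert, Finset.mem_singleton]
      by_contra hc
      push Not at hc
      obtain ⟨c1, c2, c3⟩ := hc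
      exact hG z hz c1 ((hA x z hxb c1 c2.symm).resolve_left hEx)
        ((hC y z hyb c1 c3.symm).resolve_left h2)
    · exact Finset.card_le_three.trans hS
  by_cases h : EA x
  · have h1 : ¬ EC x := fun h' => hG x hx hxb h h'
    have h2 : EC y := (hC x y hxb hyb hxy).resolve_left h1
    exact main y hy x hx hxy.symm hyb hxb (fun h' => hG y hy hyb h' h2)
  · exact main x hx y hy hxy hxb hyb h

theorem lemComp (hk33 : NoK33 H) (hk5 : NoK5 H) {W X : Set U} {L : U → Finset ℕ} {a b c n : U}
    {α β γ : ℕ} (h : Bad H W X L a b c α β γ) (hn : n ∈ W) (hNn : N H X n) (hna : n ≠ a)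
    (hnc : n ≠ c) (hnb : H.Adj n b) (hs : c ∉ comp H (W \ {b, n}) a) :
    ∃ o1 o2, o1 ≠ β ∧ o2 ≠ β ∧ o1 ≠ o2 ∧ L n = {β, o1, o2} ∧
      ¬ Ext3 H (comp H (W \ {b, n}) a ∪ {b, n}) L a b n α β o1 ∧
      ¬ Ext3 H (W \ comp H (W \ {b, n}) a) L n b c o2 β γ := by
  have hp := h.p
  have hab := hp.ab.ne
  have hbc := hp.bc.ne
  set A := comp H (W \ {b, n}) a with hAdef
  have haA : a ∈ A := mem_comp_self ⟨hp.aW, by rintro (h | h); exacts [hp.ab.ne h, hna h.symm]⟩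
  have hAs : ∀ z ∈ A, z ∈ W ∧ z ≠ b ∧ z ≠ n := by
    intro z hz
    have hz := comp_sub hz
    exact ⟨hz.1, fun h => hz.2 (.inl h), fun h => hz.2 (.inr h)⟩
  have hbA : b ∉ A := fun h => (hAs b h).2.1 rfl
  have hnA : n ∉ A := fun h => (hAs n h).2.2 rfl
  have hWA : A ∪ {b, n} ⊆ W := by
    rintro z (hz | hz | hz)
    · exact (hAs z hz).1
    · exact hz ▸ hp.bW
    · exact hz ▸ hn
  have hnL := (h.g n hn (by rintro (h | h | h); exacts [hna h, hnb.ne h, hnc h])).1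
  have pA : Pth H (A ∪ {b, n}) X a b n :=
    ⟨.inl haA, .inr (.inl rfl), .inr (.inr rfl), hp.aN, hp.bN, hNn, hp.ab, hnb.symm, hna.symm⟩
  have pC : Pth H (W \ A) X n b c :=
    ⟨⟨hn, hnA⟩, ⟨hp.bW, hbA⟩, ⟨hp.cW, hs⟩, hNn, hp.bN, hp.cN, hnb, hp.bc, hnc⟩
  have gA : Good H (A ∪ {b, n}) X L {a, b, n} := h.g.sub hWA (by
    rintro z hz (h | h | h)
    · exact .inl h
    · exact .inr (.inl h)
    · rcases hz with hz | hz | hz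
      · exact absurd (h ▸ hz) hs
      · exact .inr (.inl hz)
      · exact .inr (.inr hz))
  have gC : Good H (W \ A) X L {n, b, c} := h.g.sub sdiff_subset (by
    rintro z hz (h | h | h)
    · exact absurd (h ▸ haA) hz.2
    · exact .inr (.inl h)
    · exact .inr (.inr h))
  refine three_aux hnL (EA := fun o => Ext3 H (A ∪ {b, n}) L a b n α β o)
    (EC := fun o => Ext3 H (W \ A) L n b c o β γ) ?_ ?_ ?_
  · intro o o' ho ho' hoo
    exact lemF hk33 hk5 (h.st.sub hWA) pA gA h.ab ho ho' hoo
  · intro o o' ho ho' hoo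
    rcases lemF hk33 hk5 (h.st.sub sdiff_subset) pC.symm (gC.sub le_rfl (by
      intro z _ hz; simp only [mem_insert_iff, mem_singleton_iff] at hz ⊢; tauto)) h.bc.symm ho ho' hoo with h | h
    · exact .inl h.symm
    · exact .inr h.symm
  · rintro o ho hob ⟨φ, f1, f2, f3, f4, f5⟩ ⟨ψ, g1, g2, g3, g4, g5⟩
    obtain ⟨χ, q1, q2, q3⟩ := glue (W := W) (W1 := A ∪ {b, n}) (W2 := W \ A)
      (fun z hz => by by_cases h : z ∈ A <;> simp [h, hz]) f1 g1
      (by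
        rintro z (hz | hz | hz) hz'
        · exact absurd hz hz'.2
        · rw [hz, f3, g3]
        · rw [hz, f4, g2])
      (by
        rintro x (hx | hx) y hy hxy
        · right
          rcases comp_cl x hx y hy.1 hxy with h | h | h
          · exact .inl h
          · exact .inr (.inl h)
          · exact .inr (.inr h)
        · left
          exact ⟨hWA (.inr hx), by rcases hx with h | h <;> rw [h] <;> assumption⟩)
    refine h.bad ⟨χ, q1, ?_, ?_, ?_, ?_⟩
    · rw [q2 a (.inl haA), f2]
    · rw [q2 b (.inr (.inl rfl)), f3]
    · rw [q3 c ⟨hp.cW, hs⟩, g4]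
    · intro z hz z1 z2 z3
      by_cases hzn : z = n
      · subst hzn; rw [q2 z (.inr (.inr rfl)), f4]; exact ho
      by_cases hzA : z ∈ A
      · rw [q2 z (.inl hzA)]; exact f5 z (.inl hzA) z1 z2 hzn
      · rw [q3 z ⟨hz, hzA⟩]; exact g5 z ⟨hz, hzA⟩ hzn z2 z3

/-- no bad colouring when `b` separates `a` from `c` -/
theorem sepb (hk33 : NoK33 H) (hk5 : NoK5 H) {W X : Set U} {L : U → Finset ℕ} {a b c : U}
    {α β γ : ℕ} (h : Bad H W X L a b c α β γ) {D : Set U} (hD : D ⊆ W) (haD : a ∈ D) (hbD : b ∉ D)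
    (hcD : c ∉ D) (hcl : ∀ d ∈ D, ∀ w ∈ W, H.Adj d w → w ∈ D ∨ w = b) : False := by
  have hp := h.p
  obtain ⟨φ, f1, f2, f3, f4⟩ := thAt hk33 hk5 (W \ D) (h.st.fin.subset sdiff_subset) X L b c β γ
    (h.st.sub sdiff_subset) ⟨hp.bW, hbD⟩ ⟨hp.cW, hcD⟩ hp.bN hp.cN (.inr ⟨hp.bc, h.bc⟩)
    (h.g.sub sdiff_subset (by
      rintro z hz (h | h)
      · exact absurd (h ▸ haD) hz.2
      · exact h))
  have hs : D ∪ {b} ⊆ W := union_subset hD (by simpa using hp.bW)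
  obtain ⟨ψ, g1, g2, g3, g4⟩ := thAt hk33 hk5 (D ∪ {b}) (h.st.fin.subset hs) X L a b α β
    (h.st.sub hs) (.inl haD) (.inr rfl) hp.aN hp.bN (.inr ⟨hp.ab, h.ab⟩)
    (h.g.sub hs (by
      rintro z hz (h | h | h)
      · exact .inl h
      · exact .inr h
      · rcases hz with hz | hz
        · exact absurd (h ▸ hz) hcD
        · exact .inr hz))
  obtain ⟨χ, q1, q2, q3⟩ := glue (W := W) (W1 := D ∪ {b}) (W2 := W \ D)
      (fun z hz => by by_cases h : z ∈ D <;> simp [h, hz]) g1 f1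
      (by
        rintro z (hz | hz) hz'
        · exact absurd hz hz'.2
        · rw [hz, f2, g3])
      (by
        rintro x (hx | hx) y hy hxy
        · right; exact hcl x hx y hy.1 hxy
        · left; rw [hx]; exact ⟨hp.bW, hbD⟩)
  refine h.bad ⟨χ, q1, ?_, ?_, ?_, ?_⟩
  · rw [q2 a (.inl haD), g2]
  · rw [q2 b (.inr rfl), g3]
  · rw [q3 c ⟨hp.cW, hcD⟩, f3]
  · intro z hz z1 z2 z3
    by_cases hzD : z ∈ D
    · rw [q2 z (.inl hzD)]; exact g4 z (.inl hzD) z1 z2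
    · rw [q3 z ⟨hz, hzD⟩]; exact f4 z ⟨hz, hzD⟩ z2 z3

/-- critical -/
def Crit (H : SimpleGraph U) (W : Set U) (L : U → Finset ℕ) (a b c : U) (α β γ : ℕ) : Prop :=
  ∀ W' ⊂ W, a ∈ W' → b ∈ W' → c ∈ W' → Ext3 H W' L a b c α β γ

theorem Crit.symm {W : Set U} {L : U → Finset ℕ} {a b c : U} {α β γ : ℕ}
    (h : Crit H W L a b c α β γ) : Crit H W L c b a γ β α :=
  fun W' h' ha hb hc => (h W' h' hc hb ha).symm

theorem Bad.sub {W W' X : Set U} {L : U → Finset ℕ} {a b c : U} {α β γ : ℕ}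
    (h : Bad H W X L a b c α β γ) (hs : W' ⊆ W) (ha : a ∈ W') (hb : b ∈ W') (hc : c ∈ W')
    (hbad : ¬ Ext3 H W' L a b c α β γ) : Bad H W' X L a b c α β γ :=
  ⟨h.st.sub hs, h.p.sub ha hb hc, h.nac, h.g.sub hs (fun _ _ h => h), h.ab, h.bc, hbad⟩

theorem Bad.crit {W X : Set U} {L : U → Finset ℕ} {a b c : U} {α β γ : ℕ}
    (h : Bad H W X L a b c α β γ) :
    ∃ W' ⊆ W, Bad H W' X L a b c α β γ ∧ Crit H W' L a b c α β γ := by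
  refine set_ind (P := fun W => Bad H W X L a b c α β γ →
    ∃ W' ⊆ W, Bad H W' X L a b c α β γ ∧ Crit H W' L a b c α β γ) ?_ W h.st.fin h
  intro W _ ih h
  by_cases hc : Crit H W L a b c α β γ
  · exact ⟨W, le_rfl, h, hc⟩
  · unfold Crit at hc
    push Not at hc
    obtain ⟨W', hs, ha, hb, hc, hE⟩ := hc
    obtain ⟨W'', hs', h1, h2⟩ := ih W' hs (h.sub hs.subset ha hb hc hE)
    exact ⟨W'', hs'.trans hs.subset, h1, h2⟩

theorem crit_conn (hk33 : NoK33 H) (hk5 : NoK5 H) {W X : Set U} {L : U → Finset ℕ} {a b c : U}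
    {α β γ : ℕ} (h : Bad H W X L a b c α β γ) (hcr : Crit H W L a b c α β γ)
    (hnc : ∀ n, ¬ NCn H W X a b c n) {u v : U} (hu : u ∈ W) (hv : v ∈ W) (hNu : N H X u)
    (hNv : N H X v) (huv : u = v ∨ H.Adj u v) (hne : (W \ {u, v}).Nonempty) :
    Conn H (W \ {u, v}) := by
  have hp := h.p
  by_contra hc
  obtain ⟨p, hpm, q, hq, hqp⟩ := not_conn hne hc
  -- every component meets the path
  have meet : ∀ p ∈ W \ {u, v}, a ∈ comp H (W \ {u, v}) p ∨ b ∈ comp H (W \ {u, v}) p ∨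
      c ∈ comp H (W \ {u, v}) p := by
    intro p hpm
    by_contra hno
    push Not at hno
    obtain ⟨haD, hbD, hcD⟩ := hno
    have hpD := mem_comp_self (H := H) hpm
    have hDs : comp H (W \ {u, v}) p ⊆ W := comp_sub.trans sdiff_subset
    have huD : u ∉ comp H (W \ {u, v}) p := fun h => (comp_sub h).2 (by simp)
    have hvD : v ∉ comp H (W \ {u, v}) p := fun h => (comp_sub h).2 (by simp)
    have hcl := comp_cl (H := H) (W := W) (u := u) (v := v) (p := p)
    generalize comp H (W \ {u, v}) p = D at *
    obtain ⟨φ, f1, f2, f3, f4, f5⟩ := hcr (W \ D) (ssub_of sdiff_subset hpm.1 (fun h => h.2 hpD))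
      ⟨hp.aW, haD⟩ ⟨hp.bW, hbD⟩ ⟨hp.cW, hcD⟩
    have hfin : (D ∪ {u, v}).Finite := (h.st.fin.subset hDs).union (by simp)
    obtain ⟨ψ, g1, g2, g3⟩ := extD (L := L) (thAt hk33 hk5 _ hfin) h.st hDs hu hv huD hvD hNu hNv
      huv hcl (fun z hz _ => h.g z (hDs hz) (by
          rintro (h | h | h)
          · exact haD (h ▸ hz)
          · exact hbD (h ▸ hz)
          · exact hcD (h ▸ hz))) f1
    refine h.bad ⟨ψ, g1, ?_, ?_, ?_, ?_⟩
    · rw [g2 a ⟨hp.aW, haD⟩, f2]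
    · rw [g2 b ⟨hp.bW, hbD⟩, f3]
    · rw [g2 c ⟨hp.cW, hcD⟩, f4]
    · intro z hz z1 z2 z3
      by_cases hzD : z ∈ D
      · exact g3 z hzD
      · rw [g2 z ⟨hz, hzD⟩]; exact f5 z ⟨hz, hzD⟩ z1 z2 z3
  have key : ∀ z ∈ comp H (W \ {u, v}) p, z ∉ comp H (W \ {u, v}) q := by
    intro z h1 h2
    rw [← comp_eq h1, comp_eq h2] at hqp
    exact hqp (mem_comp_self hq)
  -- the vertex `b` is removed
  have hb : b ∉ W \ {u, v} := by
    intro hb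
    have hall : ∀ p ∈ W \ {u, v}, b ∈ comp H (W \ {u, v}) p := by
      intro p hpm
      rcases meet p hpm with h | h | h
      · exact comp_closed h hb hp.ab
      · exact h
      · exact comp_closed h hb hp.bc.symm
    exact key b (hall p hpm) (hall q hq)
  have hab : c ∉ comp H (W \ {u, v}) a ∧ a ∈ W \ {u, v} ∧ c ∈ W \ {u, v} := by
    have mp := meet p hpm
    have mq := meet q hq
    have nb : ∀ p, b ∉ comp H (W \ {u, v}) p := fun p h => hb (comp_sub h)
    have e1 := key a
    have e2 := key c
    rcases mp with h1 | h1 | h1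
    · rcases mq with h2 | h2 | h2
      · exact absurd h2 (e1 h1)
      · exact absurd h2 (nb _)
      · rw [comp_eq h1]
        exact ⟨fun h => e2 h h2, comp_sub h1, comp_sub h2⟩
    · exact absurd h1 (nb _)
    · rcases mq with h2 | h2 | h2
      · rw [comp_eq h2]
        exact ⟨fun h => e2 h1 h, comp_sub h2, comp_sub h1⟩
      · exact absurd h2 (nb _)
      · exact absurd h2 (e2 h1)
  obtain ⟨hca, haW, hcW⟩ := hab
  have hac : a ∉ comp H (W \ {u, v}) c := by
    intro h
    rw [comp_eq h] at hca
    exact hca (mem_comp_self hcW)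
  -- name the other vertex
  have main : ∀ n, n ∈ W → N H X n → W \ {u, v} = W \ {b, n} → (n = b ∨ H.Adj n b) → False := by
    intro n hn hNn he hnb
    rw [he] at hca hac haW hcW
    have hbA : ∀ z, b ∉ comp H (W \ {b, n}) z := fun z h => (comp_sub h).2 (by simp)
    have hs : ∀ z, comp H (W \ {b, n}) z ⊆ W := fun z => comp_sub.trans sdiff_subset
    have cA : N H (comp H (W \ {b, n}) a) n ∧ n ≠ b := by
      by_contra hno
      refine sepb hk33 hk5 h (hs a) (mem_comp_self haW) (hbA a) hca ?_
      intro d hd w hw hdw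
      rcases comp_cl d hd w hw hdw with h | h | h
      · exact .inl h
      · exact .inr h
      · subst h
        by_contra hc
        push Not at hc
        exact hno ⟨⟨d, hd, hdw.symm⟩, hc.2⟩
    have cC : N H (comp H (W \ {b, n}) c) n := by
      by_contra hno
      refine sepb hk33 hk5 h.symm (hs c) (mem_comp_self hcW) (hbA c) hac ?_
      intro d hd w hw hdw
      rcases comp_cl d hd w hw hdw with h | h | h
      · exact .inl h
      · exact .inr h
      · subst h
        exact absurd ⟨d, hd, hdw.symm⟩ hno
    refine hnc n ⟨hn, hNn, fun h => haW.2 (by simp [h]), fun h => hcW.2 (by simp [h]),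
      hnb.resolve_left cA.2, _, _, comp_conn haW, comp_conn hcW, mem_comp_self haW,
      mem_comp_self hcW, comp_sub, comp_sub, ?_, cA.1, cC⟩
    intro z h1 h2
    rw [← comp_eq h1, comp_eq h2] at hca
    exact hca (mem_comp_self hcW)
  have hb' : b = u ∨ b = v := by
    by_contra hc
    exact hb ⟨hp.bW, hc⟩
  rcases hb' with rfl | rfl
  · exact main v hv hNv rfl (by rcases huv with h | h; exacts [.inl h.symm, .inr h.symm])
  · exact main u hu hNu (by rw [Set.pair_comm]) huv

theorem crit_deg (hk33 : NoK33 H) (hk5 : NoK5 H) {W X : Set U} {L : U → Finset ℕ} {a b c : U}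
    {α β γ : ℕ} (h : Bad H W X L a b c α β γ) (hcr : Crit H W L a b c α β γ)
    (hnc : ∀ n, ¬ NCn H W X a b c n) {v p1 p2 p3 : U} (hv : v ∈ W) (h1 : p1 ∈ W) (h2 : p2 ∈ W)
    (h3 : p3 ∈ W) (nv : N H X v) (n1 : N H X p1) (n2 : N H X p2) (n3 : N H X p3)
    (a1 : H.Adj v p1) (a2 : H.Adj v p2) (a3 : H.Adj v p3)
    (d12 : p1 ≠ p2) : p3 = p1 ∨ p3 = p2 := by
  by_contra hc
  push Not at hc
  obtain ⟨d13, d23⟩ := hc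
  refine degLemma hk33 hk5 h.st.conn h.st.dj hv h1 h2 h3 nv n1 n2 n3 a1 a2 a3 d12 d13.symm d23.symm
      (crit_conn hk33 hk5 h hcr hnc hv h1 nv n1 (.inr a1) ⟨p2, h2, ?_⟩)
      (crit_conn hk33 hk5 h hcr hnc hv h2 nv n2 (.inr a2) ⟨p1, h1, ?_⟩)
      (crit_conn hk33 hk5 h hcr hnc hv h3 nv n3 (.inr a3) ⟨p1, h1, ?_⟩)
  · rintro (h | h); exacts [a2.ne h.symm, d12 h.symm]
  · rintro (h | h); exacts [a1.ne h.symm, d12 h]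
  · rintro (h | h); exacts [a1.ne h.symm, d13 h.symm]

end
end BadCol

namespace BadCol
section
variable {U : Type u} {H : SimpleGraph U}

/-- a common neighbour of the path -/
def Hub (H : SimpleGraph U) (W : Set U) (a b c h : U) : Prop :=
  h ∈ W ∧ h ≠ a ∧ h ≠ b ∧ h ≠ c ∧ H.Adj h a ∧ H.Adj h b ∧ H.Adj h c

def MAt (H : SimpleGraph U) (W : Set U) : Prop :=
  ∀ (X : Set U) (L : U → Finset ℕ) (a b c : U) (α β γ : ℕ), Bad H W X L a b c α β γ →
    (∃ n, NCn H W X a b c n) ∨ ∃ h, Hub H W a b c h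

def QAt (H : SimpleGraph U) (W : Set U) : Prop :=
  ∀ (X : Set U) (L : U → Finset ℕ) (a b c : U) (α β γ : ℕ), Bad H W X L a b c α β γ →
    (∀ z ∈ W, z ≠ a → z ≠ b → z ≠ c → 4 ≤ (L z).card) → False

def UAt (H : SimpleGraph U) (W : Set U) : Prop :=
  ∀ (X : Set U) (L : U → Finset ℕ) (a b c : U) (α β γ α' β' γ' : ℕ), Bad H W X L a b c α β γ →
    Bad H W X L a b c α' β' γ' → (∀ n, ¬ NCn H W X a b c n) → α = α' ∧ β = β' ∧ γ = γ'

def WAt (H : SimpleGraph U) (W : Set U) : Prop :=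
  ∀ (X : Set U) (L : U → Finset ℕ) (a b c : U) (α p γ q γ' : ℕ), Bad H W X L a b c α p γ →
    Bad H W X L a b c α q γ' → p ≠ q →
    ∃ w ∈ W, N H X w ∧ w ≠ a ∧ w ≠ b ∧ w ≠ c ∧ H.Adj w a ∧ H.Adj w b ∧ L w = {p, q, α}

theorem crit_b (hk33 : NoK33 H) (hk5 : NoK5 H) {W X : Set U} {L : U → Finset ℕ} {a b c : U}
    {α β γ : ℕ} (h : Bad H W X L a b c α β γ) (hcr : Crit H W L a b c α β γ)
    (hnc : ∀ n, ¬ NCn H W X a b c n) {w : U} (hw : w ∈ W) (hNw : N H X w) (hwb : H.Adj w b) :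
    w = a ∨ w = c :=
  crit_deg hk33 hk5 h hcr hnc h.p.bW h.p.aW h.p.cW hw h.p.bN h.p.aN h.p.cN hNw h.p.ab.symm h.p.bc
    hwb.symm h.p.ac

theorem hub_notB {W X : Set U} {a b c h : U} (hp : Pth H W X a b c) (hh : Hub H W a b c h)
    (hnc : ∀ n, ¬ NCn H W X a b c n) : ¬ N H X h := by
  intro hN
  obtain ⟨h1, h2, h3, h4, h5, h6, h7⟩ := hh
  refine hnc h ⟨h1, hN, h2, h4, h6, {a}, {c}, .singleton _, .singleton _, rfl, rfl, ?_, ?_, ?_,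
    N_single.2 h5, N_single.2 h7⟩
  · rintro z rfl
    exact ⟨hp.aW, by rintro (h | h); exacts [hp.ab.ne h, h2 h.symm]⟩
  · rintro z rfl
    exact ⟨hp.cW, by rintro (h | h); exacts [hp.bc.ne h.symm, h4 h.symm]⟩
  · rintro z rfl h
    exact hp.ac h

/-- pass from `a b c` to `a h c` by deleting `b` -/
theorem hubstep (hk33 : NoK33 H) (hk5 : NoK5 H) {W X : Set U} {L : U → Finset ℕ} {a b c h : U}
    {α β γ : ℕ} (hB : Bad H W X L a b c α β γ) (hcr : Crit H W L a b c α β γ)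
    (hnc : ∀ n, ¬ NCn H W X a b c n) (hh : Hub H W a b c h) {χ : ℕ} (hχ : χ ∈ L h)
    (hα : χ ≠ α) (hβ : χ ≠ β) (hγ : χ ≠ γ) :
    Bad H (W \ {b}) (insert b X) (rm L (fun z => H.Adj z b) {β}) a h c α χ γ := by
  classical
  have hp := hB.p
  obtain ⟨h1, h2, h3, h4, h5, h6, h7⟩ := hh
  refine ⟨hB.st.del hp.bN, ⟨⟨hp.aW, hp.ab.ne⟩, ⟨h1, h3⟩, ⟨hp.cW, hp.bc.ne'⟩,
    hp.aN.mono (subset_insert _ _), N_insert.2 (.inl h6), hp.cN.mono (subset_insert _ _), h5.symm,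
    h7, hp.ac⟩, hB.nac, ?_, hα.symm, hγ, ?_⟩
  · intro z hz hz'
    have hza : z ≠ a := fun h => hz' (.inl h)
    have hzc : z ≠ c := fun h => hz' (.inr (.inr h))
    obtain ⟨g1, g2⟩ := hB.g z hz.1 (by rintro (h | h | h); exacts [hza h, hz.2 h, hzc h])
    have := card_rm (L := L) (Q := fun z => H.Adj z b) (F := {β}) (z := z)
    simp only [Finset.card_singleton] at this
    by_cases hNz : N H X z
    · rw [rm_not (by
        intro h
        rcases crit_b hk33 hk5 hB hcr hnc hz.1 hNz h with h | h
        · exact hza h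
        · exact hzc h)]
      exact ⟨g1, fun h => absurd (hNz.mono (subset_insert _ _)) h⟩
    · have := g2 hNz
      refine ⟨by omega, fun h => ?_⟩
      rw [N_insert] at h
      rw [rm_not (by tauto)]
      exact this
  · rintro ⟨φ, f1, f2, f3, f4, f5⟩
    refine hB.bad ⟨Function.update φ b β, f1.add ?_, ?_, by simp, ?_, ?_⟩
    · intro w hw hwb
      by_cases e1 : w = a
      · rw [e1, f2]; exact hB.ab
      by_cases e2 : w = h
      · rw [e2, f3]; exact hβ
      by_cases e3 : w = c
      · rw [e3, f4]; exact hB.bc.symm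
      have := (mem_rm.1 (f5 w ⟨hw, hwb.ne⟩ e1 e2 e3)).2 hwb
      simpa using this
    · rw [Function.update_of_ne hp.ab.ne, f2]
    · rw [Function.update_of_ne hp.bc.ne', f4]
    · intro z hz e1 e2 e3
      rw [Function.update_of_ne e2]
      by_cases e4 : z = h
      · rw [e4, f3]; exact hχ
      · exact (mem_rm.1 (f5 z ⟨hz, e2⟩ e1 e4 e3)).1

theorem del_ss {W : Set U} {b : U} (hb : b ∈ W) : W \ {b} ⊂ W :=
  ssub_of sdiff_subset hb (fun h => h.2 rfl)

theorem NCn_L (hk33 : NoK33 H) (hk5 : NoK5 H) {W X : Set U} {L : U → Finset ℕ} {a b c n : U}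
    {α β γ : ℕ} (hB : Bad H W X L a b c α β γ) (hn : NCn H W X a b c n) :
    n ≠ a ∧ n ≠ b ∧ n ≠ c ∧ n ∈ W ∧ (L n).card = 3 := by
  have hs := lemSep hk5 hB.st hB.p hn
  obtain ⟨h1, h2, h3, h4, h5, -⟩ := hn
  obtain ⟨o1, o2, e1, e2, e3, e4, -⟩ := lemComp hk33 hk5 hB h1 h2 h3 h4 h5 hs
  refine ⟨h3, h5.ne, h4, h1, ?_⟩
  rw [e4]
  exact Finset.card_eq_three.2 ⟨β, o1, o2, e1.symm, e2.symm, e3, rfl⟩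

theorem qAt (hk33 : NoK33 H) (hk5 : NoK5 H) {W : Set U} (hM : ∀ W' ⊆ W, MAt H W')
    (hQ : ∀ W' ⊂ W, QAt H W') : QAt H W := by
  intro X L a b c α β γ hB0 h4
  obtain ⟨W1, hs, hB, hcr⟩ := hB0.crit
  have hnc : ∀ n, ¬ NCn H W1 X a b c n := by
    intro n hn
    obtain ⟨e1, e2, e3, e4, e5⟩ := NCn_L hk33 hk5 hB hn
    have := h4 n (hs e4) e1 e2 e3
    omega
  rcases hM W1 hs X L a b c α β γ hB with ⟨n, hn⟩ | ⟨h, hh⟩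
  · exact hnc n hn
  have hNh := hub_notB hB.p hh hnc
  have hh' := hh
  obtain ⟨h1, h2, h3, hh4, h5, h6, h7⟩ := hh
  have hc5 := (hB.g h h1 (by rintro (h | h | h); exacts [h2 h, h3 h, hh4 h])).2 hNh
  obtain ⟨χ, hχ, c1, c2, c3⟩ := exists_ne3 (by omega : 4 ≤ (L h).card) α β γ
  refine hQ (W1 \ {b}) ((del_ss hB.p.bW).trans_subset hs) _ _ a h c α χ γ
    (hubstep hk33 hk5 hB hcr hnc hh' hχ c1 c2 c3) ?_
  intro z hz z1 z2 z3
  have := card_rm (L := L) (Q := fun z => H.Adj z b) (F := {β}) (z := z)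
  simp only [Finset.card_singleton] at this
  by_cases hNz : N H X z
  · rw [rm_not (by
        intro h
        rcases crit_b hk33 hk5 hB hcr hnc hz.1 hNz h with h | h
        · exact z1 h
        · exact z3 h)]
    exact h4 z (hs hz.1) z1 hz.2 z3
  · have := (hB.g z hz.1 (by rintro (h | h | h); exacts [z1 h, hz.2 h, z3 h])).2 hNz
    omega

/-- `K33` on `{x, y, X}` and `{p, q, r}` -/
theorem k33X (hk33 : NoK33 H) {W X : Set U} (hst : St H W X) {x y p q r : U}
    (hp : p ∈ W) (hq : q ∈ W) (hr : r ∈ W) (hx : x ∈ W) (hy : y ∈ W)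
    (nx : N H X p) (ny : N H X q) (nr : N H X r) (pq : p ≠ q) (pr : p ≠ r) (qr : q ≠ r)
    (xp : H.Adj x p) (xq : H.Adj x q) (xr : H.Adj x r)
    (yp : H.Adj y p) (yq : H.Adj y q) (yr : H.Adj y r) : x = y := by
  by_contra hxy
  refine mk_K33 hk33 {x} {y} X {p} {q} {r} (.singleton _) (.singleton _) hst.conn (.singleton _)
    (.singleton _) (.singleton _) ?_ (.ss xp) (.ss xq) (.ss xr) (.ss yp) (.ss yq) (.ss yr)
    (.sr nx) (.sr ny) (.sr nr)
  intro z
  simp only [mem_singleton_iff]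
  refine ⟨?_, ?_, fun hz => ⟨?_, ?_, ?_⟩, ?_, ?_⟩
  · rintro rfl; exact ⟨hxy, hst.dj _ hx, xp.ne, xq.ne, xr.ne⟩
  · rintro rfl; exact ⟨hst.dj _ hy, yp.ne, yq.ne, yr.ne⟩
  · rintro rfl; exact hst.dj _ hp hz
  · rintro rfl; exact hst.dj _ hq hz
  · rintro rfl; exact hst.dj _ hr hz
  · rintro rfl; exact ⟨pq, pr⟩
  · rintro rfl; exact qr

/-- `K33` on `{x, y, z}` and `{p, q, X}` -/
theorem k33Y (hk33 : NoK33 H) {W X : Set U} (hst : St H W X) {x y z p q : U}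
    (hp : p ∈ W) (hq : q ∈ W) (hx : x ∈ W) (hy : y ∈ W) (hz : z ∈ W)
    (nx : N H X x) (ny : N H X y) (nz : N H X z) (pq : p ≠ q) (hxz : x ≠ z) (hyz : y ≠ z)
    (xp : H.Adj x p) (xq : H.Adj x q) (yp : H.Adj y p) (yq : H.Adj y q)
    (zp : H.Adj z p) (zq : H.Adj z q) : x = y := by
  by_contra hxy
  exact pq (k33X hk33 hst hx hy hz hp hq nx ny nz hxy hxz hyz xp.symm yp.symm zp.symm xq.symm
    yq.symm zq.symm)

theorem ustep1 (hk33 : NoK33 H) (hk5 : NoK5 H) {W X : Set U} {L : U → Finset ℕ} {a b c h : U}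
    {α β γ : ℕ} (hB : Bad H W X L a b c α β γ) (hcr : Crit H W L a b c α β γ)
    (hnc : ∀ n, ¬ NCn H W X a b c n) (hh : Hub H W a b c h) (hW : ∀ W' ⊂ W, WAt H W')
    {p q : ℕ} (hp : p ∈ L h) (hq : q ∈ L h) (pq : p ≠ q)
    (pα : p ≠ α) (pβ : p ≠ β) (pγ : p ≠ γ) (qα : q ≠ α) (qβ : q ≠ β) (qγ : q ≠ γ) :
    ∃ w ∈ W, N H X w ∧ w ≠ b ∧ H.Adj w a ∧ H.Adj w h ∧ L w = {p, q, α} := by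
  obtain ⟨w, hw, hNw, w1, w2, w3, w4, w5, w6⟩ := hW _ (del_ss hB.p.bW) _ _ a h c α p γ q γ
    (hubstep hk33 hk5 hB hcr hnc hh hp pα pβ pγ) (hubstep hk33 hk5 hB hcr hnc hh hq qα qβ qγ) pq
  have hN : N H X w := by
    by_contra hN
    have h5 := (hB.g w hw.1 (by rintro (h | h | h); exacts [w1 h, hw.2 h, w3 h])).2 hN
    have := card_rm (L := L) (Q := fun z => H.Adj z b) (F := {β}) (z := w)
    rw [w6] at this
    have h3 : ({p, q, α} : Finset ℕ).card ≤ 3 := Finset.card_le_three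
    simp only [Finset.card_singleton] at this
    omega
  rw [rm_not (by
        intro h
        rcases crit_b hk33 hk5 hB hcr hnc hw.1 hN h with h | h
        · exact w1 h
        · exact w3 h)] at w6
  exact ⟨w, hw.1, hN, hw.2, w4, w5, w6⟩

theorem ustep (hk33 : NoK33 H) (hk5 : NoK5 H) {W X : Set U} {L : U → Finset ℕ} {a b c : U}
    {α β γ : ℕ} (hB : Bad H W X L a b c α β γ) (hnc : ∀ n, ¬ NCn H W X a b c n)
    (hM : ∀ W' ⊆ W, MAt H W') (hW : ∀ W' ⊂ W, WAt H W') :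
    ∃ h, Hub H W a b c h ∧ ∃ p q w v, w ∈ W ∧ v ∈ W ∧ N H X w ∧ N H X v ∧ w ≠ b ∧ v ≠ b ∧
      H.Adj w a ∧ H.Adj w h ∧ H.Adj v c ∧ H.Adj v h ∧ L w = {p, q, α} ∧ L v = {p, q, γ} ∧
      p ≠ q ∧ p ≠ α ∧ p ≠ β ∧ p ≠ γ ∧ q ≠ α ∧ q ≠ β ∧ q ≠ γ ∧ α ≠ γ ∧ L h = {α, β, γ, p, q} := by
  obtain ⟨W1, hs, hB1, hcr⟩ := hB.crit
  have hnc1 : ∀ n, ¬ NCn H W1 X a b c n := fun n hn => hnc n (hn.mono hs)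
  obtain ⟨h, hh⟩ : ∃ h, Hub H W1 a b c h := by
    rcases hM W1 hs X L a b c α β γ hB1 with ⟨n, hn⟩ | h
    · exact absurd hn (hnc1 n)
    · exact h
  have hW1 : ∀ W' ⊂ W1, WAt H W' := fun W' h => hW W' (h.trans_subset hs)
  have hNh := hub_notB hB1.p hh hnc1
  have hh' := hh
  obtain ⟨h1, h2, h3, h4, h5, h6, h7⟩ := hh
  have hc5 := (hB1.g h h1 (by rintro (h | h | h); exacts [h2 h, h3 h, h4 h])).2 hNh
  obtain ⟨p, hp, p1, p2, p3⟩ := exists_ne3 (by omega : 4 ≤ (L h).card) α β γ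
  obtain ⟨q, hq, hqF⟩ := exists_nin (S := L h) (F := {α, β, γ, p})
    (lt_of_le_of_lt Finset.card_le_four (by omega))
  simp only [Finset.mem_insert, Finset.mem_singleton, not_or] at hqF
  obtain ⟨q1, q2, q3, qp⟩ := hqF
  obtain ⟨w, hw, wN, wb, wa, wh, wL⟩ := ustep1 hk33 hk5 hB1 hcr hnc1 hh' hW1 hp hq (Ne.symm qp)
    p1 p2 p3 q1 q2 q3
  obtain ⟨v, hv, vN, vb, vc, vh, vL⟩ := ustep1 hk33 hk5 hB1.symm hcr.symm
    (fun n hn => hnc1 n hn.symm) (by exact ⟨h1, h4, h3, h2, h7, h6, h5⟩) hW1 hp hq (Ne.symm qp)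
    p3 p2 p1 q3 q2 q1
  have hLh : L h ⊆ {α, β, γ, p, q} := by
    intro r hr
    by_contra hc
    simp only [Finset.mem_insert, Finset.mem_singleton, not_or] at hc
    obtain ⟨r1, r2, r3, r4, r5⟩ := hc
    obtain ⟨w', hw', wN', wb', wa', wh', wL'⟩ := ustep1 hk33 hk5 hB1 hcr hnc1 hh' hW1 hp hr
      (Ne.symm r4) p1 p2 p3 r1 r2 r3
    have : w = w' := k33Y hk33 hB1.st hB1.p.aW h1 hw hw' hB1.p.bW wN wN' hB1.p.bN h2.symm wb wb'
      wa wh wa' wh' hB1.p.ab.symm h6.symm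
    rw [← this, wL] at wL'
    have hr' : r ∈ ({p, r, α} : Finset ℕ) := by simp
    rw [← wL'] at hr'
    simp only [Finset.mem_insert, Finset.mem_singleton] at hr'
    tauto
  have hαγ : α ≠ γ := by
    rintro rfl
    have e : ({α, β, α, p, q} : Finset ℕ) ⊆ {α, β, p, q} := by
      intro z; simp only [Finset.mem_insert, Finset.mem_singleton]; tauto
    have := Finset.card_le_card (hLh.trans e)
    have h4 : ({α, β, p, q} : Finset ℕ).card ≤ 4 := Finset.card_le_four
    omega
  refine ⟨h, ⟨hs h1, h2, h3, h4, h5, h6, h7⟩, p, q, w, v, hs hw, hs hv, wN, vN, wb, vb, wa, wh, vc,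
    vh, wL, vL, Ne.symm qp, p1, p2, p3, q1, q2, q3, hαγ, ?_⟩
  exact Finset.eq_of_subset_of_card_le hLh (Finset.card_le_five.trans hc5)

theorem uAt (hk33 : NoK33 H) (hk5 : NoK5 H) {W : Set U}
    (hM : ∀ W' ⊆ W, MAt H W') (hW : ∀ W' ⊂ W, WAt H W') : UAt H W := by
  intro X L a b c α β γ α' β' γ' hB hB' hnc
  obtain ⟨h, ⟨h1, h2, h3, h4, h5, h6, h7⟩, p, q, w, v, w1, v1, wN, vN, wb, vb, wa, wh, vc, vh, wL,
    vL, pq, pα, pβ, pγ, qα, qβ, qγ, αγ, hL⟩ := ustep hk33 hk5 hB hnc hM hW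
  obtain ⟨h', ⟨h1', h2', h3', h4', h5', h6', h7'⟩, p', q', w', v', w1', v1', wN', vN', wb', vb', wa',
    wh', vc', vh', wL', vL', pq', pα', pβ', pγ', qα', qβ', qγ', αγ', hL'⟩ := ustep hk33 hk5 hB' hnc hM hW
  have hp := hB.p
  have e1 : h = h' := k33X hk33 hB.st hp.aW hp.bW hp.cW h1 h1' hp.aN hp.bN hp.cN hp.ab.ne hp.ac
    hp.bc.ne h5 h6 h7 h5' h6' h7'
  subst e1
  have e2 : w = w' := k33Y hk33 hB.st hp.aW h1 w1 w1' hp.bW wN wN' hp.bN h2.symm wb wb'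
      wa wh wa' wh' hp.ab.symm h6.symm
  have e3 : v = v' := k33Y hk33 hB.st hp.cW h1 v1 v1' hp.bW vN vN' hp.bN h4.symm vb vb'
      vc vh vc' vh' hp.bc h6.symm
  subst e2 e3
  rw [wL] at wL'
  rw [vL] at vL'
  rw [hL] at hL'
  have ab := hB.ab
  have bc := hB.bc
  have ab' := hB'.ab
  have bc' := hB'.bc
  simp only [Finset.ext_iff, Finset.mem_insert, Finset.mem_singleton] at wL' vL' hL'
  have k1 := wL' p
  have k2 := wL' q
  have k3 := wL' α
  have k4 := vL' p
  have k5 := vL' q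
  have k6 := vL' γ
  have k7 := hL' β
  clear wL vL hL hM hW hnc hB hB' hL' wL' vL' hp
  grind

/-- data for the `a`-side of a separation -/
theorem compA (hk5 : NoK5 H) {W X : Set U} {L : U → Finset ℕ} {a b c n : U}
    {α β γ : ℕ} (h : Bad H W X L a b c α β γ) (hn : NCn H W X a b c n) :
    St H (comp H (W \ {b, n}) a ∪ {b, n}) X ∧ Pth H (comp H (W \ {b, n}) a ∪ {b, n}) X a b n ∧
    Good H (comp H (W \ {b, n}) a ∪ {b, n}) X L {a, b, n} ∧ comp H (W \ {b, n}) a ∪ {b, n} ⊆ W ∧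
      c ∉ comp H (W \ {b, n}) a ∪ {b, n} := by
  have hs := lemSep hk5 h.st h.p hn
  obtain ⟨hn, hNn, hna, hnc, hnb, -⟩ := hn
  have hp := h.p
  have haA : a ∈ comp H (W \ {b, n}) a :=
    mem_comp_self ⟨hp.aW, by rintro (h | h); exacts [hp.ab.ne h, hna h.symm]⟩
  have hWA : comp H (W \ {b, n}) a ∪ {b, n} ⊆ W := by
    rintro z (hz | hz | hz)
    · exact (comp_sub hz).1
    · exact hz ▸ hp.bW
    · exact hz ▸ hn
  refine ⟨h.st.sub hWA, ⟨.inl haA, .inr (.inl rfl), .inr (.inr rfl), hp.aN, hp.bN, hNn, hp.ab,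
    hnb.symm, hna.symm⟩, ?_, hWA, ?_⟩
  · exact h.g.sub hWA (by
      rintro z hz (h | h | h)
      · exact .inl h
      · exact .inr (.inl h)
      · rcases hz with hz | hz | hz
        · exact absurd (h ▸ hz) hs
        · exact .inr (.inl hz)
        · exact .inr (.inr hz))
  · rintro (hz | hz | hz)
    · exact hs hz
    · exact hp.bc.ne hz.symm
    · exact hnc hz.symm

theorem wAt (hk33 : NoK33 H) (hk5 : NoK5 H) {W : Set U}
    (hU : UAt H W) (hW : ∀ W' ⊂ W, WAt H W') : WAt H W := by
  intro X L a b c α p γ q γ' hB hB' pq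
  obtain ⟨w, hw⟩ : ∃ n, NCn H W X a b c n := by
    by_contra hc
    push Not at hc
    exact pq (hU X L a b c _ _ _ _ _ _ hB hB' hc).2.1
  obtain ⟨sA, pA, gA, hWA, hcA⟩ := compA hk5 hB hw
  have hs := lemSep hk5 hB.st hB.p hw
  obtain ⟨wW, wN, wa, wc, wb, -⟩ := hw
  obtain ⟨o1, o2, e1, e2, e3, e4, e5, -⟩ := lemComp hk33 hk5 hB wW wN wa wc wb hs
  obtain ⟨u1, u2, f1, f2, f3, f4, f5, -⟩ := lemComp hk33 hk5 hB' wW wN wa wc wb hs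
  by_cases haw : H.Adj a w
  · have hα : ∀ p o, α ≠ p → o ≠ p →
        ¬ Ext3 H (comp H (W \ {b, w}) a ∪ {b, w}) L a b w α p o → o = α := by
      intro p o hαp hop hE
      by_contra hc
      rcases lemF hk33 hk5 sA pA gA hαp hop hαp hc with h | ⟨φ, r1, r2, r3, r4, -⟩
      · exact hE h
      · exact r1 a pA.aW w pA.cW haw (r2.trans r4.symm)
    have o1α := hα p o1 hB.ab e1 e5
    have u1α := hα q u1 hB'.ab f1 f5
    refine ⟨w, wW, wN, wa, wb.ne, wc, haw.symm, wb, ?_⟩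
    subst o1α
    have hq : q ∈ L w := by rw [f4]; simp
    rw [e4] at hq
    simp only [Finset.mem_insert, Finset.mem_singleton] at hq
    have hqo : q ≠ o1 := hB'.ab.symm
    have : q = o2 := by tauto
    subst this
    rw [e4]
    ext z
    simp only [Finset.mem_insert, Finset.mem_singleton]
    tauto
  · obtain ⟨v, v1, v2, v3, v4, v5, v6, v7, v8⟩ := hW _ (ssub_of hWA hB.p.cW hcA) X L a b w α p o1 q u1
      ⟨sA, pA, haw, gA, hB.ab, e1.symm, e5⟩ ⟨sA, pA, haw, gA, hB'.ab, f1.symm, f5⟩ pq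
    exact ⟨v, hWA v1, v2, v3, v4, fun h => hcA (h ▸ v1), v6, v7, v8⟩

end
end BadCol

namespace BadCol
section
variable {U : Type u} {H : SimpleGraph U}

/-- colourings of components can be glued -/
theorem compGlue {R T : Set U} {L : U → Finset ℕ} {φ : U → ℕ} (hT : Pr H T φ)
    (hRT : ∀ z ∈ R, z ∉ T)
    (h : ∀ z ∈ R, ∃ ψ, Pr H (comp H R z ∪ T) ψ ∧ (∀ x ∈ T, ψ x = φ x) ∧
      ∀ x ∈ comp H R z, ψ x ∈ L x) :
    ∃ ψ, Pr H (R ∪ T) ψ ∧ (∀ x ∈ T, ψ x = φ x) ∧ ∀ x ∈ R, ψ x ∈ L x := by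
  classical
  have h' : ∀ D : Set U, ∃ ψ : U → ℕ, (∃ z ∈ R, D = comp H R z) →
      Pr H (D ∪ T) ψ ∧ (∀ x ∈ T, ψ x = φ x) ∧ ∀ x ∈ D, ψ x ∈ L x := by
    intro D
    by_cases hD : ∃ z ∈ R, D = comp H R z
    · obtain ⟨z, hz, rfl⟩ := hD
      obtain ⟨ψ, hψ⟩ := h z hz
      exact ⟨ψ, fun _ => hψ⟩
    · exact ⟨φ, fun h => absurd h hD⟩
  choose f hf using h'
  have eT : ∀ x ∈ T, (if x ∈ T then φ x else f (comp H R x) x) = φ x := fun x hx => by simp [hx]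
  have eR : ∀ x ∈ R, (if x ∈ T then φ x else f (comp H R x) x) = f (comp H R x) x :=
    fun x hx => by simp [hRT x hx]
  refine ⟨fun x => if x ∈ T then φ x else f (comp H R x) x, ?_, eT, ?_⟩
  · have key : ∀ x ∈ R, ∀ y ∈ T, H.Adj x y → (if x ∈ T then φ x else f (comp H R x) x) ≠
        (if y ∈ T then φ y else f (comp H R y) y) := by
      intro x hx y hy hxy
      rw [eR x hx, eT y hy]
      obtain ⟨q1, q2, q3⟩ := hf (comp H R x) ⟨x, hx, rfl⟩
      rw [← q2 y hy]
      exact q1 x (.inl (mem_comp_self hx)) y (.inr hy) hxy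
    rintro x (hx | hx) y (hy | hy) hxy
    · show (if x ∈ T then φ x else f (comp H R x) x) ≠ (if y ∈ T then φ y else f (comp H R y) y)
      rw [eR x hx, eR y hy]
      have hyx : y ∈ comp H R x := comp_closed (mem_comp_self hx) hy hxy
      obtain ⟨q1, q2, q3⟩ := hf (comp H R x) ⟨x, hx, rfl⟩
      rw [comp_eq hyx]
      exact q1 x (.inl (mem_comp_self hx)) y (.inl hyx) hxy
    · exact key x hx y hy hxy
    · exact (key y hy x hx hxy.symm).symm
    · show (if x ∈ T then φ x else f (comp H R x) x) ≠ (if y ∈ T then φ y else f (comp H R y) y)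
      rw [eT x hx, eT y hy]
      exact hT x hx y hy hxy
  · intro x hx
    show (if x ∈ T then φ x else f (comp H R x) x) ∈ L x
    rw [eR x hx]
    exact (hf (comp H R x) ⟨x, hx, rfl⟩).2.2 x (mem_comp_self hx)

/-- the final configuration -/
structure F6 (H : SimpleGraph U) (W X : Set U) (b : U) (L : U → Finset ℕ) (n h v k : U)
    (s t q s' t' q' : ℕ) : Prop where
  st : St H W (insert b X)
  st6 : St H (insert b W) X
  bN : N H X b
  bW : b ∉ W
  bn : H.Adj n b
  bh : H.Adj h b
  g : Good H W (insert b X) L {v, k}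
  h3 : ∀ z ∈ W, (L z).card ≤ 3 → N H X z
  nW : n ∈ W
  hW : h ∈ W
  vW : v ∈ W
  kW : k ∈ W
  vN : N H X v
  kN : N H X k
  sv : s ∈ L v
  tv : t ∈ L v
  sk : s' ∈ L k
  tk : t' ∈ L k
  ne1 : s ≠ t
  ne2 : s ≠ q
  ne3 : t ≠ q
  ne1' : s' ≠ t'
  ne2' : s' ≠ q'
  ne3' : t' ≠ q'
  nL : L n = {s, t, q}
  hL : L h = {s', t', q'}
  nh : H.Adj n h
  nv : H.Adj n v
  hk : H.Adj h k
  vh : v ≠ h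
  kn : k ≠ n
  vk : v ≠ k
  no : ¬ ∃ φ, Pr H W φ ∧ ∀ z ∈ W, φ z ∈ L z

theorem F6.symm {W X : Set U} {b : U} {L : U → Finset ℕ} {n h v k : U}
    {s t q s' t' q' : ℕ} (f : F6 H W X b L n h v k s t q s' t' q') :
    F6 H W X b L h n k v s' t' q' s t q :=
  ⟨f.st, f.st6, f.bN, f.bW, f.bh, f.bn, by rw [Set.pair_comm]; exact f.g, f.h3, f.hW, f.nW, f.kW, f.vW, f.kN,
    f.vN, f.sk, f.tk, f.sv, f.tv, f.ne1', f.ne2', f.ne3', f.ne1, f.ne2, f.ne3, f.hL, f.nL, f.nh.symm,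
    f.hk, f.nv, f.kn, f.vh, f.vk.symm, f.no⟩

open Classical in
/-- modified lists -/
noncomputable def L6 (L : U → Finset ℕ) (v k : U) (S T : Finset ℕ) : U → Finset ℕ :=
  fun z => if z = v then S else if z = k then T else L z

theorem L6_v {L : U → Finset ℕ} {v k : U} {S T : Finset ℕ} : L6 L v k S T v = S := by simp [L6]

theorem L6_k {L : U → Finset ℕ} {v k : U} {S T : Finset ℕ} (h : v ≠ k) : L6 L v k S T k = T := by
  simp [L6, h.symm]

theorem L6_o {L : U → Finset ℕ} {v k z : U} {S T : Finset ℕ} (h : z ≠ v) (h' : z ≠ k) :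
    L6 L v k S T z = L z := by
  simp [L6, h, h']

section
variable {W X : Set U} {b : U} {L : U → Finset ℕ} {n h v k : U} {s t q s' t' q' : ℕ}

theorem card3 {s t q : ℕ} (h1 : s ≠ t) (h2 : s ≠ q) (h3 : t ≠ q) :
    ({s, t, q} : Finset ℕ).card = 3 := Finset.card_eq_three.2 ⟨s, t, q, h1, h2, h3, rfl⟩

theorem F6.g6 (f : F6 H W X b L n h v k s t q s' t' q') :
    Good H W (insert b X) (L6 L v k {s, t, q} {s', t', q'}) ∅ := by
  intro z hz _
  by_cases h1 : z = v
  · subst h1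
    rw [L6_v, card3 f.ne1 f.ne2 f.ne3]
    exact ⟨le_rfl, fun h => absurd (f.vN.mono (subset_insert _ _)) h⟩
  by_cases h2 : z = k
  · subst h2
    rw [L6_k f.vk, card3 f.ne1' f.ne2' f.ne3']
    exact ⟨le_rfl, fun h => absurd (f.kN.mono (subset_insert _ _)) h⟩
  rw [L6_o h1 h2]
  exact f.g z hz (by rintro (h | h); exacts [h1 h, h2 h])

/-- a colouring from the modified lists -/
theorem F6.fin (f : F6 H W X b L n h v k s t q s' t' q') {φ : U → ℕ} (hφ : Pr H W φ)
    (h1 : φ v = s ∨ φ v = t) (h2 : φ k = s' ∨ φ k = t')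
    (h3 : ∀ z ∈ W, z ≠ v → z ≠ k → φ z ∈ L z) : False := by
  refine f.no ⟨φ, hφ, fun z hz => ?_⟩
  by_cases e1 : z = v
  · subst e1; rcases h1 with h | h <;> rw [h]; exacts [f.sv, f.tv]
  by_cases e2 : z = k
  · subst e2; rcases h2 with h | h <;> rw [h]; exacts [f.sk, f.tk]
  exact h3 z hz e1 e2

theorem mem3 {x s t q : ℕ} (h : x ∈ ({s, t, q} : Finset ℕ)) (hq : x ≠ q) : x = s ∨ x = t := by
  simp only [Finset.mem_insert, Finset.mem_singleton] at h; tauto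

theorem F6.nN (f : F6 H W X b L n h v k s t q s' t' q') : N H (insert b X) n :=
  N_insert.2 (.inl f.bn)
theorem F6.hN (f : F6 H W X b L n h v k s t q s' t' q') : N H (insert b X) h :=
  N_insert.2 (.inl f.bh)
theorem F6.vN' (f : F6 H W X b L n h v k s t q s' t' q') : N H (insert b X) v :=
  f.vN.mono (subset_insert _ _)
theorem F6.kN' (f : F6 H W X b L n h v k s t q s' t' q') : N H (insert b X) k :=
  f.kN.mono (subset_insert _ _)

theorem F6.qq (hk33 : NoK33 H) (hk5 : NoK5 H) (f : F6 H W X b L n h v k s t q s' t' q') : q = q' := by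
  by_contra hq
  obtain ⟨φ, f1, f2, f3, f4⟩ := thAt hk33 hk5 W f.st.fin _ _ n h q q' f.st f.nW f.hW f.nN f.hN
    (.inr ⟨f.nh, hq⟩) (f.g6.sub le_rfl (by simp))
  have hv := f4 v f.vW f.nv.ne' f.vh
  have hk := f4 k f.kW f.kn f.hk.ne'
  rw [L6_v] at hv
  rw [L6_k f.vk] at hk
  refine f.fin f1 (mem3 hv ?_) (mem3 hk ?_) ?_
  · rw [← f2]; exact f1 v f.vW n f.nW f.nv.symm
  · rw [← f3]; exact f1 k f.kW h f.hW f.hk.symm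
  · intro z hz e1 e2
    by_cases e3 : z = n
    · rw [e3, f2, f.nL]; simp
    by_cases e4 : z = h
    · rw [e4, f3, f.hL]; simp
    have := f4 z hz e3 e4
    rwa [L6_o e1 e2] at this

theorem F6.nk (hk33 : NoK33 H) (hk5 : NoK5 H) (f : F6 H W X b L n h v k s t q s' t' q) :
    ¬ H.Adj n k := by
  intro hnk
  obtain ⟨φ, f1, f2, f3, f4⟩ := thAt hk33 hk5 W f.st.fin _ _ n k q t' f.st f.nW f.kW f.nN f.kN'
    (.inr ⟨hnk, f.ne3'.symm⟩) (f.g6.sub le_rfl (by simp))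
  have hv := f4 v f.vW f.nv.ne' f.vk
  rw [L6_v] at hv
  refine f.fin f1 (mem3 hv ?_) (.inr f3) ?_
  · rw [← f2]; exact f1 v f.vW n f.nW f.nv.symm
  · intro z hz e1 e2
    by_cases e3 : z = n
    · rw [e3, f2, f.nL]; simp
    have := f4 z hz e3 e2
    rwa [L6_o e1 e2] at this

theorem F6.w (hk33 : NoK33 H) (hk5 : NoK5 H) (f : F6 H W X b L n h v k s t q s' t' q)
    (hW : WAt H W) : ∃ w ∈ W, N H X w ∧ w ≠ v ∧ w ≠ k ∧ H.Adj w n ∧ H.Adj w h ∧ L w = {s', t', q} := by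
  have hp : Pth H W (insert b X) n h k := ⟨f.nW, f.hW, f.kW, f.nN, f.hN, f.kN', f.nh, f.hk, f.kn.symm⟩
  have hb : ∀ x y, (x = s' ∨ x = t') → (y = s' ∨ y = t') → x ≠ y →
      Bad H W (insert b X) (L6 L v k {s, t, q} {s', t', q}) n h k q x y := by
    intro x y hx hy hxy
    refine ⟨f.st, hp, f.nk hk33 hk5, f.g6.sub le_rfl (by simp), ?_, hxy, ?_⟩
    · rcases hx with rfl | rfl
      · exact f.ne2'.symm
      · exact f.ne3'.symm
    · rintro ⟨φ, f1, f2, f3, f4, f5⟩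
      have hv := f5 v f.vW f.nv.ne' f.vh f.vk
      rw [L6_v] at hv
      refine f.fin f1 (mem3 hv ?_) (by rw [f4]; exact hy) ?_
      · rw [← f2]; exact f1 v f.vW n f.nW f.nv.symm
      · intro z hz e1 e2
        by_cases e3 : z = n
        · rw [e3, f2, f.nL]; simp
        by_cases e4 : z = h
        · rw [e4, f3, f.hL]; rcases hx with rfl | rfl <;> simp
        have := f5 z hz e3 e4 e2
        rwa [L6_o e1 e2] at this
  obtain ⟨w, w1, w2, w3, w4, w5, w6, w7, w8⟩ := hW _ _ _ _ _ _ _ _ _ _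
    (hb s' t' (.inl rfl) (.inr rfl) f.ne1') (hb t' s' (.inr rfl) (.inl rfl) f.ne1'.symm) f.ne1'
  have wv : w ≠ v := fun e => (f.symm.nk hk33 hk5) (e ▸ w7.symm)
  rw [L6_o wv w5] at w8
  exact ⟨w, w1, f.h3 w w1 (by rw [w8]; exact Finset.card_le_three), wv, w5, w6, w7, w8⟩

/-- extension to the side of `v` when `n` gets colour `q` -/
theorem sideTh (hk33 : NoK33 H) (hk5 : NoK5 H) {W X D : Set U} {L : U → Finset ℕ} {n w v : U}
    {s t q x : ℕ} (hst : St H W X) (hD : D ⊆ W) (hn : n ∈ W) (hw : w ∈ W) (hnD : n ∉ D) (hwD : w ∉ D)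
    (hv : v ∈ D) (nN : N H X n) (wN : N H X w) (vN : N H X v) (nw : H.Adj n w) (nv : H.Adj n v)
    (hg : Good H D X L {v}) (hs : s ∈ L v) (ht : t ∈ L v) (e1 : s ≠ t) (e2 : s ≠ q) (e3 : t ≠ q)
    (hx : q ≠ x) :
    ∃ ψ, Pr H (D ∪ {n, w}) ψ ∧ ψ n = q ∧ ψ w = x ∧ ∀ z ∈ D, ψ z ∈ L z := by
  classical
  have hs' : D ∪ {n, w} ⊆ W := by
    rintro z (h | h | h)
    · exact hD h
    · exact h ▸ hn
    · exact h ▸ hw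
  obtain ⟨φ, f1, f2, f3, f4⟩ := thAt hk33 hk5 (D ∪ {n, w}) (hst.fin.subset hs') X
    (Function.update L v {s, t, q}) n w q x (hst.sub hs') (.inr (.inl rfl)) (.inr (.inr rfl)) nN wN
    (.inr ⟨nw, hx⟩) (by
      rintro z (hz | hz) hz'
      · by_cases hzv : z = v
        · subst hzv
          rw [Function.update_self, card3 e1 e2 e3]
          exact ⟨le_rfl, fun h => absurd vN h⟩
        · rw [Function.update_of_ne hzv]
          exact hg z hz hzv
      · exact absurd hz hz')
  refine ⟨φ, f1, f2, f3, fun z hz => ?_⟩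
  have h1 := f4 z (.inl hz) (fun h => hnD (h ▸ hz)) (fun h => hwD (h ▸ hz))
  by_cases hzv : z = v
  · subst hzv
    rw [Function.update_self] at h1
    have := f1 z (.inl hz) n (.inr (.inl rfl)) nv.symm
    rw [f2] at this
    rcases mem3 h1 this with h | h <;> rw [h] <;> assumption
  · rwa [Function.update_of_ne hzv] at h1

theorem sideF (hk33 : NoK33 H) (hk5 : NoK5 H) {W X D : Set U} {L : U → Finset ℕ} {n w v : U}
    {x y z : ℕ} (hst : St H W X) (hD : D ⊆ W) (hn : n ∈ W) (hw : w ∈ W) (hnD : n ∉ D) (hwD : w ∉ D)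
    (hv : v ∈ D) (nN : N H X n) (wN : N H X w) (vN : N H X v) (nw : H.Adj n w) (nv : H.Adj n v)
    (hg : Good H D X L {v}) (hy : y ∈ L v) (e1 : x ≠ y) (e2 : x ≠ z) (e3 : y ≠ z)
    (hno : ¬ ∃ ψ, Pr H (D ∪ {n, w}) ψ ∧ ψ n = x ∧ ψ w = y ∧ ∀ z ∈ D, ψ z ∈ L z) :
    ∃ ψ, Pr H (D ∪ {n, w}) ψ ∧ ψ n = x ∧ ψ w = z ∧ ∀ z ∈ D, ψ z ∈ L z := by
  have hs' : D ∪ {n, w} ⊆ W := by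
    rintro z (h | h | h)
    · exact hD h
    · exact h ▸ hn
    · exact h ▸ hw
  have key : ∀ c, Ext3 H (D ∪ {n, w}) L v n w y x c →
      ∃ ψ, Pr H (D ∪ {n, w}) ψ ∧ ψ n = x ∧ ψ w = c ∧ ∀ z ∈ D, ψ z ∈ L z := by
    rintro c ⟨φ, f1, f2, f3, f4, f5⟩
    refine ⟨φ, f1, f3, f4, fun z hz => ?_⟩
    by_cases hzv : z = v
    · rw [hzv, f2]; exact hy
    · exact f5 z (.inl hz) hzv (fun h => hnD (h ▸ hz)) (fun h => hwD (h ▸ hz))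
  rcases lemF hk33 hk5 (a := v) (b := n) (c := w) (L := L) (α := y) (β := x) (γ1 := y) (γ2 := z)
    (hst.sub hs') ⟨.inl hv, .inr (.inl rfl), .inr (.inr rfl), vN, nN, wN, nv.symm, nw,
      fun h => hwD (h ▸ hv)⟩ (by
      rintro z (hz | hz) hz'
      · exact hg z hz (fun h => hz' (.inl h))
      · exact absurd (.inr hz) hz') e1.symm e1.symm e2.symm e3 with h | h
  · exact absurd (key _ h) hno
  · exact key _ h

/-- add the third vertex of the triangle -/
theorem addh {D : Set U} {L : U → Finset ℕ} {n w h : U} {φ ψ : U → ℕ} (hnD : n ∉ D) (hwD : w ∉ D)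
    (hhD : h ∉ D) (hn : h ≠ n) (hw : h ≠ w) (hDh : ¬ N H D h) (hφ1 : φ n ≠ φ h) (hφ2 : φ w ≠ φ h)
    (h1 : Pr H (D ∪ {n, w}) ψ) (h2 : ψ n = φ n) (h3 : ψ w = φ w) (h4 : ∀ z ∈ D, ψ z ∈ L z) :
    ∃ χ, Pr H (D ∪ {n, h, w}) χ ∧ (∀ x ∈ ({n, h, w} : Set U), χ x = φ x) ∧ ∀ z ∈ D, χ z ∈ L z := by
  classical
  refine ⟨Function.update ψ h (φ h), Pr.add (h1.sub ?_) ?_, ?_, ?_⟩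
  · rintro z ⟨hz | hz | hz | hz, hz'⟩
    · exact .inl hz
    · exact .inr (.inl hz)
    · exact absurd hz hz'
    · exact .inr (.inr hz)
  · rintro z (hz | hz | hz | hz) hzh
    · exact absurd ⟨z, hz, hzh.symm⟩ hDh
    · rw [hz, h2]; exact hφ1
    · exact absurd hz hzh.ne
    · rw [hz, h3]; exact hφ2
  · rintro x (rfl | rfl | rfl)
    · rw [Function.update_of_ne hn.symm, h2]
    · simp
    · rw [Function.update_of_ne hw.symm, h3]
  · intro z hz
    have hzh : z ≠ h := by rintro rfl; exact hhD hz
    rw [Function.update_of_ne hzh]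
    exact h4 z hz

end
end
end BadCol

namespace BadCol
section
variable {U : Type u} {H : SimpleGraph U}
variable {W X : Set U} {b : U} {L : U → Finset ℕ} {n h v k w : U} {s t q s' t' q' : ℕ}

/-- a component with a boundary vertex misses `n` or `h` -/
theorem F6.nb (hk33 : NoK33 H) (f : F6 H W X b L n h v k s t q s' t' q')
    (wW : w ∈ W) (wN : N H X w) (wn : H.Adj w n) (wh : H.Adj w h) {z y : U}
    (hz : z ∈ W \ {n, h, w}) (hy : y ∈ comp H (W \ {n, h, w}) z) (yN : N H X y)
    (h1 : N H (comp H (W \ {n, h, w}) z) n) (h2 : N H (comp H (W \ {n, h, w}) z) h) : False := by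
  have hDs : ∀ x ∈ comp H (W \ {n, h, w}) z, x ∈ W ∧ x ≠ n ∧ x ≠ h ∧ x ≠ w := by
    intro x hx
    have := comp_sub hx
    simpa using this
  have hc := comp_conn (H := H) hz
  generalize comp H (W \ {n, h, w}) z = D at *
  have bX : b ∉ X := f.st6.dj b (.inl rfl)
  have dj : ∀ x ∈ W, x ∉ X := fun x hx => f.st6.dj x (.inr hx)
  have bW := f.bW
  refine mk_K33 hk33 {w} {b} D {n} {h} X (.singleton _) (.singleton _) hc (.singleton _)
    (.singleton _) f.st6.conn ?_ (.ss wn) (.ss wh) (.sl wN) (.ss f.bn.symm) (.ss f.bh.symm) (.sl f.bN)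
    (.sr h1) (.sr h2) (by obtain ⟨x, hx, hxy⟩ := yN; exact ⟨y, hy, x, hx, hxy⟩)
  intro x
  simp only [mem_singleton_iff]
  refine ⟨?_, ?_, ?_, ?_, ?_⟩
  · rintro rfl
    exact ⟨fun e => bW (e ▸ wW), fun hx => (hDs _ hx).2.2.2 rfl, wn.ne, wh.ne, dj _ wW⟩
  · rintro rfl
    exact ⟨fun hx => bW (hDs _ hx).1, f.bn.ne', f.bh.ne', bX⟩
  · intro hx
    have := hDs _ hx
    exact ⟨this.2.1, this.2.2.1, dj _ this.1⟩
  · rintro rfl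
    exact ⟨f.nh.ne, dj _ f.nW⟩
  · rintro rfl
    exact dj _ f.hW

/-- extension from the triangle -/
theorem F6.E (hk33 : NoK33 H) (hk5 : NoK5 H) (f : F6 H W X b L n h v k s t q s' t' q')
    (wW : w ∈ W) (wN : N H X w) (wv : w ≠ v) (wk : w ≠ k) (wn : H.Adj w n) (wh : H.Adj w h)
    {cn ch cw : ℕ} (e1 : cn ≠ ch) (e2 : cn ≠ cw) (e3 : ch ≠ cw) (l1 : cn ∈ L n) (l2 : ch ∈ L h)
    (l3 : cw ∈ L w)
    (hi : ∃ ψ, Pr H (comp H (W \ {n, h, w}) v ∪ {n, w}) ψ ∧ ψ n = cn ∧ ψ w = cw ∧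
      ∀ z ∈ comp H (W \ {n, h, w}) v, ψ z ∈ L z)
    (hii : ∃ ψ, Pr H (comp H (W \ {n, h, w}) k ∪ {h, w}) ψ ∧ ψ h = ch ∧ ψ w = cw ∧
      ∀ z ∈ comp H (W \ {n, h, w}) k, ψ z ∈ L z) : False := by
  classical
  let φ : U → ℕ := fun x => if x = n then cn else if x = h then ch else cw
  have φn : φ n = cn := by simp [φ]
  have φh : φ h = ch := by simp [φ, f.nh.ne']
  have φw : φ w = cw := by simp [φ, wn.ne, wh.ne]
  have hT : Pr H ({n, h, w} : Set U) φ := by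
    rintro x (rfl | rfl | rfl) y (rfl | rfl | rfl) hxy <;> first | exact absurd rfl hxy.ne |
      (simp only [φn, φh, φw]; first | assumption | exact Ne.symm (by assumption))
  have nN := f.nN
  have hN := f.hN
  have wN' : N H (insert b X) w := wN.mono (subset_insert _ _)
  have hvR : v ∈ W \ {n, h, w} := ⟨f.vW, by
    rintro (e | e | e); exacts [f.nv.ne' e, f.vh e, wv e.symm]⟩
  have hkR : k ∈ W \ {n, h, w} := ⟨f.kW, by
    rintro (e | e | e); exacts [f.kn e, f.hk.ne' e, wk e.symm]⟩
  have nb0 := fun z y hz hy yN => f.nb hk33 (z := z) (y := y) wW wN wn wh hz hy yN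
  obtain ⟨χ, c1, c2, c3⟩ := compGlue (H := H) (R := W \ {n, h, w}) (T := {n, h, w}) (L := L) hT
    (fun z hz => hz.2) (by
      intro z hz
      have hzD := mem_comp_self (H := H) hz
      have nb := nb0 z
      by_cases hv : v ∈ comp H (W \ {n, h, w}) z
      · rw [← comp_eq hv]
        obtain ⟨ψ, p1, p2, p3, p4⟩ := hi
        refine addh (fun h => (comp_sub h).2 (by simp)) (fun h => (comp_sub h).2 (by simp))
          (fun h => (comp_sub h).2 (by simp)) f.nh.ne' wh.ne' ?_ (by rw [φn, φh]; exact e1)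
          (by rw [φw, φh]; exact e3.symm) p1 (by rw [p2, φn]) (by rw [p3, φw]) p4
        exact nb0 v v hvR (mem_comp_self hvR) f.vN ⟨v, mem_comp_self hvR, f.nv⟩
      by_cases hk : k ∈ comp H (W \ {n, h, w}) z
      · rw [← comp_eq hk]
        obtain ⟨ψ, p1, p2, p3, p4⟩ := hii
        have := addh (D := comp H (W \ {n, h, w}) k) (h := n) (φ := φ) (ψ := ψ) (fun h => (comp_sub h).2 (by simp)) (fun h => (comp_sub h).2 (by simp))
          (fun h => (comp_sub h).2 (by simp)) f.nh.ne wn.ne'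
          (fun h' => nb0 k k hkR (mem_comp_self hkR) f.kN h' ⟨k, mem_comp_self hkR, f.hk⟩) (by rw [φn, φh]; exact e1.symm)
          (by rw [φw, φn]; exact e2.symm) p1 (by rw [p2, φh]) (by rw [p3, φw]) p4
        rwa [Set.insert_comm h n] at this
      have hDs : ∀ x ∈ comp H (W \ {n, h, w}) z, x ∈ W ∧ x ≠ n ∧ x ≠ h ∧ x ≠ w := by
        intro x hx
        have := comp_sub hx
        simpa using this
      generalize comp H (W \ {n, h, w}) z = D at *
      have gD : ∀ x ∈ D, 3 ≤ (L x).card ∧ (¬ N H (insert b X) x → 5 ≤ (L x).card) := fun x hx =>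
        f.g x (hDs x hx).1 (by rintro (e | e); exacts [hv (e ▸ hx), hk (e ▸ hx)])
      have hnD : n ∉ D := fun h => (hDs n h).2.1 rfl
      have hhD : h ∉ D := fun h' => (hDs h h').2.2.1 rfl
      have hwD : w ∉ D := fun h => (hDs w h).2.2.2 rfl
      have hDW : D ⊆ W := fun x hx => (hDs x hx).1
      by_cases hDh : N H D h
      · by_cases hDn : N H D n
        · have hno : ∀ y ∈ D, ¬ N H X y := fun y hy yN => nb y hz hy yN hDn hDh
          have hs : D ∪ {n, h} ⊆ W \ {w} := by
            rintro x (hx | rfl | rfl)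
            · exact ⟨hDW hx, (hDs x hx).2.2.2⟩
            · exact ⟨f.nW, wn.ne'⟩
            · exact ⟨f.hW, wh.ne'⟩
          obtain ⟨ψ, p1, p2, p3, p4⟩ := thAt hk33 hk5 (D ∪ {n, h})
            (f.st.fin.subset (hs.trans sdiff_subset)) (insert w (insert b X))
            (rm L (fun z => H.Adj z w) {cw}) n h cn ch ((f.st.del wN').sub hs) (.inr (.inl rfl))
            (.inr (.inr rfl)) (nN.mono (subset_insert _ _)) (hN.mono (subset_insert _ _))
            (.inr ⟨f.nh, e1⟩) (by
              rintro x (hx | hx) hx'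
              · have h4 : 4 ≤ (L x).card := by
                  by_contra hc
                  exact hno x hx (f.h3 x (hDW hx) (by omega))
                refine ⟨?_, fun hN => ?_⟩
                · have := card_rm (L := L) (Q := fun z => H.Adj z w) (F := {cw}) (z := x)
                  simp only [Finset.card_singleton] at this
                  omega
                · rw [N_insert] at hN
                  push Not at hN
                  rw [rm_not (by exact hN.1)]
                  exact (gD x hx).2 hN.2
              · exact absurd hx hx')
          have p4' : ∀ x ∈ D, ψ x ∈ L x ∧ (H.Adj x w → ψ x ≠ cw) := by
            intro x hx
            have := p4 x (.inl hx) (hDs x hx).2.1 (hDs x hx).2.2.1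
            rw [mem_rm] at this
            simpa using this
          refine ⟨Function.update ψ w cw, Pr.add (p1.sub ?_) ?_, ?_, ?_⟩
          · rintro x ⟨hx | hx | hx | hx, hx'⟩
            · exact .inl hx
            · exact .inr (.inl hx)
            · exact .inr (.inr hx)
            · exact absurd hx hx'
          · rintro x (hx | hx | hx | hx) hxw
            · exact (p4' x hx).2 hxw
            · rw [hx, p2]; exact e2
            · rw [hx, p3]; exact e3
            · exact absurd hx hxw.ne
          · rintro x (rfl | rfl | rfl)
            · rw [Function.update_of_ne wn.ne', p2, φn]
            · rw [Function.update_of_ne wh.ne', p3, φh]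
            · rw [Function.update_self, φw]
          · intro x hx
            rw [Function.update_of_ne (hDs x hx).2.2.2]
            exact (p4' x hx).1
        · have hs : D ∪ {h, w} ⊆ W := by
            rintro x (hx | rfl | rfl)
            exacts [hDW hx, f.hW, wW]
          obtain ⟨ψ, p1, p2, p3, p4⟩ := thAt hk33 hk5 (D ∪ {h, w}) (f.st.fin.subset hs)
            (insert b X) L h w ch cw (f.st.sub hs) (.inr (.inl rfl)) (.inr (.inr rfl)) hN wN'
            (.inr ⟨wh.symm, e3⟩) (by
              rintro x (hx | hx) hx'
              · exact gD x hx
              · exact absurd hx hx')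
          have := addh (h := n) (φ := φ) hhD hwD hnD f.nh.ne wn.ne' hDn (by rw [φn, φh]; exact e1.symm)
            (by rw [φw, φn]; exact e2.symm) p1 (by rw [p2, φh]) (by rw [p3, φw])
            (fun x hx => p4 x (.inl hx) (hDs x hx).2.2.1 (hDs x hx).2.2.2)
          rwa [Set.insert_comm h n] at this
      · have hs : D ∪ {n, w} ⊆ W := by
          rintro x (hx | rfl | rfl)
          exacts [hDW hx, f.nW, wW]
        obtain ⟨ψ, p1, p2, p3, p4⟩ := thAt hk33 hk5 (D ∪ {n, w}) (f.st.fin.subset hs)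
          (insert b X) L n w cn cw (f.st.sub hs) (.inr (.inl rfl)) (.inr (.inr rfl)) nN wN'
          (.inr ⟨wn.symm, e2⟩) (by
            rintro x (hx | hx) hx'
            · exact gD x hx
            · exact absurd hx hx')
        exact addh (h := h) (φ := φ) hnD hwD hhD f.nh.ne' wh.ne' hDh (by rw [φn, φh]; exact e1)
          (by rw [φw, φh]; exact e3.symm) p1 (by rw [p2, φn]) (by rw [p3, φw])
          (fun x hx => p4 x (.inl hx) (hDs x hx).2.1 (hDs x hx).2.2.2))
  refine f.no ⟨χ, c1.sub (fun z hz => by by_cases h : z ∈ ({n, h, w} : Set U); exacts [.inr h, .inl ⟨hz, h⟩]), ?_⟩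
  intro z hz
  by_cases hzT : z ∈ ({n, h, w} : Set U)
  · rw [c2 z hzT]
    rcases hzT with rfl | rfl | rfl
    · rwa [φn]
    · rwa [φh]
    · rwa [φw]
  · exact c3 z ⟨hz, hzT⟩

theorem F6.false (hk33 : NoK33 H) (hk5 : NoK5 H) (f : F6 H W X b L n h v k s t q s' t' q')
    (hW : WAt H W) : False := by
  obtain rfl := f.qq hk33 hk5
  obtain ⟨w, wW, wN, wv, wk, wn, wh, wL⟩ := f.w hk33 hk5 hW
  obtain ⟨w', w1, w2, w3, w4, w5, w6, w7⟩ := f.symm.w hk33 hk5 hW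
  have bw : w ≠ b := fun e => f.bW (e ▸ wW)
  have bw' : w' ≠ b := fun e => f.bW (e ▸ w1)
  have : w = w' := k33Y hk33 f.st6 (x := w) (y := w') (z := b) (p := n) (q := h) (.inr f.nW)
    (.inr f.hW) (.inr wW) (.inr w1) (.inl rfl) wN w2 f.bN f.nh.ne bw bw' wn wh w6 w5 f.bn.symm f.bh.symm
  subst this
  have hst := f.st
  have hss : ∀ z, comp H (W \ {n, h, w}) z ⊆ W := fun z => comp_sub.trans sdiff_subset
  have hvR : v ∈ W \ {n, h, w} := ⟨f.vW, by
    rintro (e | e | e); exacts [f.nv.ne' e, f.vh e, wv e.symm]⟩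
  have hkR : k ∈ W \ {n, h, w} := ⟨f.kW, by
    rintro (e | e | e); exacts [f.kn e, f.hk.ne' e, wk e.symm]⟩
  have vD := mem_comp_self (H := H) hvR
  have kD := mem_comp_self (H := H) hkR
  have hD1 : ¬ N H (comp H (W \ {n, h, w}) v) h := fun h' =>
    f.nb hk33 wW wN wn wh hvR vD f.vN ⟨v, vD, f.nv⟩ h'
  have hD2 : ¬ N H (comp H (W \ {n, h, w}) k) n := fun h' =>
    f.nb hk33 wW wN wn wh hkR kD f.kN h' ⟨k, kD, f.hk⟩
  have g1 : Good H (comp H (W \ {n, h, w}) v) (insert b X) L {v} := f.g.sub (hss v) (by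
    rintro z hz (e | e)
    · exact e
    · exact absurd ⟨z, hz, by rw [show z = k from e]; exact f.hk⟩ hD1)
  have g2 : Good H (comp H (W \ {n, h, w}) k) (insert b X) L {k} := f.g.sub (hss k) (by
    rintro z hz (e | e)
    · exact absurd ⟨z, hz, by rw [show z = v from e]; exact f.nv⟩ hD2
    · exact e)
  have nD : ∀ z, n ∉ comp H (W \ {n, h, w}) z := fun z h => (comp_sub h).2 (by simp)
  have hD : ∀ z, h ∉ comp H (W \ {n, h, w}) z := fun z h => (comp_sub h).2 (by simp)
  have wD : ∀ z, w ∉ comp H (W \ {n, h, w}) z := fun z h => (comp_sub h).2 (by simp)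
  have wN' : N H (insert b X) w := wN.mono (subset_insert _ _)
  have hsw : s ∈ L w := by rw [w7]; simp
  have htw : t ∈ L w := by rw [w7]; simp
  have hqw : q ∈ L w := by rw [w7]; simp
  have hqh : q ∈ L h := by rw [f.hL]; simp
  have hqn : q ∈ L n := by rw [f.nL]; simp
  have hsn : s ∈ L n := by rw [f.nL]; simp
  have e1 : s = s' ∨ s = t' := mem3 (by rw [← wL]; exact hsw) f.ne2
  have e2 : t = s' ∨ t = t' := mem3 (by rw [← wL]; exact htw) f.ne3
  have hsh : s ∈ L h := by rw [f.hL]; rcases e1 with e | e <;> simp [e]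
  have hth : t ∈ L h := by rw [f.hL]; rcases e2 with e | e <;> simp [e]
  have sk : s ∈ L k := by rcases e1 with e | e <;> rw [e]; exacts [f.sk, f.tk]
  have tk : t ∈ L k := by rcases e2 with e | e <;> rw [e]; exacts [f.sk, f.tk]
  have i1 := fun x hx => sideTh hk33 hk5 (q := q) (x := x) hst (hss v) f.nW wW (nD v) (wD v) vD f.nN wN' f.vN' wn.symm
    f.nv g1 f.sv f.tv f.ne1 f.ne2 f.ne3 hx
  have ii1 := fun x hx => sideTh hk33 hk5 (q := q) (x := x) hst (hss k) f.hW wW (hD k) (wD k) kD f.hN wN' f.kN' wh.symm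
    f.hk g2 sk tk f.ne1 f.ne2 f.ne3 hx
  have E := fun cn ch cw => f.E hk33 hk5 wW wN wv wk wn wh (cn := cn) (ch := ch) (cw := cw)
  have ii2 := sideF hk33 hk5 (x := t) (y := s) (z := q) hst (hss k) f.hW wW (hD k) (wD k) kD f.hN wN'
    f.kN' wh.symm f.hk g2 sk f.ne1.symm f.ne3 f.ne2 (fun h =>
      E q t s f.ne3.symm f.ne2.symm f.ne1.symm hqn hth hsw (i1 s f.ne2.symm) h)
  have i2 := sideF hk33 hk5 (x := s) (y := t) (z := q) hst (hss v) f.nW wW (nD v) (wD v) vD f.nN wN'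
    f.vN' wn.symm f.nv g1 f.tv f.ne1 f.ne2 f.ne3 (fun h =>
      E s q t f.ne2 f.ne1 f.ne3.symm hsn hqh htw h (ii1 t f.ne3.symm))
  exact E s t q f.ne1 f.ne2 f.ne3 hsn hth hqw i2 ii2

end
end BadCol

namespace BadCol
section
variable {U : Type u} {H : SimpleGraph U}
variable {W X : Set U} {L : U → Finset ℕ} {a b c : U} {α β γ : ℕ}

/-- a minimal counterexample -/
structure MC (H : SimpleGraph U) (W X : Set U) (L : U → Finset ℕ) (a b c : U) (α β γ : ℕ) : Prop where
  B : Bad H W X L a b c α β γ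
  cr : Crit H W L a b c α β γ
  nn : ∀ n, ¬ NCn H W X a b c n
  nh : ∀ h, ¬ Hub H W a b c h

theorem Hub.symm {h : U} (hh : Hub H W a b c h) : Hub H W c b a h := by
  obtain ⟨h1, h2, h3, h4, h5, h6, h7⟩ := hh
  exact ⟨h1, h4, h3, h2, h7, h6, h5⟩

theorem MC.symm (h : MC H W X L a b c α β γ) : MC H W X L c b a γ β α :=
  ⟨h.B.symm, h.cr.symm, fun n hn => h.nn n hn.symm, fun n hn => h.nh n hn.symm⟩

theorem MC.m1 (hk33 : NoK33 H) (hk5 : NoK5 H) (h : MC H W X L a b c α β γ) :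
    ∃ v ∈ W, N H X v ∧ v ≠ a ∧ v ≠ b ∧ v ≠ c ∧ H.Adj v c := by
  classical
  by_contra hno
  have hp := h.B.p
  have hv : ∀ v ∈ W, N H X v → v ≠ a → v ≠ b → ¬ H.Adj v c := fun v h1 h2 h3 h4 h5 =>
    hno ⟨v, h1, h2, h3, h4, h5.ne, h5⟩
  obtain ⟨φ, f1, f2, f3, f4⟩ := thAt hk33 hk5 (W \ {c}) (h.B.st.fin.subset sdiff_subset)
    (insert c X) (rm L (fun z => H.Adj z c) {γ}) a b α β (h.B.st.del hp.cN) ⟨hp.aW, hp.ac⟩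
    ⟨hp.bW, hp.bc.ne⟩ (hp.aN.mono (subset_insert _ _)) (hp.bN.mono (subset_insert _ _))
    (.inr ⟨hp.ab, h.B.ab⟩) (by
      rintro z ⟨hz, hzc⟩ hz'
      have za : z ≠ a := fun e => hz' (.inl e)
      have zb : z ≠ b := fun e => hz' (.inr e)
      have hg := h.B.g z hz (by rintro (e | e | e); exacts [za e, zb e, hzc e])
      by_cases hzN : N H X z
      · rw [rm_not (by exact hv z hz hzN za zb)]
        exact ⟨hg.1, fun h => absurd (hzN.mono (subset_insert _ _)) h⟩
      · have := hg.2 hzN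
        have h2 := card_rm (L := L) (Q := fun z => H.Adj z c) (F := {γ}) (z := z)
        simp only [Finset.card_singleton] at h2
        refine ⟨by omega, fun h => ?_⟩
        rw [rm_not (by exact fun h' => h (N_insert.2 (.inl h')))]
        exact this)
  have f5 : ∀ z ∈ W, z ≠ c → z ≠ a → z ≠ b → φ z ∈ L z ∧ (H.Adj z c → φ z ≠ γ) := by
    intro z hz zc za zb
    have := f4 z ⟨hz, zc⟩ za zb
    rw [mem_rm] at this
    simpa using this
  refine h.B.bad ⟨Function.update φ c γ, Pr.add f1 ?_, ?_, ?_, ?_, ?_⟩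
  · intro w hw hwc
    by_cases wa : w = a
    · exact absurd (wa ▸ hwc) h.B.nac
    by_cases wb : w = b
    · rw [wb, f3]; exact h.B.bc
    exact (f5 w hw hwc.ne wa wb).2 hwc
  · rw [Function.update_of_ne hp.ac, f2]
  · rw [Function.update_of_ne hp.bc.ne, f3]
  · simp
  · intro z hz za zb zc
    rw [Function.update_of_ne zc]
    exact (f5 z hz zc za zb).1

/-- delete a boundary vertex -/
theorem delBad (hB : Bad H W X L a b c α β γ) {v : U} (vN : N H X v)
    (va : v ≠ a) (vb : v ≠ b) (vc : v ≠ c) {L' : U → Finset ℕ}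
    (g1 : ∀ z ∈ W, z ≠ a → z ≠ b → z ≠ c → z ≠ v → N H X z → 3 ≤ (L' z).card)
    (g2 : ∀ z ∈ W, z ≠ a → z ≠ b → z ≠ c → z ≠ v → ¬ N H X z → 3 ≤ (L' z).card)
    (g3 : ∀ z ∈ W, z ≠ a → z ≠ b → z ≠ c → z ≠ v → ¬ N H X z → ¬ H.Adj z v → 5 ≤ (L' z).card)
    (hE : ¬ Ext3 H (W \ {v}) L' a b c α β γ) :
    Bad H (W \ {v}) (insert v X) L' a b c α β γ := by
  have hp := hB.p
  refine ⟨hB.st.del vN, ⟨⟨hp.aW, va.symm⟩, ⟨hp.bW, vb.symm⟩, ⟨hp.cW, vc.symm⟩,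
    hp.aN.mono (subset_insert _ _), hp.bN.mono (subset_insert _ _), hp.cN.mono (subset_insert _ _),
    hp.ab, hp.bc, hp.ac⟩, hB.nac, ?_, hB.ab, hB.bc, hE⟩
  rintro z ⟨hz, hzv⟩ hz'
  have za : z ≠ a := fun e => hz' (.inl e)
  have zb : z ≠ b := fun e => hz' (.inr (.inl e))
  have zc : z ≠ c := fun e => hz' (.inr (.inr e))
  by_cases hzN : N H X z
  · exact ⟨g1 z hz za zb zc hzv hzN, fun h => absurd (hzN.mono (subset_insert _ _)) h⟩
  · refine ⟨g2 z hz za zb zc hzv hzN, fun h => ?_⟩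
    exact g3 z hz za zb zc hzv hzN (fun h' => h (N_insert.2 (.inl h')))

/-- add back a deleted vertex -/
theorem addBad (hB : Bad H W X L a b c α β γ) {v : U}
    (va : v ≠ a) (vb : v ≠ b) (vc : v ≠ c) {φ : U → ℕ} {y : ℕ} (hy : y ∈ L v)
    (f1 : Pr H (W \ {v}) φ) (f2 : φ a = α) (f3 : φ b = β) (f4 : φ c = γ)
    (f5 : ∀ z ∈ W, z ≠ v → z ≠ a → z ≠ b → z ≠ c → φ z ∈ L z)
    (f6 : ∀ z ∈ W, H.Adj z v → φ z ≠ y) : False := by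
  classical
  refine hB.bad ⟨Function.update φ v y, Pr.add f1 f6, ?_, ?_, ?_, ?_⟩
  · rw [Function.update_of_ne va.symm, f2]
  · rw [Function.update_of_ne vb.symm, f3]
  · rw [Function.update_of_ne vc.symm, f4]
  · intro z hz za zb zc
    by_cases hzv : z = v
    · subst hzv; simpa using hy
    · rw [Function.update_of_ne hzv]; exact f5 z hz hzv za zb zc

/-- the boundary vertex next to `c` -/
structure MV (H : SimpleGraph U) (W X : Set U) (L : U → Finset ℕ) (a b c : U) (γ : ℕ)
    (v u : U) (s t : ℕ) : Prop where
  vW : v ∈ W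
  vN : N H X v
  va : v ≠ a
  vb : v ≠ b
  vc : v ≠ c
  vAc : H.Adj v c
  vAb : ¬ H.Adj v b
  vAa : ¬ H.Adj v a
  cB : ∀ z ∈ W, N H X z → H.Adj z c → z = b ∨ z = v
  uW : u ∈ W
  uN : N H X u
  ub : u ≠ b
  uc : u ≠ c
  uv : H.Adj u v
  vB : ∀ z ∈ W, N H X z → H.Adj z v → z = c ∨ z = u
  sv : s ∈ L v
  tv : t ∈ L v
  st : s ≠ t
  sγ : s ≠ γ
  tγ : t ≠ γ

theorem Hub.mono {W' : Set U} {h : U} (hh : Hub H W' a b c h) (hs : W' ⊆ W) : Hub H W a b c h :=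
  ⟨hs hh.1, hh.2⟩

theorem MC.mv (hk33 : NoK33 H) (hk5 : NoK5 H) (h : MC H W X L a b c α β γ)
    (hM : ∀ W' ⊂ W, MAt H W') : ∃ v u s t, MV H W X L a b c γ v u s t := by
  classical
  obtain ⟨v, vW, vN, va, vb, vc, vAc⟩ := h.m1 hk33 hk5
  have hp := h.B.p
  have cb := fun w hw hN hA => crit_b hk33 hk5 h.B h.cr h.nn (w := w) hw hN hA
  have vAb : ¬ H.Adj v b := fun hA => by
    rcases cb v vW vN hA with e | e
    exacts [va e, vc e]
  have cB : ∀ z ∈ W, N H X z → H.Adj z c → z = b ∨ z = v := fun z hz hN hA =>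
    crit_deg hk33 hk5 h.B h.cr h.nn hp.cW hp.bW vW hz hp.cN hp.bN vN hN hp.bc.symm vAc.symm hA.symm
      vb.symm
  have hvg := h.B.g v vW (by rintro (e | e | e); exacts [va e, vb e, vc e])
  have hu : ∃ u ∈ W, N H X u ∧ H.Adj u v ∧ u ≠ c ∧ u ≠ a := by
    by_contra hno
    have hv : ∀ z ∈ W, N H X z → H.Adj z v → z = c ∨ z = a := by
      intro z h1 h2 h3
      by_contra hc
      push Not at hc
      exact hno ⟨z, h1, h2, h3, hc.1, hc.2⟩
    obtain ⟨s, hs, sα, sγ⟩ : ∃ s ∈ L v, s ≠ α ∧ s ≠ γ := exists_ne2 (by have := hvg.1; omega) α γ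
    have hB' : Bad H (W \ {v}) (insert v X) (rm L (fun z => H.Adj z v) {s}) a b c α β γ := by
      have hg := fun z (hz : z ∈ W) (za : z ≠ a) (zb : z ≠ b) (zc : z ≠ c) => h.B.g z hz
        (by rintro (e | e | e); exacts [za e, zb e, zc e])
      refine delBad h.B vN va vb vc ?_ ?_ ?_ ?_
      · intro z hz za zb zc zv hN
        rw [rm_not (by exact fun hA => (hv z hz hN hA).elim zc za)]
        exact (hg z hz za zb zc).1
      · intro z hz za zb zc zv hN
        have := (hg z hz za zb zc).2 hN
        have h2 := card_rm (L := L) (Q := fun z => H.Adj z v) (F := {s}) (z := z)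
        simp only [Finset.card_singleton] at h2
        omega
      · intro z hz za zb zc zv hN hA
        rw [rm_not (by exact hA)]
        exact (hg z hz za zb zc).2 hN
      · rintro ⟨φ, f1, f2, f3, f4, f5⟩
        have f6 : ∀ z ∈ W, z ≠ v → z ≠ a → z ≠ b → z ≠ c → φ z ∈ L z ∧ (H.Adj z v → φ z ≠ s) := by
          intro z hz zv za zb zc
          have := f5 z ⟨hz, zv⟩ za zb zc
          rw [mem_rm] at this
          simpa using this
        refine addBad h.B va vb vc hs f1 f2 f3 f4 (fun z hz zv za zb zc => (f6 z hz zv za zb zc).1) ?_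
        intro z hz hA
        by_cases za : z = a
        · rw [za, f2]; exact sα.symm
        by_cases zb : z = b
        · exact absurd (zb ▸ hA.symm) vAb
        by_cases zc : z = c
        · rw [zc, f4]; exact sγ.symm
        exact (f6 z hz hA.ne za zb zc).2 hA
    rcases hM _ (del_ss vW) _ _ _ _ _ _ _ _ hB' with ⟨n, hn⟩ | ⟨x, hx⟩
    · obtain ⟨n1, n2, n3, n4, n5⟩ := NCn_L hk33 hk5 hB' hn
      have nb : H.Adj n b := hn.2.2.2.2.1
      have nN : ¬ N H X n := fun hN => by
        rcases cb n n4.1 hN nb with e | e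
        exacts [n1 e, n3 e]
      have := (h.B.g n n4.1 (by rintro (e | e | e); exacts [n1 e, n2 e, n3 e])).2 nN
      have h2 := card_rm (L := L) (Q := fun z => H.Adj z v) (F := {s}) (z := n)
      simp only [Finset.card_singleton] at h2
      omega
    · exact h.nh x (hx.mono sdiff_subset)
  obtain ⟨u, uW, uN, uv, uc, ua⟩ := hu
  obtain ⟨s, hs, t, ht, st, sγ, tγ⟩ := exists_two hvg.1 γ
  have vB : ∀ z ∈ W, N H X z → H.Adj z v → z = c ∨ z = u := fun z hz hN hA =>
    crit_deg hk33 hk5 h.B h.cr h.nn vW hp.cW uW hz vN hp.cN uN hN vAc uv.symm hA.symm uc.symm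
  refine ⟨v, u, s, t, vW, vN, va, vb, vc, vAc, vAb, ?_, cB, uW, uN, ?_, uc, uv, vB, hs, ht, st, sγ, tγ⟩
  · intro hA
    rcases vB a hp.aW hp.aN hA.symm with e | e
    exacts [hp.ac e, ua e.symm]
  · rintro rfl
    exact vAb uv.symm

/-- the lists after deleting `v` -/
noncomputable def Lv (H : SimpleGraph U) (X : Set U) (L : U → Finset ℕ) (v : U) (s t : ℕ) : U → Finset ℕ :=
  rm L (fun z => H.Adj z v ∧ ¬ N H X z) {s, t}

theorem Lv_sub {v : U} {s t : ℕ} {z : U} {x : ℕ} (h : x ∈ Lv H X L v s t z) : x ∈ L z :=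
  (mem_rm.1 h).1

theorem Lv_ne {v : U} {s t : ℕ} {z : U} {x : ℕ} (h : x ∈ Lv H X L v s t z) (h1 : H.Adj z v)
    (h2 : ¬ N H X z) : x ≠ s ∧ x ≠ t := by
  have := (mem_rm.1 h).2 ⟨h1, h2⟩
  simpa using this

theorem pick2 {s t : ℕ} (h : s ≠ t) (x : ℕ) : ∃ y, (y = s ∨ y = t) ∧ x ≠ y := by
  by_cases e : x = s
  · exact ⟨t, .inr rfl, fun e' => h (e.symm.trans e')⟩
  · exact ⟨s, .inl rfl, e⟩

theorem MC.bad1 (h : MC H W X L a b c α β γ)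
    {v u : U} {s t : ℕ} (m : MV H W X L a b c γ v u s t) :
    Bad H (W \ {v}) (insert v X) (Lv H X L v s t) a b c α β γ := by
  have hp := h.B.p
  have hg := fun z (hz : z ∈ W) (za : z ≠ a) (zb : z ≠ b) (zc : z ≠ c) => h.B.g z hz
    (by rintro (e | e | e); exacts [za e, zb e, zc e])
  refine delBad h.B m.vN m.va m.vb m.vc ?_ ?_ ?_ ?_
  · intro z hz za zb zc zv hN
    rw [Lv, rm_not (by exact fun h => h.2 hN)]
    exact (hg z hz za zb zc).1
  · intro z hz za zb zc zv hN
    have := (hg z hz za zb zc).2 hN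
    have h2 := card_rm (L := L) (Q := fun z => H.Adj z v ∧ ¬ N H X z) (F := {s, t}) (z := z)
    rw [Finset.card_pair m.st] at h2
    rw [Lv]
    omega
  · intro z hz za zb zc zv hN hA
    rw [Lv, rm_not (by exact fun h => hA h.1)]
    exact (hg z hz za zb zc).2 hN
  · rintro ⟨φ, f1, f2, f3, f4, f5⟩
    obtain ⟨y, hy, hyu⟩ := pick2 m.st (φ u)
    refine addBad h.B m.va m.vb m.vc (y := y) (by rcases hy with e | e <;> rw [e]; exacts [m.sv, m.tv])
      f1 f2 f3 f4 (fun z hz zv za zb zc => Lv_sub (f5 z ⟨hz, zv⟩ za zb zc)) ?_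
    intro z hz hA
    by_cases hzN : N H X z
    · rcases m.vB z hz hzN hA with rfl | rfl
      · rw [f4]; rcases hy with e | e <;> rw [e]; exacts [m.sγ.symm, m.tγ.symm]
      · exact hyu
    · have := f5 z ⟨hz, hA.ne⟩ (fun e => hzN (e ▸ hp.aN)) (fun e => hzN (e ▸ hp.bN))
        (fun e => hzN (e ▸ hp.cN))
      have := Lv_ne this hA hzN
      rcases hy with e | e <;> rw [e]; exacts [this.1, this.2]

end
end BadCol

namespace BadCol
section
variable {U : Type u} {H : SimpleGraph U}
variable {W X : Set U} {L : U → Finset ℕ} {a b c : U} {α β γ : ℕ}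

/-- data of a separating vertex after deleting `v` -/
structure SN (H : SimpleGraph U) (W X : Set U) (L : U → Finset ℕ) (a b c : U) (α β γ : ℕ)
    (v u : U) (s t : ℕ) (n : U) (A : Set U) (q r : ℕ) : Prop where
  mc : MC H W X L a b c α β γ
  mv : MV H W X L a b c γ v u s t
  st : St H (W \ {v}) (insert v X)
  nW : n ∈ W
  nN : ¬ N H X n
  nb : H.Adj n b
  nv : H.Adj n v
  nA : n ∉ A
  bA : b ∉ A
  cA : c ∉ A
  vA : v ∉ A
  aA : a ∈ A
  hA : A ⊆ W
  cA' : Conn H A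
  cl : ∀ x ∈ A, ∀ y ∈ W, H.Adj x y → y ∈ A ∨ y = b ∨ y = n ∨ y = v
  NA : N H A n
  pA : Pth H (A ∪ {b, n}) (insert v X) a b n
  gA : Good H (A ∪ {b, n}) (insert v X) (Lv H X L v s t) {a, b, n}
  qβ : q ≠ β
  rβ : r ≠ β
  qr : q ≠ r
  Ln : Lv H X L v s t n = {β, q, r}
  eA : ¬ Ext3 H (A ∪ {b, n}) (Lv H X L v s t) a b n α β q
  eC : ¬ Ext3 H ((W \ {v}) \ A) (Lv H X L v s t) n b c r β γ

theorem MC.sn (hk33 : NoK33 H) (hk5 : NoK5 H) (h : MC H W X L a b c α β γ)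
    {v u : U} {s t : ℕ} (m : MV H W X L a b c γ v u s t) {n : U}
    (hn : NCn H (W \ {v}) (insert v X) a b c n) :
    ∃ q r, SN H W X L a b c α β γ v u s t n (comp H ((W \ {v}) \ {b, n}) a) q r := by
  have hB := h.bad1 m
  have hs := lemSep hk5 hB.st hB.p hn
  obtain ⟨c1, c2, c3, c4, c5⟩ := compA hk5 hB hn
  obtain ⟨n1, n2, n3, n4, n5, A0, C0, p1, p2, p3, p4, p5, p6, p7, p8, p9⟩ := hn
  obtain ⟨q, r, e1, e2, e3, e4, e5, e6⟩ := lemComp hk33 hk5 hB n1 n2 n3 n4 n5 hs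
  have nN : ¬ N H X n := fun hN => by
    rcases crit_b hk33 hk5 h.B h.cr h.nn n1.1 hN n5 with e | e
    exacts [n3 e, n4 e]
  refine ⟨q, r, h, m, hB.st, n1.1, nN, n5, (N_insert.1 n2).resolve_right nN,
    fun h => (comp_sub h).2 (by simp), fun h => (comp_sub h).2 (by simp), hs,
    fun h => (comp_sub h).1.2 rfl, mem_comp_self (p5 p3), ?_, comp_conn (p5 p3), ?_,
    p8.mono (conn_sub_comp p1 p5 p3), c2, c3, e1, e2, e3, e4, e5, e6⟩
  · intro z hz; exact (comp_sub hz).1.1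
  · intro x hx y hy hxy
    by_contra hc
    push Not at hc
    exact hc.1 (comp_closed hx ⟨⟨hy, hc.2.2.2⟩, by rintro (e | e); exacts [hc.2.1 e, hc.2.2.1 e]⟩ hxy)

section
variable {v u n : U} {s t q r : ℕ} {A : Set U}

theorem SN.Av (hk33 : NoK33 H) (hk5 : NoK5 H)
    (f : SN H W X L a b c α β γ v u s t n A q r) : N H A v := by
  classical
  by_contra hno
  have hp := f.mc.B.p
  have hB := f.mc.B
  have hcX : Conn H (X ∪ A) := by
    refine hB.st.conn.union f.cA' ?_
    obtain ⟨x, hx, hax⟩ := hp.aN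
    exact ⟨x, hx, a, f.aA, hax.symm⟩
  have nLc : 5 ≤ (L n).card := (hB.g n f.nW (by
    rintro (e | e | e)
    exacts [f.nN (e ▸ hp.aN), f.nb.ne e, f.nN (e ▸ hp.cN)])).2 f.nN
  have nc : n ≠ c := fun e => f.nN (e ▸ hp.cN)
  obtain ⟨φ, f1, f2, f3, f4⟩ := thAt hk33 hk5 (W \ A) (hB.st.fin.subset sdiff_subset) (X ∪ A)
    (Function.update L n (L n \ {q})) b c β γ ⟨hB.st.fin.subset sdiff_subset, hcX, by
      rintro z ⟨hz, hzA⟩ (h | h)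
      exacts [hB.st.dj z hz h, hzA h]⟩ ⟨hp.bW, f.bA⟩ ⟨hp.cW, f.cA⟩ (hp.bN.mono subset_union_left)
    (hp.cN.mono subset_union_left) (.inr ⟨hp.bc, hB.bc⟩) (by
      rintro z ⟨hz, hzA⟩ hz'
      by_cases hzn : z = n
      · subst hzn
        rw [Function.update_self]
        have := Finset.le_card_sdiff {q} (L z)
        simp only [Finset.card_singleton] at this
        exact ⟨by omega, fun h => absurd (f.NA.mono subset_union_right) h⟩
      · rw [Function.update_of_ne hzn]
        have hg := hB.g z hz (by
          rintro (e | e | e)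
          exacts [hzA (e ▸ f.aA), hz' (.inl e), hz' (.inr e)])
        exact ⟨hg.1, fun h => hg.2 (fun h' => h (h'.mono subset_union_left))⟩)
  have hn := f4 n ⟨f.nW, f.nA⟩ f.nb.ne nc
  rw [Function.update_self] at hn
  simp only [Finset.mem_sdiff, Finset.mem_singleton] at hn
  have hnβ : φ n ≠ β := by
    rw [← f2]; exact f1 n ⟨f.nW, f.nA⟩ b ⟨hp.bW, f.bA⟩ f.nb
  have hWA : A ∪ {b, n} ⊆ W \ {v} := by
    rintro z (hz | rfl | rfl)
    · exact ⟨f.hA hz, fun e => f.vA (e ▸ hz)⟩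
    · exact ⟨hp.bW, f.mv.vb.symm⟩
    · exact ⟨f.nW, f.nv.ne⟩
  obtain ⟨ψ, g1, g2, g3, g4, g5⟩ := (lemF hk33 hk5 (f.st.sub hWA) f.pA f.gA hB.ab f.qβ hnβ
    (Ne.symm hn.2)).resolve_left f.eA
  obtain ⟨χ, q1, q2, q3⟩ := glue (W := W) (W1 := A ∪ {b, n}) (W2 := W \ A)
    (fun z hz => by by_cases h : z ∈ A <;> simp [h, hz]) g1 f1
    (by
      rintro z (hz | hz | hz) hz'
      · exact absurd hz hz'.2
      · rw [hz, g3, f2]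
      · rw [hz, g4])
    (by
      rintro x (hx | hx) y hy hxy
      · right
        rcases f.cl x hx y hy.1 hxy with h | h | h | h
        · exact .inl h
        · exact .inr (.inl h)
        · exact .inr (.inr h)
        · exact absurd ⟨x, hx, h ▸ hxy.symm⟩ hno
      · left
        rcases hx with rfl | rfl
        exacts [⟨hp.bW, f.bA⟩, ⟨f.nW, f.nA⟩])
  refine hB.bad ⟨χ, q1, ?_, ?_, ?_, ?_⟩
  · rw [q2 a (.inl f.aA), g2]
  · rw [q2 b (.inr (.inl rfl)), g3]
  · rw [q3 c ⟨hp.cW, f.cA⟩, f3]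
  · intro z hz za zb zc
    by_cases hzn : z = n
    · subst hzn; rw [q2 z (.inr (.inr rfl)), g4]; exact hn.1
    by_cases hzA : z ∈ A
    · rw [q2 z (.inl hzA)]; exact Lv_sub (g5 z (.inl hzA) za zb hzn)
    · rw [q3 z ⟨hz, hzA⟩]
      have := f4 z ⟨hz, hzA⟩ zb zc
      rwa [Function.update_of_ne hzn] at this

theorem SN.BC (hk33 : NoK33 H) (hk5 : NoK5 H)
    (f : SN H W X L a b c α β γ v u s t n A q r) {z : U} (hz : z ∈ W) (zN : N H X z) (zA : z ∉ A)
    (zb : z ≠ b) (zc : z ≠ c) (zv : z ≠ v) : False := by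
  have hAv := f.Av hk33 hk5
  have hp := f.mc.B.p
  have zn : z ≠ n := fun e => f.nN (e ▸ zN)
  have cn : c ≠ n := fun e => f.nN (e ▸ hp.cN)
  have hzR : z ∈ W \ {b, c, n, v} := ⟨hz, by simp [zb, zc, zn, zv]⟩
  have hKs : ∀ x ∈ comp H (W \ {b, c, n, v}) z, x ∈ W ∧ x ≠ b ∧ x ≠ c ∧ x ≠ n ∧ x ≠ v := by
    intro x hx
    have := comp_sub hx
    simpa using this
  have hKc := comp_conn (H := H) hzR
  have hzK := mem_comp_self (H := H) hzR
  have hKcl : ∀ x ∈ comp H (W \ {b, c, n, v}) z, ∀ y ∈ W, y ∉ comp H (W \ {b, c, n, v}) z →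
      H.Adj x y → y = b ∨ y = c ∨ y = n ∨ y = v := by
    intro x hx y hy hyK hxy
    by_contra hc
    exact hyK (comp_closed hx ⟨hy, hc⟩ hxy)
  generalize comp H (W \ {b, c, n, v}) z = K at *
  have hKA : ∀ x ∈ K, x ∉ A := by
    -- otherwise walk from a common vertex to `z`
    intro x hx hxA
    obtain ⟨x', hx', y, hy, hyA, -, hxy⟩ := hKc.exit hx hzK hxA zA
    have := hKs y hy
    rcases f.cl x' hx' y this.1 hxy with h | h | h | h
    exacts [hyA h, this.2.1 h, this.2.2.2.1 h, this.2.2.2.2 h]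
  have haK : a ∉ K := fun h => hKA a h f.aA
  have av : a ≠ v := f.mv.va.symm
  have key : ∀ p ∈ W, N H X p → (p = c ∨ H.Adj p c) → a ≠ p → z ≠ p → ∃ x ∈ K, ∃ y, H.Adj x y ∧ y ≠ p ∧
      (y = b ∨ y = n ∨ y = v) := by
    intro p hpW hpN hpc hap hzp
    have hc := crit_conn hk33 hk5 f.mc.B f.mc.cr f.mc.nn hpW hp.cW hpN hp.cN hpc
      ⟨a, hp.aW, by simp [hap, hp.ac]⟩
    obtain ⟨x, hx, y, hy, hyK, -, hxy⟩ := hc.exit (u := z) (v := a) (K := K) ⟨hz, by simp [hzp, zc]⟩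
      ⟨hp.aW, by simp [hap, hp.ac]⟩ hzK haK
    have hy2 : y ≠ p ∧ y ≠ c := by simpa using hy.2
    refine ⟨x, hx, y, hxy, hy2.1, ?_⟩
    rcases hKcl x hx y hy.1 hyK hxy with h | h | h | h
    exacts [.inl h, absurd h hy2.2, .inr (.inl h), .inr (.inr h)]
  have dj := f.mc.B.st.dj
  have fin : ∀ K' : Set U, Conn H K' → K ⊆ K' → (∀ x ∈ K', x ∈ K ∨ x = n) → N H K' b → N H K' v →
      False := by
    intro K' h1 h2 h3 h4 h5
    have hK' : ∀ x ∈ K', x ∈ W ∧ x ≠ b ∧ x ≠ c ∧ x ≠ v ∧ x ∉ A := by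
      intro x hx
      rcases h3 x hx with h | rfl
      · have := hKs x h
        exact ⟨this.1, this.2.1, this.2.2.1, this.2.2.2.2, hKA x h⟩
      · exact ⟨f.nW, f.nb.ne, cn.symm, f.nv.ne, f.nA⟩
    refine mk_K33 hk33 {b} {v} X {c} K' A (.singleton _) (.singleton _) f.mc.B.st.conn (.singleton _)
      h1 f.cA' ?_ (.ss hp.bc) (.sl h4) (.sl ⟨a, f.aA, hp.ab.symm⟩) (.ss f.mv.vAc) (.sl h5) (.sl hAv)
      (.sr hp.cN) ?_ ?_
    · intro x
      simp only [mem_singleton_iff]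
      refine ⟨?_, ?_, ?_, ?_, ?_⟩
      · rintro rfl
        exact ⟨f.mv.vb.symm, dj _ hp.bW, hp.bc.ne, fun h => (hK' _ h).2.1 rfl, f.bA⟩
      · rintro rfl
        exact ⟨dj _ f.mv.vW, f.mv.vc, fun h => (hK' _ h).2.2.2.1 rfl, f.vA⟩
      · intro hx
        exact ⟨fun e => dj _ hp.cW (e ▸ hx), fun h => dj _ (hK' _ h).1 hx, fun h => dj _ (f.hA h) hx⟩
      · rintro rfl
        exact ⟨fun h => (hK' _ h).2.2.1 rfl, f.cA⟩
      · intro hx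
        exact (hK' x hx).2.2.2.2
    · exact ((Touch.sr zN).mono le_rfl (by simpa using h2 hzK))
    · exact ((Touch.sr hp.aN).mono le_rfl (by simpa using f.aA))
  by_cases hKn : N H K n
  · refine fin (insert n K) (hKc.insert hKn) (subset_insert _ _) ?_ ⟨n, .inl rfl, f.nb.symm⟩
      ⟨n, .inl rfl, f.nv.symm⟩
    rintro x (rfl | hx)
    exacts [.inr rfl, .inl hx]
  · obtain ⟨x, hx, y, hxy, hyp, hy⟩ := key b hp.bW hp.bN (.inr hp.bc) hp.ab.ne zb
    obtain ⟨x', hx', y', hxy', hyp', hy'⟩ := key v f.mv.vW f.mv.vN (.inr f.mv.vAc) av zv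
    refine fin K hKc le_rfl (fun x hx => .inl hx) ?_ ?_
    · rcases hy' with rfl | rfl | rfl
      · exact ⟨x', hx', hxy'.symm⟩
      · exact absurd ⟨x', hx', hxy'.symm⟩ hKn
      · exact absurd rfl hyp'
    · rcases hy with rfl | rfl | rfl
      · exact absurd rfl hyp
      · exact absurd ⟨x, hx, hxy.symm⟩ hKn
      · exact ⟨x, hx, hxy.symm⟩

theorem SN.uA (hk33 : NoK33 H) (hk5 : NoK5 H)
    (f : SN H W X L a b c α β γ v u s t n A q r) : u ∈ A := by
  by_contra h
  exact f.BC hk33 hk5 f.mv.uW f.mv.uN h f.mv.ub f.mv.uc f.mv.uv.ne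

theorem SN.WA (f : SN H W X L a b c α β γ v u s t n A q r) : A ∪ {b, n} ⊆ W \ {v} := by
  rintro z (hz | rfl | rfl)
  · exact ⟨f.hA hz, fun e => f.vA (e ▸ hz)⟩
  · exact ⟨f.mc.B.p.bW, f.mv.vb.symm⟩
  · exact ⟨f.nW, f.nv.ne⟩

theorem SN.pC (f : SN H W X L a b c α β γ v u s t n A q r) :
    Pth H ((W \ {v}) \ A) (insert v X) n b c := by
  have hp := f.mc.B.p
  exact ⟨⟨⟨f.nW, f.nv.ne⟩, f.nA⟩, ⟨⟨hp.bW, f.mv.vb.symm⟩, f.bA⟩, ⟨⟨hp.cW, f.mv.vc.symm⟩, f.cA⟩,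
    N_insert.2 (.inl f.nv), hp.bN.mono (subset_insert _ _), hp.cN.mono (subset_insert _ _), f.nb, hp.bc,
    fun e => f.nN (e ▸ hp.cN)⟩

theorem SN.nc (hk33 : NoK33 H) (hk5 : NoK5 H) (hQ : ∀ W' ⊂ W, QAt H W')
    (f : SN H W X L a b c α β γ v u s t n A q r) : H.Adj n c := by
  classical
  by_contra hno
  have hp := f.mc.B.p
  have hB := f.mc.B
  have uA := f.uA hk33 hk5
  obtain ⟨ψ, g1, g2, g3, g4, g5⟩ := (lemF hk33 hk5 (f.st.sub f.WA) f.pA f.gA hB.ab f.qβ f.rβ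
    f.qr).resolve_left f.eA
  obtain ⟨y, hy, hyu⟩ := pick2 f.mv.st (ψ u)
  have hcard : ∀ z ∈ (W \ {v}) \ A, z ≠ n → z ≠ b → z ≠ c → 5 ≤ (L z).card := by
    rintro z ⟨⟨hz, zv⟩, zA⟩ zn zb zc
    refine (hB.g z hz ?_).2 (fun zN => f.BC hk33 hk5 hz zN zA zb zc zv)
    rintro (e | e | e)
    exacts [zA (e ▸ f.aA), zb e, zc e]
  have hcard' : ∀ z ∈ (W \ {v}) \ A, z ≠ n → z ≠ b → z ≠ c →
      4 ≤ (rm L (fun z => H.Adj z v) {y} z).card := by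
    intro z hz zn zb zc
    have h1 := hcard z hz zn zb zc
    have h2 := card_rm (L := L) (Q := fun z => H.Adj z v) (F := {y}) (z := z)
    simp only [Finset.card_singleton] at h2
    omega
  have hE : Ext3 H ((W \ {v}) \ A) (rm L (fun z => H.Adj z v) {y}) n b c r β γ := by
    by_contra hE
    refine hQ ((W \ {v}) \ A) (ssub_of (sdiff_subset.trans sdiff_subset) f.mv.vW (fun h => h.1.2 rfl))
      (insert v X) (rm L (fun z => H.Adj z v) {y}) n b c r β γ
      ⟨f.st.sub sdiff_subset, f.pC, hno, ?_, f.rβ, hB.bc, hE⟩ hcard'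
    intro z hz hz'
    have zn : z ≠ n := fun e => hz' (.inl e)
    have zb : z ≠ b := fun e => hz' (.inr (.inl e))
    have zc : z ≠ c := fun e => hz' (.inr (.inr e))
    refine ⟨by have := hcard' z hz zn zb zc; omega, fun h => ?_⟩
    rw [rm_not (by exact fun h' => h (N_insert.2 (.inl h')))]
    exact hcard z hz zn zb zc
  obtain ⟨φ, f1, f2, f3, f4, f5⟩ := hE
  have rL : r ∈ Lv H X L v s t n := by rw [f.Ln]; simp
  have f5' : ∀ z ∈ (W \ {v}) \ A, z ≠ n → z ≠ b → z ≠ c → φ z ∈ L z ∧ (H.Adj z v → φ z ≠ y) := by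
    intro z hz zn zb zc
    have := f5 z hz zn zb zc
    rw [mem_rm] at this
    simpa using this
  obtain ⟨χ, q1, q2, q3⟩ := glue (W := W \ {v}) (W1 := A ∪ {b, n}) (W2 := (W \ {v}) \ A)
    (fun z hz => by
      by_cases h : z ∈ A
      · exact .inl (.inl h)
      · exact .inr ⟨hz, h⟩) g1 f1
    (by
      rintro z (hz | hz | hz) hz'
      · exact absurd hz hz'.2
      · rw [hz, g3, f3]
      · rw [hz, g4, f2])
    (by
      rintro x (hx | hx) y hy hxy
      · right
        rcases f.cl x hx y hy.1.1 hxy with h | h | h | h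
        · exact .inl h
        · exact .inr (.inl h)
        · exact .inr (.inr h)
        · exact absurd h hy.1.2
      · left
        rcases hx with rfl | rfl
        exacts [f.pC.bW, f.pC.aW])
  have hyst : ∀ x, x ≠ s ∧ x ≠ t → x ≠ y := by
    rintro x ⟨x1, x2⟩
    rcases hy with e | e <;> rw [e] <;> assumption
  refine addBad hB f.mv.va f.mv.vb f.mv.vc (y := y) (φ := χ) (by rcases hy with e | e <;> rw [e]; exacts [f.mv.sv, f.mv.tv])
    q1 ?_ ?_ ?_ ?_ ?_
  · rw [q2 a (.inl f.aA), g2]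
  · rw [q2 b (.inr (.inl rfl)), g3]
  · rw [q3 c f.pC.cW, f4]
  · intro z hz zv za zb zc
    by_cases hzn : z = n
    · subst hzn; rw [q2 z (.inr (.inr rfl)), g4]; exact Lv_sub rL
    by_cases hzA : z ∈ A
    · rw [q2 z (.inl hzA)]; exact Lv_sub (g5 z (.inl hzA) za zb hzn)
    · rw [q3 z ⟨⟨hz, zv⟩, hzA⟩]; exact (f5' z ⟨⟨hz, zv⟩, hzA⟩ hzn zb zc).1
  · intro z hz hzv
    by_cases hzn : z = n
    · subst hzn; rw [q2 z (.inr (.inr rfl)), g4]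
      exact hyst _ (Lv_ne rL f.nv f.nN)
    by_cases hzA : z ∈ A
    · rw [q2 z (.inl hzA)]
      by_cases hzN : N H X z
      · rcases f.mv.vB z hz hzN hzv with e | e
        · exact absurd (e ▸ hzA) f.cA
        · rw [e]; exact hyu
      · exact hyst _ (Lv_ne (g5 z (.inl hzA) (fun e => hzN (e ▸ hp.aN)) (fun e => hzN (e ▸ hp.bN)) hzn) hzv hzN)
    · rw [q3 z ⟨⟨hz, hzv.ne⟩, hzA⟩]
      by_cases zb : z = b
      · exact absurd (zb ▸ hzv.symm) f.mv.vAb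
      by_cases zc : z = c
      · rw [zc, f4]; exact hyst _ ⟨f.mv.sγ.symm, f.mv.tγ.symm⟩
      exact (f5' z ⟨⟨hz, hzv.ne⟩, hzA⟩ hzn zb zc).2 hzv

theorem SN.rγ (hk33 : NoK33 H) (hk5 : NoK5 H) (hQ : ∀ W' ⊂ W, QAt H W')
    (f : SN H W X L a b c α β γ v u s t n A q r) : r = γ := by
  by_contra hr
  have hB := f.mc.B
  have gC : Good H ((W \ {v}) \ A) (insert v X) (Lv H X L v s t) {c, b, n} :=
    (f.mc.bad1 f.mv).g.sub sdiff_subset (by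
      rintro z hz (e | e | e)
      exacts [absurd (e ▸ f.aA) hz.2, .inr (.inl e), .inl e])
  rcases lemF hk33 hk5 (f.st.sub sdiff_subset) f.pC.symm gC hB.bc.symm f.rβ hB.bc.symm hr with h | h
  · exact f.eC h.symm
  · obtain ⟨φ, f1, f2, f3, f4, -⟩ := h
    exact f1 n f.pC.aW c f.pC.cW (f.nc hk33 hk5 hQ) (by rw [f2, f4])

end

/-- the outcome near `c` -/
structure M4 (H : SimpleGraph U) (W X : Set U) (L : U → Finset ℕ) (a b c : U) (β γ : ℕ)
    (v : U) (s t : ℕ) (n h : U) (q : ℕ) : Prop where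
  vW : v ∈ W
  vN : N H X v
  va : v ≠ a
  vb : v ≠ b
  vc : v ≠ c
  vAb : ¬ H.Adj v b
  vAa : ¬ H.Adj v a
  vAc : H.Adj v c
  cB : ∀ z ∈ W, N H X z → H.Adj z c → z = b ∨ z = v
  sv : s ∈ L v
  tv : t ∈ L v
  st : s ≠ t
  sγ : s ≠ γ
  tγ : t ≠ γ
  nW : n ∈ W
  nN : ¬ N H X n
  nb : H.Adj n b
  nc : H.Adj n c
  nv : H.Adj n v
  na : ¬ H.Adj n a
  sn : s ∈ L n
  tn : t ∈ L n
  nL : L n \ {s, t} = {β, q, γ}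
  qβ : q ≠ β
  qγ : q ≠ γ
  hW : h ∈ W
  hN : ¬ N H X h
  ha : H.Adj h a
  hb : H.Adj h b
  hn : H.Adj h n

theorem SN.mem {v u n : U} {s t q r : ℕ} {A : Set U}
    (f : SN H W X L a b c α β γ v u s t n A q r) : s ∈ L n ∧ t ∈ L n ∧ L n \ {s, t} = {β, q, r} := by
  have hp := f.mc.B.p
  have nLc : 5 ≤ (L n).card := (f.mc.B.g n f.nW (by
    rintro (e | e | e)
    exacts [f.nN (e ▸ hp.aN), f.nb.ne e, f.nN (e ▸ hp.cN)])).2 f.nN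
  have hL : L n \ {s, t} = {β, q, r} := by
    rw [← f.Ln, Lv, rm_of (by exact ⟨f.nv, f.nN⟩)]
  have h3 : (L n \ {s, t}).card = 3 := by rw [hL, card3 f.qβ.symm f.rβ.symm f.qr]
  have key : ∀ x y, L n \ {x, y} = L n \ {s, t} → x ∈ L n := by
    intro x y hxy
    by_contra hx
    have : L n \ {x, y} = L n \ {y} := by
      ext z; simp only [Finset.mem_sdiff, Finset.mem_insert, Finset.mem_singleton]
      constructor
      · rintro ⟨h1, h2⟩; exact ⟨h1, fun h => h2 (.inr h)⟩
      · rintro ⟨h1, h2⟩; refine ⟨h1, ?_⟩; rintro (h | h); exacts [hx (h ▸ h1), h2 h]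
    have h2 := Finset.le_card_sdiff {y} (L n)
    rw [← this, hxy, h3, Finset.card_singleton] at h2
    omega
  exact ⟨key s t rfl, key t s (by rw [Finset.pair_comm]), hL⟩

theorem MC.m4 (hk33 : NoK33 H) (hk5 : NoK5 H) (h : MC H W X L a b c α β γ)
    (hM : ∀ W' ⊂ W, MAt H W') (hQ : ∀ W' ⊂ W, QAt H W') :
    ∃ v s t n k q, M4 H W X L a b c β γ v s t n k q := by
  obtain ⟨v, u, s, t, m⟩ := h.mv hk33 hk5 hM
  have hp := h.B.p
  have hB' := h.bad1 m
  rcases hM _ (del_ss m.vW) _ _ _ _ _ _ _ _ hB' with ⟨n, hn⟩ | ⟨x, hx⟩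
  swap
  · exact absurd (hx.mono sdiff_subset) (h.nh x)
  obtain ⟨q, r, f⟩ := h.sn hk33 hk5 m hn
  have hs := f.WA
  have nc := f.nc hk33 hk5 hQ
  obtain rfl := f.rγ hk33 hk5 hQ
  have na : ¬ H.Adj n a := fun hA => h.nh n ⟨f.nW, hA.ne, f.nb.ne, nc.ne, hA, f.nb, nc⟩
  obtain ⟨l1, l2, l3⟩ := f.mem
  have hBA : Bad H (comp H ((W \ {v}) \ {b, n}) a ∪ {b, n}) (insert v X) (Lv H X L v s t) a b n α β q :=
    ⟨f.st.sub hs, f.pA, fun hA => na hA.symm, f.gA, h.B.ab, f.qβ.symm, f.eA⟩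
  have hcA : c ∉ comp H ((W \ {v}) \ {b, n}) a ∪ {b, n} := by
    rintro (h | h | h)
    exacts [f.cA h, hp.bc.ne' h, nc.ne' h]
  generalize comp H ((W \ {v}) \ {b, n}) a ∪ {b, n} = WA at *
  rcases hM WA (ssub_of (hs.trans sdiff_subset) m.vW (fun h => (hs h).2 rfl)) _ _ _ _ _ _ _ _ hBA with
    ⟨n2, hn2⟩ | ⟨k, hk⟩
  · exfalso
    have n2n : n2 ≠ n := hn2.2.2.2.1
    have hn3 : NCn H (W \ {v}) (insert v X) a b c n2 := by
      obtain ⟨a1, a2, a3, a4, a5, A0, C0, p1, p2, p3, p4, p5, p6, p7, p8, p9⟩ := hn2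
      have hc2 : c ≠ n2 := fun e => hcA (e ▸ a1)
      have cW : c ∈ W \ {v} := ⟨hp.cW, m.vc.symm⟩
      refine ⟨hs a1, a2, a3, hc2.symm, a5, A0, insert c C0, p1, p2.insert ⟨n, p4, nc.symm⟩, p3, .inl rfl,
        fun z hz => ⟨hs (p5 hz).1, (p5 hz).2⟩, ?_, ?_, p8, p9.mono (subset_insert _ _)⟩
      · rintro z (rfl | hz)
        · exact ⟨cW, by rintro (e | e); exacts [hp.bc.ne' e, hc2 e]⟩
        · exact ⟨hs (p6 hz).1, (p6 hz).2⟩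
      · rintro z hz (rfl | hz')
        · exact hcA (p5 hz).1
        · exact p7 z hz hz'
    obtain ⟨q2, r2, f2⟩ := h.sn hk33 hk5 m hn3
    exact n2n (k33X hk33 h.B.st hp.bW hp.cW m.vW f2.nW f.nW hp.bN hp.cN m.vN hp.bc.ne m.vb.symm
      m.vc.symm f2.nb (f2.nc hk33 hk5 hQ) f2.nv f.nb nc f.nv)
  · obtain ⟨k1, k2, k3, k4, k5, k6, k7⟩ := hk
    have kW : k ∈ W := (hs k1).1
    have kN : ¬ N H X k := fun hN => by
      rcases crit_b hk33 hk5 h.B h.cr h.nn kW hN k6 with e | e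
      exacts [k2 e, hcA (e ▸ k1)]
    exact ⟨v, s, t, n, k, q, m.vW, m.vN, m.va, m.vb, m.vc, m.vAb, m.vAa, m.vAc, m.cB, m.sv, m.tv, m.st, m.sγ,
      m.tγ, f.nW, f.nN, f.nb, nc, f.nv, na, l1, l2, l3, f.qβ, f.qr, kW, kN, k5, k6, k7⟩

end
end BadCol

namespace BadCol
section
variable {U : Type u} {H : SimpleGraph U}
variable {W X : Set U} {L : U → Finset ℕ} {a b c : U} {α β γ : ℕ}

theorem MC.hm (hk33 : NoK33 H) (mc : MC H W X L a b c α β γ)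
    {v n h k m h' : U} {s t q s' t' q' : ℕ}
    (f : M4 H W X L a b c β γ v s t n h q) (g : M4 H W X L c b a β α k s' t' m h' q') : h = m := by
  by_contra hne
  have hp := mc.B.p
  have st := mc.B.st
  have ha : h ≠ a := f.ha.ne
  have hb : h ≠ b := f.hb.ne
  have hc : h ≠ c := fun e => f.hN (e ▸ hp.cN)
  have ma : m ≠ a := g.nc.ne
  have mb : m ≠ b := g.nb.ne
  have mc' : m ≠ c := fun e => g.nN (e ▸ hp.cN)
  have na : n ≠ a := fun e => f.nN (e ▸ hp.aN)
  have ka : h' ≠ a := fun e => g.hN (e ▸ hp.aN)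
  have hh : h ≠ h' := fun e => mc.nh h ⟨f.hW, ha, hb, hc, f.ha, f.hb, e ▸ g.ha⟩
  have mn : m ≠ n := fun e => f.na (e ▸ g.nc)
  refine mk_K33 hk33 {h} {m} X {a} {b} (insert h' (insert n {c})) (.singleton _) (.singleton _) st.conn
    (.singleton _) (.singleton _) ?_ ?_ (.ss f.ha) (.ss f.hb) (.sl ?_) (.ss g.nc) (.ss g.nb) (.sl ?_)
    (.sr hp.aN) (.sr hp.bN) ?_
  · refine Conn.insert (Conn.insert (.singleton _) (N_single.2 f.nc)) ⟨c, by simp, g.ha⟩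
  · intro z
    simp only [mem_singleton_iff, mem_insert_iff]
    refine ⟨?_, ?_, ?_, ?_, ?_⟩
    · rintro rfl
      exact ⟨hne, st.dj _ f.hW, ha, hb, by simp [hh, f.hn.ne, hc]⟩
    · rintro rfl
      exact ⟨st.dj _ g.nW, ma, mb, by simp [g.hn.ne', mn, mc']⟩
    · intro hz
      refine ⟨fun e => st.dj a hp.aW (e ▸ hz), fun e => st.dj b hp.bW (e ▸ hz), ?_⟩
      rintro (e | e | e)
      exacts [st.dj _ g.hW (e ▸ hz), st.dj _ f.nW (e ▸ hz), st.dj _ hp.cW (e ▸ hz)]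
    · rintro rfl
      exact ⟨hp.ab.ne, by simp [ka.symm, na.symm, hp.ac]⟩
    · rintro rfl
      simp [g.hb.ne', f.nb.ne', hp.bc.ne]
  · exact ⟨n, by simp, f.hn⟩
  · exact ⟨h', by simp, g.hn.symm⟩
  · obtain ⟨x, hx, hcx⟩ := hp.cN
    exact ⟨x, hx, c, by simp, hcx.symm⟩

/-- lists after colouring the path -/
noncomputable def L5 (H : SimpleGraph U) (L : U → Finset ℕ) (a b c : U) (α β γ : ℕ) : U → Finset ℕ :=
  rm (rm (rm L (fun z => H.Adj z a) {α}) (fun z => H.Adj z b) {β}) (fun z => H.Adj z c) {γ}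

theorem mem_L5 {z : U} {x : ℕ} : x ∈ L5 H L a b c α β γ z ↔
    x ∈ L z ∧ (H.Adj z a → x ≠ α) ∧ (H.Adj z b → x ≠ β) ∧ (H.Adj z c → x ≠ γ) := by
  simp only [L5, mem_rm, Finset.mem_singleton]
  tauto

theorem L5_n {n : U} {s t q : ℕ} (na : ¬ H.Adj n a) (nb : H.Adj n b) (nc : H.Adj n c)
    (sn : s ∈ L n) (tn : t ∈ L n) (sγ : s ≠ γ) (tγ : t ≠ γ)
    (nL : L n \ {s, t} = {β, q, γ}) (qβ : q ≠ β) (qγ : q ≠ γ) :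
    s ≠ q ∧ t ≠ q ∧ L5 H L a b c α β γ n = {s, t, q} := by
  have hx : ∀ x, (x ∈ L n ∧ x ≠ s ∧ x ≠ t) ↔ x = β ∨ x = q ∨ x = γ := by
    intro x
    have := congrArg (fun S => x ∈ S) nL
    simp only [Finset.mem_sdiff, Finset.mem_insert, Finset.mem_singleton, not_or, eq_iff_iff] at this
    exact this
  have h1 := (hx q).2 (by simp)
  have h2 := (hx β).2 (by simp)
  refine ⟨h1.2.1.symm, h1.2.2.symm, ?_⟩
  ext x
  rw [mem_L5]
  simp only [Finset.mem_insert, Finset.mem_singleton]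
  constructor
  · rintro ⟨e1, -, e2, e3⟩
    have := hx x
    have := e2 nb
    have := e3 nc
    tauto
  · rintro (rfl | rfl | rfl)
    · exact ⟨sn, fun e => absurd e na, fun _ => h2.2.1.symm, fun _ => sγ⟩
    · exact ⟨tn, fun e => absurd e na, fun _ => h2.2.2.symm, fun _ => tγ⟩
    · exact ⟨h1.1, fun e => absurd e na, fun _ => qβ, fun _ => qγ⟩

theorem L5_comm : L5 H L a b c α β γ = L5 H L c b a γ β α := by
  funext z
  ext x
  rw [mem_L5, mem_L5]
  tauto

theorem L5_card {z : U} (h : ¬ (H.Adj z a ∧ H.Adj z b ∧ H.Adj z c)) :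
    (L z).card ≤ (L5 H L a b c α β γ z).card + 2 := by
  have c1 := card_rm (L := L) (Q := fun z => H.Adj z a) (F := {α}) (z := z)
  have c2 := card_rm (L := rm L (fun z => H.Adj z a) {α}) (Q := fun z => H.Adj z b) (F := {β}) (z := z)
  have c3 := card_rm (L := rm (rm L (fun z => H.Adj z a) {α}) (fun z => H.Adj z b) {β})
    (Q := fun z => H.Adj z c) (F := {γ}) (z := z)
  simp only [Finset.card_singleton] at c1 c2 c3
  unfold L5
  by_cases ha : H.Adj z a
  · by_cases hb : H.Adj z b
    · by_cases hc : H.Adj z c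
      · exact absurd ⟨ha, hb, hc⟩ h
      · rw [rm_not (Q := fun z => H.Adj z c) hc]; omega
    · rw [rm_not (Q := fun z => H.Adj z b) hb] at c3; omega
  · rw [rm_not (Q := fun z => H.Adj z a) ha] at c2; omega

theorem L5_eq {z : U} (ha : ¬ H.Adj z a) (hb : ¬ H.Adj z b) (hc : ¬ H.Adj z c) :
    L5 H L a b c α β γ z = L z := by
  ext x; rw [mem_L5]; tauto

theorem L5_card1 {z : U} (ha : ¬ H.Adj z a) (hc : ¬ H.Adj z c) :
    (L z).card ≤ (L5 H L a b c α β γ z).card + 1 := by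
  have c2 := card_rm (L := L) (Q := fun z => H.Adj z b) (F := {β}) (z := z)
  have : L5 H L a b c α β γ z = rm L (fun z => H.Adj z b) {β} z := by
    ext x; rw [mem_L5, mem_rm, Finset.mem_singleton]; tauto
  rw [this]
  simpa using c2

theorem MC.false (hk33 : NoK33 H) (hk5 : NoK5 H) (mc : MC H W X L a b c α β γ)
    (hM : ∀ W' ⊂ W, MAt H W') (hQ : ∀ W' ⊂ W, QAt H W') (hW : ∀ W' ⊂ W, WAt H W') : False := by
  classical
  obtain ⟨v, s, t, n, h, q, f⟩ := mc.m4 hk33 hk5 hM hQ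
  obtain ⟨k, s', t', m, h', q', g⟩ := mc.symm.m4 hk33 hk5 hM hQ
  obtain rfl := mc.hm hk33 f g
  have hp := mc.B.p
  have st := mc.B.st
  have na : n ≠ a := fun e => f.nN (e ▸ hp.aN)
  have hc : h ≠ c := fun e => f.hN (e ▸ hp.cN)
  have vh : v ≠ h := fun e => f.hN (e ▸ f.vN)
  have kn : k ≠ n := fun e => f.nN (e ▸ g.vN)
  have vk : v ≠ k := fun e => f.vAa (e ▸ g.vAc)
  obtain ⟨n1, n2, n3⟩ := L5_n (α := α) f.na f.nb f.nc f.sn f.tn f.sγ f.tγ f.nL f.qβ f.qγ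
  obtain ⟨m1, m2, m3⟩ := L5_n (α := γ) g.na g.nb g.nc g.sn g.tn g.sγ g.tγ g.nL g.qβ g.qγ
  rw [L5_comm] at m3
  have hs : W \ {a, b, c} ⊆ W := sdiff_subset
  have mem : ∀ z, z ∈ W \ {a, b, c} ↔ z ∈ W ∧ z ≠ a ∧ z ≠ b ∧ z ≠ c := by
    intro z; simp
  have cX : Conn H (insert a (insert c X)) :=
    (st.conn.insert hp.cN).insert (hp.aN.mono (subset_insert _ _))
  have hX : X ⊆ insert a (insert c X) := fun z hz => .inr (.inr hz)
  have nX : ∀ z ∈ W, z ≠ a → z ≠ c → z ∉ insert a (insert c X) := by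
    rintro z hz za zc (e | e | e)
    exacts [za e, zc e, st.dj z hz e]
  have gen : ∀ z ∈ W, z ≠ a → z ≠ b → z ≠ c → z ≠ v → z ≠ k → N H X z →
      ¬ H.Adj z a ∧ ¬ H.Adj z b ∧ ¬ H.Adj z c := by
    intro z hz za zb zc zv zk zN
    refine ⟨fun e => ?_, fun e => ?_, fun e => ?_⟩
    · rcases g.cB z hz zN e with e | e
      exacts [zb e, zk e]
    · rcases crit_b hk33 hk5 mc.B mc.cr mc.nn hz zN e with e | e
      exacts [za e, zc e]
    · rcases f.cB z hz zN e with e | e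
      exacts [zb e, zv e]
  have hLg : ∀ z ∈ W, z ≠ a → z ≠ b → z ≠ c → 3 ≤ (L z).card ∧ (¬ N H X z → 5 ≤ (L z).card) :=
    fun z hz za zb zc => mc.B.g z hz (by rintro (e | e | e); exacts [za e, zb e, zc e])
  refine F6.false (W := W \ {a, b, c}) (X := insert a (insert c X)) (b := b)
    (L := L5 H L a b c α β γ) (n := n) (h := h) (v := v) (k := k) (s := s) (t := t) (q := q)
    (s' := s') (t' := t') (q' := q') hk33 hk5
    { st := ⟨st.fin.subset hs, cX.insert (hp.bN.mono hX), ?_⟩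
      st6 := ⟨(st.fin.subset hs).insert b, cX, ?_⟩
      bN := hp.bN.mono hX
      bW := by simp
      bn := f.nb
      bh := f.hb
      g := ?_
      h3 := ?_
      nW := (mem n).2 ⟨f.nW, na, f.nb.ne, f.nc.ne⟩
      hW := (mem h).2 ⟨f.hW, f.ha.ne, f.hb.ne, hc⟩
      vW := (mem v).2 ⟨f.vW, f.va, f.vb, f.vc⟩
      kW := (mem k).2 ⟨g.vW, g.vc, g.vb, g.va⟩
      vN := f.vN.mono hX
      kN := g.vN.mono hX
      sv := mem_L5.2 ⟨f.sv, fun e => absurd e f.vAa, fun e => absurd e f.vAb, fun _ => f.sγ⟩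
      tv := mem_L5.2 ⟨f.tv, fun e => absurd e f.vAa, fun e => absurd e f.vAb, fun _ => f.tγ⟩
      sk := mem_L5.2 ⟨g.sv, fun _ => g.sγ, fun e => absurd e g.vAb, fun e => absurd e g.vAa⟩
      tk := mem_L5.2 ⟨g.tv, fun _ => g.tγ, fun e => absurd e g.vAb, fun e => absurd e g.vAa⟩
      ne1 := f.st
      ne2 := n1
      ne3 := n2
      ne1' := g.st
      ne2' := m1
      ne3' := m2
      nL := n3
      hL := m3
      nh := f.hn.symm
      nv := f.nv
      hk := g.nv
      vh := vh
      kn := kn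
      vk := vk
      no := ?_ } (hW _ (ssub_of hs hp.aW (by simp)))
  · intro z hz
    obtain ⟨zW, za, zb, zc⟩ := (mem z).1 hz
    rintro (e | e)
    exacts [zb e, nX z zW za zc e]
  · rintro z (rfl | hz)
    · exact nX _ hp.bW hp.ab.ne' hp.bc.ne
    · obtain ⟨zW, za, zb, zc⟩ := (mem z).1 hz
      exact nX z zW za zc
  · intro z hz hz'
    obtain ⟨zW, za, zb, zc⟩ := (mem z).1 hz
    have zv : z ≠ v := fun e => hz' (.inl e)
    have zk : z ≠ k := fun e => hz' (.inr e)
    obtain ⟨l1, l2⟩ := hLg z zW za zb zc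
    by_cases zN : N H X z
    · obtain ⟨g1, g2, g3⟩ := gen z zW za zb zc zv zk zN
      rw [L5_eq g1 g2 g3]
      exact ⟨l1, fun e => absurd (zN.mono (hX.trans (subset_insert _ _))) e⟩
    · have l5 := l2 zN
      have := L5_card (α := α) (β := β) (γ := γ) (L := L) (H := H) (a := a) (b := b) (c := c) (z := z)
        (fun e => mc.nh z ⟨zW, za, zb, zc, e⟩)
      refine ⟨by omega, fun e => ?_⟩
      simp only [N_insert, not_or] at e
      rw [L5_eq e.2.1 e.1 e.2.2.1]
      exact l5
  · intro z hz hle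
    obtain ⟨zW, za, zb, zc⟩ := (mem z).1 hz
    by_contra e
    simp only [N_insert, not_or] at e
    have := (hLg z zW za zb zc).2 e.2.2
    have := L5_card1 (L := L) (α := α) (β := β) (γ := γ) (b := b) e.1 e.2.1
    omega
  · rintro ⟨φ, hφ, hL⟩
    have hL' : ∀ z ∈ W, z ≠ a → z ≠ b → z ≠ c → φ z ∈ L z ∧ (H.Adj z a → φ z ≠ α) ∧
        (H.Adj z b → φ z ≠ β) ∧ (H.Adj z c → φ z ≠ γ) :=
      fun z hz za zb zc => mem_L5.1 (hL z ((mem z).2 ⟨hz, za, zb, zc⟩))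
    obtain ⟨ψ, ea, eb, ec, ez⟩ : ∃ ψ : U → ℕ, ψ a = α ∧ ψ b = β ∧ ψ c = γ ∧
        ∀ z, z ≠ a → z ≠ b → z ≠ c → ψ z = φ z := by
      refine ⟨fun z => if z = a then α else if z = b then β else if z = c then γ else φ z,
        by simp, by simp [hp.ab.ne'], by simp [hp.ac.symm, hp.bc.ne'], ?_⟩
      intro z za zb zc; simp [za, zb, zc]
    refine mc.B.bad ⟨ψ, ?_, ea, eb, ec, ?_⟩
    · have hab := mc.B.ab
      have hbc := mc.B.bc
      have hnac := mc.B.nac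
      have key : ∀ x ∈ W, ∀ y ∈ W, H.Adj x y → (x = a ∨ x = b ∨ x = c) → ψ x ≠ ψ y := by
        intro x hx y hy hxy h1
        by_cases h2 : y = a ∨ y = b ∨ y = c
        · rcases h1 with rfl | rfl | rfl <;> rcases h2 with h2 | h2 | h2 <;> rw [h2] at hxy ⊢ <;>
            first
            | (simp only [ea, eb, ec]; first | exact hab | exact hbc | exact hab.symm | exact hbc.symm)
            | exact absurd hxy hnac
            | exact absurd hxy.symm hnac
            | exact absurd rfl hxy.ne
        · push Not at h2
          obtain ⟨ya, yb, yc⟩ := h2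
          obtain ⟨-, q1, q2, q3⟩ := hL' y hy ya yb yc
          rw [ez y ya yb yc]
          rcases h1 with rfl | rfl | rfl
          · rw [ea]; exact (q1 hxy.symm).symm
          · rw [eb]; exact (q2 hxy.symm).symm
          · rw [ec]; exact (q3 hxy.symm).symm
      intro x hx y hy hxy
      by_cases h1 : x = a ∨ x = b ∨ x = c
      · exact key x hx y hy hxy h1
      by_cases h2 : y = a ∨ y = b ∨ y = c
      · exact (key y hy x hx hxy.symm h2).symm
      push Not at h1 h2
      rw [ez x h1.1 h1.2.1 h1.2.2, ez y h2.1 h2.2.1 h2.2.2]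
      exact hφ x ((mem x).2 ⟨hx, h1⟩) y ((mem y).2 ⟨hy, h2⟩) hxy
    · intro z hz za zb zc
      rw [ez z za zb zc]
      exact (hL' z hz za zb zc).1

theorem mAt (hk33 : NoK33 H) (hk5 : NoK5 H)
    (hM : ∀ W' ⊂ W, MAt H W') (hQ : ∀ W' ⊂ W, QAt H W') (hW : ∀ W' ⊂ W, WAt H W') : MAt H W := by
  intro X L a b c α β γ hB
  by_contra hno
  push Not at hno
  obtain ⟨W1, hs, hB1, hcr⟩ := hB.crit
  exact MC.false hk33 hk5 ⟨hB1, hcr, fun n hn => hno.1 n (hn.mono hs), fun x hx => hno.2 x (hx.mono hs)⟩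
    (fun W' h => hM W' (h.trans_subset hs)) (fun W' h => hQ W' (h.trans_subset hs))
    (fun W' h => hW W' (h.trans_subset hs))

theorem allAt (hk33 : NoK33 H) (hk5 : NoK5 H) (W : Set U) (hW : W.Finite) : UAt H W := by
  refine (set_ind (P := fun W => UAt H W ∧ MAt H W ∧ QAt H W ∧ WAt H W) ?_ W hW).1
  intro W _ ih
  have m : MAt H W := mAt hk33 hk5 (fun W' h => (ih W' h).2.1) (fun W' h => (ih W' h).2.2.1)
    (fun W' h => (ih W' h).2.2.2)
  have m' : ∀ W' ⊆ W, MAt H W' := by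
    intro W' h
    rcases h.eq_or_ssubset with rfl | h
    exacts [m, (ih W' h).2.1]
  have u := uAt hk33 hk5 m' (fun W' h => (ih W' h).2.2.2)
  exact ⟨u, m, qAt hk33 hk5 m' (fun W' h => (ih W' h).2.2.1), wAt hk33 hk5 u (fun W' h => (ih W' h).2.2.2)⟩

end
end BadCol

namespace BadCol
section
variable {V : Type u}

/-- transport a connected set of `G` avoiding the edge `bn` to the subdivided graph -/
theorem conn_sd (G : PlaneGraph V) {b n : V} {A : Set (Option V)}
    (hA : Conn (apex (toGraph G) G.boundaryVerts) A) (h0 : none ∉ A) (hb : some b ∉ A)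
    (hB : Set (Option V)) :
    Conn (apex (subdiv G b n) hB) (some '' A) := by
  refine ⟨hA.1.image _, ?_⟩
  have key : ∀ u v, Rch (apex (toGraph G) G.boundaryVerts) A u v →
      Rch (apex (subdiv G b n) hB) (some '' A) (some u) (some v) := by
    intro u v h
    induction h with
    | refl => exact .refl
    | @tail x y _ e ih =>
      refine ih.tail ⟨?_, ⟨x, e.2.1, rfl⟩, ⟨y, e.2.2, rfl⟩⟩
      rcases x with _ | x
      · exact absurd e.2.1 h0
      rcases y with _ | y
      · exact absurd e.2.2 h0
      refine ⟨e.1, fun h => ?_⟩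
      have hbm : b ∈ s(x, y) := by rw [h]; exact Sym2.mem_mk_left _ _
      rcases Sym2.mem_iff.1 hbm with rfl | rfl
      exacts [hb e.2.1, hb e.2.2]
  rintro _ ⟨u, hu, rfl⟩ _ ⟨v, hv, rfl⟩
  exact key u v (hA.2 u hu v hv)

theorem touch_sd (G : PlaneGraph V) {b n w : V} {A : Set (Option V)}
    (hA : N (apex (toGraph G) G.boundaryVerts) A (some w)) (h0 : none ∉ A)
    (hb : some b ∉ A) (hn : some n ∉ A) (hB : Set (Option V)) :
    Touch (apex (subdiv G b n) hB) {some (some w)} (some '' A) := by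
  obtain ⟨x, hx, hwx⟩ := hA
  rcases x with _ | x
  · exact absurd hx h0
  refine ⟨_, rfl, some (some x), ⟨_, hx, rfl⟩, hwx, fun h => ?_⟩
  have hxm : x ∈ s(b, n) := by rw [← h]; exact Sym2.mem_mk_right _ _
  rcases Sym2.mem_iff.1 hxm with rfl | rfl
  exacts [hb hx, hn hx]

theorem no_NCn (G : PlaneGraph V) {a b c : V}
    (hab : G.Adj a b) (hbc : G.Adj b c) (ha : a ∈ G.boundaryVerts) (hb : b ∈ G.boundaryVerts)
    (hc : c ∈ G.boundaryVerts)
    (hNoChord : ¬∃ u v : V, G.Adj u v ∧ G.OnOuter u ∧ G.OnOuter v ∧ ¬G.EdgeOnOuter u v) (n : Option V) :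
    ¬ NCn (apex (toGraph G) G.boundaryVerts) (some '' G.verts) {none} (some a) (some b) (some c) n := by
  rintro ⟨⟨n, hn, rfl⟩, hN, -, -, hnb, A, C, p1, p2, p3, p4, p5, p6, p7, p8, p9⟩
  have hnB : n ∈ G.boundaryVerts := N_single.1 hN
  have hbn : G.Adj b n := G.adj_symm _ _ hnb
  have hE : G.EdgeOnOuter b n := by
    by_contra hE
    exact hNoChord ⟨b, n, hbn, hb.2, hnB.2, hE⟩
  obtain ⟨D⟩ := subdiv_drawing G hbn hb.2 hnB.2 hE
  have key : ∀ S : Set (Option V), S ⊆ (some '' G.verts) \ {some b, some n} →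
      none ∉ S ∧ some b ∉ S ∧ some n ∉ S := by
    intro S hS
    refine ⟨fun h => ?_, fun h => (hS h).2 (.inl rfl), fun h => (hS h).2 (.inr rfl)⟩
    obtain ⟨x, -, hx⟩ := (hS h).1
    cases hx
  obtain ⟨a0, ab, an⟩ := key A p5
  obtain ⟨c0, cb, cn⟩ := key C p6
  set B' : Set (Option V) := insert none (some '' G.boundaryVerts) with hB'
  have bne : b ≠ n := fun e => G.adj_irrefl n (e ▸ hbn)
  refine mk_K33 D.noK33 {some (some b)} {some (some n)} {none} {some none} (some '' A) (some '' C)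
    (.singleton _) (.singleton _) (.singleton _) (.singleton _) (conn_sd G p1 a0 ab _)
    (conn_sd G p2 c0 cb _) ?_ (.ss (.inl rfl)) ?_ ?_ (.ss (.inr rfl)) ?_ ?_ (.ss (.inl rfl)) ?_ ?_
  · intro z
    refine ⟨?_, ?_, ?_, ?_, ?_⟩
    · rintro rfl; simp [bne, ab, cb]
    · rintro rfl; simp [an, cn]
    · rintro rfl; simp
    · rintro rfl; simp [a0, c0]
    · rintro ⟨x, hx, rfl⟩; simpa using p7 x hx
  · exact touch_sd G (w := b) ⟨some a, p3, G.adj_symm _ _ hab⟩ a0 ab an _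
  · exact touch_sd G (w := b) ⟨some c, p4, hbc⟩ c0 cb cn _
  · exact touch_sd G p8 a0 ab an _
  · exact touch_sd G p9 c0 cb cn _
  · exact ⟨none, rfl, some (some a), ⟨_, p3, rfl⟩, .inr ⟨a, ha, rfl⟩⟩
  · exact ⟨none, rfl, some (some c), ⟨_, p4, rfl⟩, .inr ⟨c, hc, rfl⟩⟩

/-- a colouring that does not extend is bad -/
theorem mk_Bad (G : PlaneGraph V) (a b c : V)
    (L : V → Finset ℕ)
    (hac : a ≠ c)
    (hT : IsCanvas G {a, b, c}
      (fun u v => (u = a ∧ v = b) ∨ (u = b ∧ v = a) ∨ (u = b ∧ v = c) ∨ (u = c ∧ v = b)) L)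
    (hInduced : ¬G.Adj a c) (x₁ : ℕ × ℕ × ℕ)
    (h1 : x₁.1 ∈ L a ∧ x₁.2.1 ∈ L b ∧ x₁.2.2 ∈ L c ∧ x₁.1 ≠ x₁.2.1 ∧ x₁.2.1 ≠ x₁.2.2)
    (h2 : ¬(∃ ψ : V → ℕ, (∀ v ∈ G.verts, ψ v ∈ L v) ∧ (∀ u v, G.Adj u v → ψ u ≠ ψ v) ∧
          ψ a = x₁.1 ∧ ψ b = x₁.2.1 ∧ ψ c = x₁.2.2)) :
    Bad (apex (toGraph G) G.boundaryVerts) (some '' G.verts) {none}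
      (fun o => o.elim ∅ L) (some a) (some b) (some c) x₁.1 x₁.2.1 x₁.2.2 := by
  have hB : ∀ z, z ∈ G.boundaryVerts → N (apex (toGraph G) G.boundaryVerts) {none} (some z) :=
    fun z hz => N_single.2 hz
  have mS : ∀ z ∈ ({a, b, c} : Set V), z ∈ G.boundaryVerts :=
    fun z hz => ⟨hT.sverts_sub hz, hT.sverts_outer z hz⟩
  have ma := mS a (by simp)
  have mb := mS b (by simp)
  have mc := mS c (by simp)
  obtain ⟨la, lb, lc, nab, nbc⟩ := h1
  refine ⟨⟨G.finite_verts.image _, .singleton _, ?_⟩, ⟨⟨a, ma.1, rfl⟩, ⟨b, mb.1, rfl⟩, ⟨c, mc.1, rfl⟩,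
    hB a ma, hB b mb, hB c mc, hT.sadj_sub a b (by simp), hT.sadj_sub b c (by simp), ?_⟩,
    hInduced, ?_, nab, nbc, ?_⟩
  · rintro _ ⟨z, -, rfl⟩ h
    cases h
  · simpa using hac
  · rintro _ ⟨z, hz, rfl⟩ hz'
    have hzS : z ∉ ({a, b, c} : Set V) := by simpa using hz'
    refine ⟨hT.card_outside_S z hz hzS, fun hN => hT.card_inner z hz fun ho => hN (hB z ⟨hz, ho⟩)⟩
  · rintro ⟨φ, f1, f2, f3, f4, f5⟩
    refine h2 ⟨fun v => φ (some v), ?_, ?_, f2, f3, f4⟩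
    · intro v hv
      by_cases va : v = a
      · subst va; simpa only [f2] using la
      by_cases vb : v = b
      · subst vb; simpa only [f3] using lb
      by_cases vc : v = c
      · subst vc; simpa only [f4] using lc
      exact f5 (some v) ⟨v, hv, rfl⟩ (by simpa using va) (by simpa using vb) (by simpa using vc)
    · intro u v huv
      exact f1 (some u) ⟨u, G.adj_mem _ _ huv, rfl⟩ (some v) ⟨v, G.adj_mem _ _ (G.adj_symm _ _ huv), rfl⟩ huv

end
end BadCol


/-- Lemma 2.4: let `T = (G, S, L)` be a canvas such that `S` is
an induced path `a b c` of length two. If there is no chord of the boundary of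
the outer face of `G`, then there is at most one proper `L`-coloring of `S`
(given as a triple of colors of `a, b, c`) that does not extend to an
`L`-coloring of `G`. -/
theorem at_most_one_bad_coloring {V : Type u} (G : PlaneGraph V) (a b c : V)
    (L : V → Finset ℕ)
    (hab : a ≠ b) (hbc : b ≠ c) (hac : a ≠ c)
    (hT : IsCanvas G {a, b, c}
      (fun u v => (u = a ∧ v = b) ∨ (u = b ∧ v = a) ∨ (u = b ∧ v = c) ∨ (u = c ∧ v = b)) L)
    (hInduced : ¬G.Adj a c)
    (hNoChord : ¬∃ u v : V, G.Adj u v ∧ G.OnOuter u ∧ G.OnOuter v ∧ ¬G.EdgeOnOuter u v) :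
    ∀ x₁ x₂ : ℕ × ℕ × ℕ,
      (x₁.1 ∈ L a ∧ x₁.2.1 ∈ L b ∧ x₁.2.2 ∈ L c ∧ x₁.1 ≠ x₁.2.1 ∧ x₁.2.1 ≠ x₁.2.2) →
      ¬(∃ ψ : V → ℕ, (∀ v ∈ G.verts, ψ v ∈ L v) ∧ (∀ u v, G.Adj u v → ψ u ≠ ψ v) ∧
          ψ a = x₁.1 ∧ ψ b = x₁.2.1 ∧ ψ c = x₁.2.2) →
      (x₂.1 ∈ L a ∧ x₂.2.1 ∈ L b ∧ x₂.2.2 ∈ L c ∧ x₂.1 ≠ x₂.2.1 ∧ x₂.2.1 ≠ x₂.2.2) →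
      ¬(∃ ψ : V → ℕ, (∀ v ∈ G.verts, ψ v ∈ L v) ∧ (∀ u v, G.Adj u v → ψ u ≠ ψ v) ∧
          ψ a = x₂.1 ∧ ψ b = x₂.2.1 ∧ ψ c = x₂.2.2) →
      x₁ = x₂ := by
  intro x₁ x₂ h1 h2 h3 h4
  have hB1 := BadCol.mk_Bad G a b c L hac hT hInduced x₁ h1 h2
  have hB2 := BadCol.mk_Bad G a b c L hac hT hInduced x₂ h3 h4
  have mS : ∀ z ∈ ({a, b, c} : Set V), z ∈ G.boundaryVerts :=
    fun z hz => ⟨hT.sverts_sub hz, hT.sverts_outer z hz⟩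
  obtain ⟨D⟩ := BadCol.apex_G_drawing G
  obtain ⟨e1, e2, e3⟩ := BadCol.allAt D.noK33 D.noK5 _ hB1.st.fin _ _ _ _ _ _ _ _ _ _ _ hB1 hB2
    (BadCol.no_NCn G (hT.sadj_sub a b (by simp)) (hT.sadj_sub b c (by simp))
      (mS a (by simp)) (mS b (by simp)) (mS c (by simp)) hNoChord)
  exact Prod.ext e1 (Prod.ext e2 e3)
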